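/- Let n, d be integers with d < n and let α > 0. Let K be a distance-standard radial kernel. Then: for every d-Ahlfors regular measure μ whose support E is d-rectifiable, the non-tangential limit of |∇D_{K,μ,α}| exists at H^d-almost every Q ∈ E with respect to every aperture η ∈ (0,1), if and only if K(λ·) converges in C¹_loc(ℝⁿ∖{0}), as λ ↓ 0, to some constant c_∞ > 0. -/

import Mathlib

open MeasureTheory Metric Set Filter
open scoped Topology ENNReal NNReal

noncomputable section

abbrev ES (n : ℕ) := EuclideanSpace ℝ (Fin n)

/-- The regularized "R" function `R_{K,μ,α}` with dimension parameter `d`. -/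
def RK {n : ℕ} (d α : ℝ) (K : ES n → ℝ) (μ : Measure (ES n)) (x : ES n) : ℝ :=
  ∫ y, K (x - y) / ‖x - y‖ ^ (d + α) ∂μ

/-- The regularized distance `D_{K,μ,α} = R_{K,μ,α}^{-1/α}`. -/
def DK {n : ℕ} (d α : ℝ) (K : ES n → ℝ) (μ : Measure (ES n)) (x : ES n) : ℝ :=
  RK d α K μ x ^ (-α⁻¹)

/-- `d`-dimensional Hausdorff measure restricted to a subspace. -/
def planeMeasure {n : ℕ} (d : ℕ) (E : Submodule ℝ (ES n)) : Measure (ES n) :=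
  (μH[(d : ℝ)]).restrict (E : Set (ES n))

/-- `K` is `(d,α)`-distance-exact. -/
def DistExact (n d : ℕ) (α : ℝ) (K : ES n → ℝ) : Prop :=
  ∀ E : Submodule ℝ (ES n), Module.finrank ℝ ↥E = d →
    ∃ c : ℝ, ∀ x ∉ E, DK (d : ℝ) α K (planeMeasure d E) x = c * infDist x (E : Set (ES n))

/-- `K` is `(d,α)`-distance-orthogonal. -/
def DistOrth (n d : ℕ) (α : ℝ) (K : ES n → ℝ) : Prop :=
  ∀ E : Submodule ℝ (ES n), Module.finrank ℝ ↥E = d →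
    ∀ x ∉ E, RK (d : ℝ) α K (planeMeasure d E) x = 0

/-- `K` is a distance-standard kernel. -/
def DistStandard {n : ℕ} (K : ES n → ℝ) : Prop :=
  ContDiffOn ℝ 2 K {0}ᶜ ∧
  (∀ m : ℕ, m ≤ 2 → ∃ C : ℝ, ∀ x : ES n, x ≠ 0 →
      ‖iteratedFDerivWithin ℝ m K {0}ᶜ x‖ * ‖x‖ ^ m ≤ C) ∧
  ∃ c > 0, ∀ x : ES n, x ≠ 0 → c ≤ K x

/-- The square function `F_{K,μ,α}` relative to the set `E`. -/
def FK {n : ℕ} (d α : ℝ) (K : ES n → ℝ) (μ : Measure (ES n)) (E : Set (ES n)) (x : ES n) : ℝ :=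
  infDist x E * ‖gradient (fun y => ‖gradient (DK d α K μ) y‖ ^ 2) x‖

/-- `D_{K,μ,α}` satisfies the usual square function estimate (USFE) outside `E`. -/
def SatisfiesUSFE {n : ℕ} (d α : ℝ) (K : ES n → ℝ) (μ : Measure (ES n)) (E : Set (ES n)) : Prop :=
  ∃ C : ℝ, ∀ Q ∈ E, ∀ r > 0,
    (∫ x in ball Q r ∩ Eᶜ, (FK d α K μ E x) ^ 2 * infDist x E ^ (d - (n : ℝ))) ≤ C * r ^ d

/-- The support of a measure on a metric space. -/
def msupp {X : Type*} [PseudoMetricSpace X] [MeasurableSpace X] (μ : Measure X) : Set X :=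
  {x | ∀ r > 0, 0 < μ (ball x r)}

/-- `μ` is `d`-Ahlfors regular with constant `C`. -/
def IsAhlfors {n : ℕ} (d : ℝ) (μ : Measure (ES n)) (C : ℝ) : Prop :=
  1 ≤ C ∧ ∀ Q ∈ msupp μ, ∀ R > 0,
    ENNReal.ofReal (C⁻¹ * R ^ d) ≤ μ (ball Q R) ∧ μ (ball Q R) ≤ ENNReal.ofReal (C * R ^ d)

/-- A non-tangential cone of aperture `η` and radius `R` at `Q`. -/
def NTcone {n : ℕ} (E : Set (ES n)) (Q : ES n) (R η : ℝ) : Set (ES n) :=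
  {x | x ∉ E ∧ dist x Q < R ∧ η * dist x Q ≤ infDist x E}

/-- `f` has non-tangential limit `L` at `Q` with aperture `η`. -/
def HasNTLimit {n : ℕ} (E : Set (ES n)) (f : ES n → ℝ) (Q : ES n) (η L : ℝ) : Prop :=
  ∀ ε > 0, ∃ R > 0, ∀ x ∈ NTcone E Q R η, |f x - L| < ε

/-- A set `E ⊆ ℝⁿ` is `d`-rectifiable. -/
def RectSet (n d : ℕ) (E : Set (ES n)) : Prop :=
  ∃ f : ℕ → (EuclideanSpace ℝ (Fin d) → ES n),
    (∀ i, ∃ L : ℝ≥0, LipschitzWith L (f i)) ∧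
    μH[(d : ℝ)] (E \ ⋃ i, Set.range (f i)) = 0

/-- A measure `μ` is `d`-rectifiable. -/
def RectMeasure (n d : ℕ) (μ : Measure (ES n)) : Prop :=
  μ ≪ μH[(d : ℝ)] ∧ ∃ S : Set (ES n), MeasurableSet S ∧ RectSet n d S ∧ μ Sᶜ = 0

/-- A set `E ⊆ ℝⁿ` is `d`-uniformly rectifiable (the Lipschitz images condition). -/
def UnifRect (n d : ℕ) (E : Set (ES n)) : Prop :=
  ∃ (M : ℝ≥0) (θ : ℝ), 0 < θ ∧ ∀ Q ∈ E, ∀ R > 0,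
    ∃ f : EuclideanSpace ℝ (Fin d) → ES n, LipschitzOnWith M f (ball 0 R) ∧
      ENNReal.ofReal (θ * R ^ d) ≤ μH[(d : ℝ)] (E ∩ ball Q R ∩ f '' (ball 0 R))

end

/-- Quantitative first- and second-order bounds of a distance-standard kernel. -/
structure KernelBounds {n : ℕ} (K : ES n → ℝ) (B c : ℝ) : Prop where
  pos_B : 0 < B
  pos_c : 0 < c
  lower : ∀ x, x ≠ 0 → c ≤ K x
  upper : ∀ x, x ≠ 0 → |K x| ≤ B
  diff : ∀ x, x ≠ 0 → DifferentiableAt ℝ K x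
  fderiv_le : ∀ x, x ≠ 0 → ‖fderiv ℝ K x‖ * ‖x‖ ≤ B
  diff_fderiv : ∀ x, x ≠ 0 → DifferentiableAt ℝ (fderiv ℝ K) x
  fderiv_fderiv_le : ∀ x, x ≠ 0 → ‖fderiv ℝ (fderiv ℝ K) x‖ * ‖x‖ ^ 2 ≤ B

theorem DistStandard.exists_kernelBounds {n : ℕ} {K : ES n → ℝ} (hK : DistStandard K) :
    ∃ B c, KernelBounds K B c := by
  obtain ⟨hC, hb, c, hc, hlow⟩ := hK
  obtain ⟨B0, h0⟩ := hb 0 (by norm_num)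
  obtain ⟨B1, h1⟩ := hb 1 (by norm_num)
  obtain ⟨B2, h2⟩ := hb 2 (by norm_num)
  have hopen : IsOpen ({0}ᶜ : Set (ES n)) := isOpen_compl_singleton
  have hu : UniqueDiffOn ℝ ({0}ᶜ : Set (ES n)) := hopen.uniqueDiffOn
  have hmem : ∀ x : ES n, x ≠ 0 → ({0}ᶜ : Set (ES n)) ∈ 𝓝 x := fun x hx => hopen.mem_nhds hx
  have hdf : ∀ x : ES n, x ≠ 0 → fderivWithin ℝ K {0}ᶜ x = fderiv ℝ K x :=
    fun x hx => fderivWithin_of_mem_nhds (hmem x hx)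
  have hC1 : ContDiffOn ℝ 1 (fderiv ℝ K) {0}ᶜ :=
    hC.fderiv_of_isOpen hopen (by norm_num)
  have B0' : B0 ≤ max 1 (max B0 (max B1 B2)) := by simp
  have B1' : B1 ≤ max 1 (max B0 (max B1 B2)) := by simp
  have B2' : B2 ≤ max 1 (max B0 (max B1 B2)) := by simp
  refine ⟨max 1 (max B0 (max B1 B2)), c, by positivity, hc, hlow, fun x hx => ?_, fun x hx => ?_,
    fun x hx => ?_, fun x hx => ?_, fun x hx => ?_⟩
  · have := h0 x hx
    simp at this
    exact this.trans (by simp)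
  · exact (hC.contDiffAt (hmem x hx)).differentiableAt (by norm_num)
  · have := h1 x hx
    rw [norm_iteratedFDerivWithin_one _ (hu x hx), hdf x hx, pow_one] at this
    exact this.trans B1'
  · exact (hC1.contDiffAt (hmem x hx)).differentiableAt (by norm_num)
  · have := h2 x hx
    rw [← norm_iteratedFDerivWithin_fderivWithin hu hx,
      norm_iteratedFDerivWithin_one _ (hu x hx),
      fderivWithin_of_mem_nhds (hmem x hx)] at this
    rw [Filter.EventuallyEq.fderiv_eq (f₁ := fderiv ℝ K) (f := fderivWithin ℝ K {0}ᶜ)]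
    · exact this.trans B2'
    · filter_upwards [hmem x hx] with y hy using (hdf y hy).symm

noncomputable section

/-- The kernel `K(z)/|z|^s`. -/
def kern {n : ℕ} (s : ℝ) (K : ES n → ℝ) (z : ES n) : ℝ := K z / ‖z‖ ^ s

/-- The derivative of `kern s K` away from the origin. -/
def kernDeriv {n : ℕ} (s : ℝ) (K : ES n → ℝ) (z : ES n) : ES n →L[ℝ] ℝ :=
  ‖z‖ ^ (-s) • fderiv ℝ K z - (s * K z * ‖z‖ ^ (-s - 2)) • innerSL ℝ z

end

theorem hasFDerivAt_norm_rpow_neg {n : ℕ} (s : ℝ) {z : ES n} (hz : z ≠ 0) :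
    HasFDerivAt (fun z : ES n => ‖z‖ ^ (-s)) ((-(s * ‖z‖ ^ (-s - 2))) • innerSL ℝ z) z := by
  have hz' : 0 < ‖z‖ := norm_pos_iff.2 hz
  have h1 : HasFDerivAt (fun z : ES n => ‖z‖ ^ 2) (2 • (innerSL ℝ z)) z :=
    (hasStrictFDerivAt_norm_sq z).hasFDerivAt
  have h2 := h1.rpow_const (p := -s / 2) (Or.inl (by positivity))
  have e : (fun z : ES n => ‖z‖ ^ (-s)) = fun z : ES n => (‖z‖ ^ 2) ^ (-s / 2) := by
    ext w
    rw [← Real.rpow_natCast, ← Real.rpow_mul (norm_nonneg _)]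
    congr 1; push_cast; ring
  rw [e]
  refine h2.congr_fderiv ?_
  rw [← Real.rpow_natCast, ← Real.rpow_mul (norm_nonneg _), ← Nat.cast_smul_eq_nsmul ℝ, smul_smul]
  congr 1
  have : ((2 : ℕ) : ℝ) * (-s / 2 - 1) = -s - 2 := by push_cast; ring
  rw [this]; push_cast; ring

theorem hasFDerivAt_kern {n : ℕ} {K : ES n → ℝ} (s : ℝ) {z : ES n} (hz : z ≠ 0)
    (hK : DifferentiableAt ℝ K z) : HasFDerivAt (kern s K) (kernDeriv s K z) z := by
  have h := hK.hasFDerivAt.mul (hasFDerivAt_norm_rpow_neg s hz)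
  have e : kern s K = fun z => K z * ‖z‖ ^ (-s) := by
    ext w
    rw [kern, Real.rpow_neg (norm_nonneg _), div_eq_mul_inv]
  rw [e]
  refine h.congr_fderiv ?_
  rw [kernDeriv]
  module

section KernelEstimates

variable {n : ℕ} {K : ES n → ℝ} {B c : ℝ}

theorem KernelBounds.norm_kern_le (h : KernelBounds K B c) (s : ℝ) {z : ES n} (hz : z ≠ 0) :
    ‖kern s K z‖ ≤ B * ‖z‖ ^ (-s) := by
  rw [kern, norm_div, Real.norm_eq_abs, Real.norm_of_nonneg (by positivity),
    Real.rpow_neg (norm_nonneg _), div_eq_mul_inv]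
  gcongr
  exact h.upper z hz

theorem KernelBounds.norm_kernDeriv_le (h : KernelBounds K B c) {s : ℝ} (hs : 0 < s) {z : ES n}
    (hz : z ≠ 0) : ‖kernDeriv s K z‖ ≤ (1 + s) * B * ‖z‖ ^ (-s - 1) := by
  have hz' : 0 < ‖z‖ := norm_pos_iff.2 hz
  refine (norm_sub_le _ _).trans ?_
  rw [norm_smul, norm_smul, innerSL_apply_norm, Real.norm_of_nonneg (by positivity), norm_mul,
    norm_mul, Real.norm_of_nonneg hs.le, Real.norm_of_nonneg (Real.rpow_nonneg hz'.le _),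
    Real.norm_eq_abs]
  have e1 : ‖z‖ ^ (-s) = ‖z‖ ^ (-s - 1) * ‖z‖ := by
    rw [← Real.rpow_add_one hz'.ne']; congr 1; ring
  have e2 : ‖z‖ ^ (-s - 1) = ‖z‖ ^ (-s - 2) * ‖z‖ := by
    rw [← Real.rpow_add_one hz'.ne']; congr 1; ring
  have h1 : ‖z‖ ^ (-s) * ‖fderiv ℝ K z‖ ≤ ‖z‖ ^ (-s - 1) * B := by
    rw [e1, mul_assoc]
    gcongr
    rw [mul_comm]; exact h.fderiv_le z hz
  have h2 : s * |K z| * ‖z‖ ^ (-s - 2) * ‖z‖ ≤ s * B * ‖z‖ ^ (-s - 1) := by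
    rw [e2, ← mul_assoc]
    gcongr
    exact h.upper z hz
  calc _ ≤ ‖z‖ ^ (-s - 1) * B + s * B * ‖z‖ ^ (-s - 1) := by gcongr
    _ = _ := by ring

theorem KernelBounds.continuousOn (h : KernelBounds K B c) : ContinuousOn K {0}ᶜ :=
  fun x hx => (h.diff x hx).continuousAt.continuousWithinAt

theorem KernelBounds.measurable (h : KernelBounds K B c) : Measurable K :=
  measurable_of_continuousOn_compl_singleton 0 h.continuousOn

theorem KernelBounds.measurable_kern (h : KernelBounds K B c) (s : ℝ) : Measurable (kern s K) :=
  h.measurable.div (measurable_norm.pow_const s)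

theorem KernelBounds.measurable_kernDeriv (h : KernelBounds K B c) (s : ℝ) :
    Measurable (kernDeriv s K) :=
  ((measurable_norm.pow_const _).smul (measurable_fderiv ℝ K)).sub
    (((h.measurable.const_mul s).mul (measurable_norm.pow_const _)).smul
      (innerSL ℝ).continuous.measurable)

end KernelEstimates

section Growth

variable {X : Type*} [PseudoMetricSpace X] [MeasurableSpace X] [OpensMeasurableSpace X]

theorem measurable_weight (x : X) (r s : ℝ) :
    Measurable fun y : X => (1 + dist y x / r) ^ (-s) :=
  (((continuous_id.dist continuous_const).measurable.div_const r).const_add 1).pow_const _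

theorem lintegral_weight_le_lintegral_ball (σ : Measure X) (x : X) {r s : ℝ} (hr : 0 < r)
    (hs : 0 < s) :
    ∫⁻ y, ENNReal.ofReal ((1 + dist y x / r) ^ (-s)) ∂σ ≤
      ∫⁻ t in Ioo (0 : ℝ) 1, σ (ball x (r * t ^ (-s⁻¹))) := by
  rw [lintegral_eq_lintegral_meas_lt σ (Eventually.of_forall fun y => by positivity)
    (measurable_weight x r s).aemeasurable,
    show Ioo (0 : ℝ) 1 = Ioo 0 1 ∩ Ioi 0 from (inter_eq_left.2 Ioo_subset_Ioi_self).symm,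
    ← Measure.restrict_restrict measurableSet_Ioo, ← lintegral_indicator measurableSet_Ioo]
  refine setLIntegral_mono' measurableSet_Ioi fun t (ht : 0 < t) => ?_
  by_cases h1 : t < 1
  · rw [indicator_of_mem (show t ∈ Ioo (0 : ℝ) 1 from ⟨ht, h1⟩)]
    refine measure_mono fun y (hy : t < (1 + dist y x / r) ^ (-s)) => ?_
    have hb : 0 < 1 + dist y x / r := by positivity
    have h2 : 1 + dist y x / r < t ^ (-s⁻¹) := by
      have h3 : ((1 + dist y x / r) ^ (-s)) ^ (-s⁻¹) = 1 + dist y x / r := by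
        rw [← Real.rpow_mul hb.le, neg_mul_neg, mul_inv_cancel₀ hs.ne', Real.rpow_one]
      rw [← h3]
      exact Real.rpow_lt_rpow_of_neg ht hy (by simpa using hs)
    have h4 : dist y x / r < t ^ (-s⁻¹) := by linarith
    rw [mem_ball]
    rwa [div_lt_iff₀' hr] at h4
  · have : {a : X | t < (1 + dist a x / r) ^ (-s)} = ∅ := by
      refine eq_empty_of_forall_notMem fun y hy => h1 ?_
      refine lt_of_lt_of_le hy (Real.rpow_le_one_of_one_le_of_nonpos ?_ (by linarith))
      have : 0 ≤ dist y x / r := by positivity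
      linarith
    rw [this]; simp

theorem lintegral_Ioo_rpow_lt_top {d s : ℝ} (hs : 0 < s) (hds : d < s) :
    ∫⁻ t in Ioo (0 : ℝ) 1, ENNReal.ofReal (t ^ (-(d / s))) < ∞ := by
  have : IntegrableOn (fun t : ℝ => t ^ (-(d / s))) (Ioo 0 1) := by
    rw [intervalIntegral.integrableOn_Ioo_rpow_iff one_pos, neg_lt_neg_iff, div_lt_one hs]
    exact hds
  exact this.lintegral_lt_top

theorem ofReal_mul_rpow_scale {C r t d s : ℝ} (hr : 0 < r) (ht : 0 < t) (hC : 0 ≤ C) :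
    ENNReal.ofReal (C * (r * t ^ (-s⁻¹)) ^ d) =
      ENNReal.ofReal (C * r ^ d) * ENNReal.ofReal (t ^ (-(d / s))) := by
  rw [← ENNReal.ofReal_mul (by positivity), Real.mul_rpow hr.le (by positivity),
    ← Real.rpow_mul ht.le, mul_assoc]
  congr 4
  ring

theorem lintegral_weight_le {σ : Measure X} {x : X} {C r d s : ℝ} (hr : 0 < r) (hs : 0 < s)
    (hC : 0 ≤ C) (hσ : ∀ ρ > 0, σ (ball x ρ) ≤ ENNReal.ofReal (C * ρ ^ d)) :
    ∫⁻ y, ENNReal.ofReal ((1 + dist y x / r) ^ (-s)) ∂σ ≤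
      ENNReal.ofReal (C * r ^ d) *
        ∫⁻ t in Ioo (0 : ℝ) 1, ENNReal.ofReal (t ^ (-(d / s))) := by
  refine (lintegral_weight_le_lintegral_ball σ x hr hs).trans ?_
  rw [← lintegral_const_mul' _ _ ENNReal.ofReal_ne_top]
  refine setLIntegral_mono' measurableSet_Ioo fun t ht => ?_
  rw [← ofReal_mul_rpow_scale hr ht.1 hC]
  exact hσ _ (by have := ht.1; positivity)

theorem tendsto_lintegral_weight_div {σ : Measure X} {x : X} {C d s : ℝ} (hs : 0 < s)
    (hds : d < s) (hC : 0 ≤ C) (hσ : ∀ ρ > 0, σ (ball x ρ) ≤ ENNReal.ofReal (C * ρ ^ d))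
    (hlim : Tendsto (fun ρ => σ (ball x ρ) / ENNReal.ofReal (ρ ^ d)) (𝓝[>] 0) (𝓝 0))
    {r : ℕ → ℝ} (hr : ∀ i, 0 < r i) (hr0 : Tendsto r atTop (𝓝 0)) :
    Tendsto (fun i => (∫⁻ y, ENNReal.ofReal ((1 + dist y x / r i) ^ (-s)) ∂σ) /
      ENNReal.ofReal (r i ^ d)) atTop (𝓝 0) := by
  have hmono : Monotone fun ρ => σ (ball x ρ) := fun a b hab => measure_mono (ball_subset_ball hab)
  have hpos : ∀ i, 0 < r i ^ d := fun i => Real.rpow_pos_of_pos (hr i) d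
  have key : Tendsto (fun i => ∫⁻ t in Ioo (0 : ℝ) 1,
      σ (ball x (r i * t ^ (-s⁻¹))) / ENNReal.ofReal (r i ^ d)) atTop
      (𝓝 (∫⁻ t in Ioo (0 : ℝ) 1, 0)) := by
    refine tendsto_lintegral_of_dominated_convergence
      (fun t => ENNReal.ofReal C * ENNReal.ofReal (t ^ (-(d / s)))) (fun i => ?_) (fun i => ?_) ?_ ?_
    · exact (hmono.measurable.comp ((measurable_id.pow_const _).const_mul _)).div_const _
    · filter_upwards [ae_restrict_mem measurableSet_Ioo] with t ht
      refine ENNReal.div_le_of_le_mul ?_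
      refine (hσ _ (mul_pos (hr i) (Real.rpow_pos_of_pos ht.1 _))).trans (le_of_eq ?_)
      rw [ofReal_mul_rpow_scale (hr i) ht.1 hC, ENNReal.ofReal_mul hC]
      ring
    · rw [lintegral_const_mul' _ _ ENNReal.ofReal_ne_top]
      exact ENNReal.mul_ne_top ENNReal.ofReal_ne_top (lintegral_Ioo_rpow_lt_top hs hds).ne
    · filter_upwards [ae_restrict_mem measurableSet_Ioo] with t ht
      have hu : 0 < t ^ (-s⁻¹) := Real.rpow_pos_of_pos ht.1 _
      have h1 : Tendsto (fun i => r i * t ^ (-s⁻¹)) atTop (𝓝[>] 0) := by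
        refine tendsto_nhdsWithin_iff.2 ⟨by simpa using hr0.mul_const (t ^ (-s⁻¹)), ?_⟩
        exact Eventually.of_forall fun i => mul_pos (hr i) hu
      have h2 := ENNReal.Tendsto.mul_const (b := ENNReal.ofReal ((t ^ (-s⁻¹)) ^ d))
        (hlim.comp h1) (Or.inr ENNReal.ofReal_ne_top)
      rw [zero_mul] at h2
      refine h2.congr fun i => ?_
      have hud : 0 < (t ^ (-s⁻¹)) ^ d := Real.rpow_pos_of_pos hu d
      simp only [Function.comp]
      rw [Real.mul_rpow (hr i).le hu.le, ENNReal.ofReal_mul (hpos i).le,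
        ← ENNReal.mul_div_right_comm,
        ENNReal.mul_div_mul_right _ _ (by simpa using hud) ENNReal.ofReal_ne_top]
  rw [lintegral_zero] at key
  refine tendsto_of_tendsto_of_tendsto_of_le_of_le tendsto_const_nhds key (fun _ => zero_le) ?_
  intro i
  simp only [div_eq_mul_inv]
  rw [lintegral_mul_const']
  · gcongr
    exact lintegral_weight_le_lintegral_ball σ x (hr i) hs
  · simpa using hpos i

end Growth

theorem isClosed_msupp {X : Type*} [PseudoMetricSpace X] [MeasurableSpace X] (μ : Measure X) :
    IsClosed (msupp μ) := by
  refine isClosed_of_closure_subset fun x hx r hr => ?_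
  obtain ⟨y, hy, hxy⟩ := Metric.mem_closure_iff.1 hx (r / 2) (by positivity)
  refine (hy (r / 2) (by positivity)).trans_le (measure_mono ?_)
  refine ball_subset_ball' ?_
  rw [dist_comm]; linarith

theorem measure_compl_msupp {X : Type*} [PseudoMetricSpace X] [SecondCountableTopology X]
    [MeasurableSpace X] (μ : Measure X) : μ (msupp μ)ᶜ = 0 := by
  refine measure_null_of_locally_null _ fun x hx => ?_
  simp only [msupp, mem_compl_iff, mem_ofPred_eq, not_forall, not_lt, nonpos_iff_eq_zero] at hx
  obtain ⟨r, hr, h⟩ := hx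
  exact ⟨ball x r, mem_nhdsWithin_of_mem_nhds (ball_mem_nhds x hr), h⟩

section Ahlfors

variable {n : ℕ} {d C : ℝ} {μ : Measure (ES n)}

theorem IsAhlfors.isLocallyFiniteMeasure (h : IsAhlfors d μ C) : IsLocallyFiniteMeasure μ := by
  refine ⟨fun x => ?_⟩
  by_cases hx : x ∈ msupp μ
  · exact ⟨ball x 1, ball_mem_nhds x one_pos,
      (h.2 x hx 1 one_pos).2.trans_lt ENNReal.ofReal_lt_top⟩
  · simp only [msupp, mem_ofPred_eq, not_forall, not_lt, nonpos_iff_eq_zero] at hx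
    obtain ⟨r, hr, h⟩ := hx
    exact ⟨ball x r, ball_mem_nhds x hr, by simp [h]⟩

theorem IsAhlfors.measure_le_ediam (h : IsAhlfors d μ C) (hd : 0 ≤ d) (s : Set (ES n))
    (hs : ediam s ≠ ∞) : μ s ≤ ENNReal.ofReal C * ediam s ^ d := by
  by_cases hne : (s ∩ msupp μ).Nonempty
  · obtain ⟨Q, hQs, hQ⟩ := hne
    have hb : ∀ R > (ediam s).toReal, μ s ≤ ENNReal.ofReal (C * R ^ d) := fun R hR => by
      refine (measure_mono fun y hy => ?_).trans
        (h.2 Q hQ R (ENNReal.toReal_nonneg.trans_lt hR)).2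
      rw [mem_ball]
      refine lt_of_le_of_lt ?_ hR
      rw [dist_edist]
      exact ENNReal.toReal_mono hs (edist_le_ediam_of_mem hy hQs)
    have hc : Tendsto (fun R : ℝ => ENNReal.ofReal (C * R ^ d)) (𝓝[>] (ediam s).toReal)
        (𝓝 (ENNReal.ofReal (C * (ediam s).toReal ^ d))) := by
      refine ENNReal.tendsto_ofReal (Tendsto.mono_left ?_ nhdsWithin_le_nhds)
      exact ((Real.continuousAt_rpow_const _ _ (Or.inr hd)).tendsto).const_mul C
    have := ge_of_tendsto hc (eventually_nhdsWithin_of_forall hb)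
    rwa [ENNReal.ofReal_mul (by linarith [h.1]), ← ENNReal.ofReal_rpow_of_nonneg
      ENNReal.toReal_nonneg hd, ENNReal.ofReal_toReal hs] at this
  · have : μ s ≤ μ (msupp μ)ᶜ := measure_mono fun y hy hy' => hne ⟨y, hy, hy'⟩
    rw [measure_compl_msupp] at this
    exact this.trans zero_le

theorem IsAhlfors.measure_le_hausdorff (h : IsAhlfors d μ C) (hd : 0 ≤ d) (s : Set (ES n)) :
    μ s ≤ ENNReal.ofReal C * μH[d] s := by
  have hC : 0 < C := by linarith [h.1]
  have hC' : ENNReal.ofReal C ≠ 0 := by simpa using hC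
  have key : (ENNReal.ofReal C)⁻¹ • μ ≤ μH[d] := by
    refine Measure.le_hausdorffMeasure d _ 1 one_pos fun s hs => ?_
    rw [Measure.smul_apply, smul_eq_mul, ENNReal.inv_mul_le_iff hC' ENNReal.ofReal_ne_top]
    exact h.measure_le_ediam hd s (hs.trans_lt ENNReal.one_lt_top).ne
  have := key s
  rwa [Measure.smul_apply, smul_eq_mul, ENNReal.inv_mul_le_iff hC' ENNReal.ofReal_ne_top] at this

theorem IsAhlfors.exists_countable_cover (h : IsAhlfors d μ C) (hd : 0 ≤ d) {N : Set (ES n)}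
    (hN : N ⊆ msupp μ) (h0 : μ N = 0) {δ : ℝ} (hδ : 0 < δ) :
    ∃ (u : Set (ES n)) (t : ES n → Set (ES n)), u.Countable ∧ (N ⊆ ⋃ b : u, t b) ∧
      (∀ b ∈ u, ediam (t b) ≤ ENNReal.ofReal (8 * δ)) ∧
      ∑' b : u, ediam (t b) ^ d ≤ ENNReal.ofReal (8 ^ d * C) * ENNReal.ofReal δ := by
  have := h.isLocallyFiniteMeasure
  have hC : 0 < C := by linarith [h.1]
  obtain ⟨U, hNU, hU, hμU⟩ := N.exists_isOpen_lt_of_lt (μ := μ) (ENNReal.ofReal δ)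
    (by rw [h0]; simpa using hδ)
  have hex : ∀ Q ∈ N, ∃ ρ > 0, ρ < δ ∧ closedBall Q ρ ⊆ U := fun Q hQ => by
    obtain ⟨ε, hε, hb⟩ := Metric.isOpen_iff.1 hU Q (hNU hQ)
    have hm : 0 < min ε δ := lt_min hε hδ
    refine ⟨min ε δ / 2, by positivity, by linarith [min_le_right ε δ], ?_⟩
    exact (closedBall_subset_ball (by linarith [min_le_left ε δ])).trans hb
  choose! ρ hρ0 hρδ hρU using hex
  obtain ⟨u, huN, hdisj, hcov⟩ := Vitali.exists_disjoint_subfamily_covering_enlargement_closedBall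
    N (fun x => x) ρ δ (fun a ha => (hρδ a ha).le) 4 (by norm_num)
  have hcount : u.Countable := hdisj.countable_of_nonempty_interior fun a ha => by
    refine ⟨a, ball_subset_interior_closedBall (mem_ball_self (hρ0 a (huN ha)))⟩
  have hdiam : ∀ b ∈ u, ediam (closedBall b (4 * ρ b)) ≤ ENNReal.ofReal (8 * ρ b) := fun b hb => by
    have h1 := hρ0 b (huN hb)
    refine ediam_le_of_forall_dist_le fun x hx y hy => ?_
    rw [mem_closedBall] at hx hy
    linarith [dist_triangle_right x y b]
  refine ⟨u, fun b => closedBall b (4 * ρ b), hcount, fun x hx => ?_, fun b hb => ?_, ?_⟩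
  · obtain ⟨b, hb, hsub⟩ := hcov x hx
    exact mem_iUnion.2 ⟨⟨b, hb⟩, hsub (mem_closedBall_self (hρ0 x hx).le)⟩
  · refine (hdiam b hb).trans (ENNReal.ofReal_le_ofReal ?_)
    linarith [hρδ b (huN hb)]
  · have : Countable u := hcount
    calc ∑' b : u, ediam (closedBall (b : ES n) (4 * ρ b)) ^ d
        ≤ ∑' b : u, ENNReal.ofReal (8 ^ d * C) * μ (closedBall (b : ES n) (ρ b)) := by
          refine ENNReal.tsum_le_tsum fun (b : u) => ?_
          have h1 := hρ0 b (huN b.2)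
          calc ediam (closedBall (b : ES n) (4 * ρ b)) ^ d
              ≤ ENNReal.ofReal (8 * ρ b) ^ d := ENNReal.rpow_le_rpow (hdiam b b.2) hd
            _ = ENNReal.ofReal (8 ^ d * C) * ENNReal.ofReal (C⁻¹ * ρ b ^ d) := by
              rw [ENNReal.ofReal_rpow_of_pos (by positivity), ← ENNReal.ofReal_mul (by positivity),
                Real.mul_rpow (by norm_num) h1.le]
              congr 1; field_simp
            _ ≤ _ := by
              gcongr
              exact (h.2 b (hN (huN b.2)) (ρ b) h1).1.trans (measure_mono ball_subset_closedBall)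
      _ = ENNReal.ofReal (8 ^ d * C) * μ (⋃ b : u, closedBall (b : ES n) (ρ b)) := by
          rw [ENNReal.tsum_mul_left, measure_iUnion]
          · intro a b hab
            exact hdisj a.2 b.2 (fun e => hab (Subtype.ext e))
          · exact fun b => measurableSet_closedBall
      _ ≤ _ := by
          gcongr
          exact (measure_mono (iUnion_subset fun b : u => hρU b (huN b.2))).trans hμU.le

theorem IsAhlfors.hausdorff_null (h : IsAhlfors d μ C) (hd : 0 ≤ d) {N : Set (ES n)}
    (hN : N ⊆ msupp μ) (h0 : μ N = 0) : μH[d] N = 0 := by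
  choose u t hu hcov hdiam hsum using fun k : ℕ =>
    h.exists_countable_cover hd hN h0 (δ := 1 / ((k : ℝ) + 1)) (by positivity)
  have hl : Tendsto (fun k : ℕ => ENNReal.ofReal (1 / ((k : ℝ) + 1))) atTop (𝓝 0) := by
    simpa using ENNReal.tendsto_ofReal (tendsto_one_div_add_atTop_nhds_zero_nat (𝕜 := ℝ))
  have : ∀ k, Countable (u k) := hu
  have hle := Measure.hausdorffMeasure_le_liminf_tsum (ι := fun k : ℕ => u k) d N (l := atTop)
    (fun k : ℕ => ENNReal.ofReal (8 * (1 / ((k : ℝ) + 1)))) ?_ (fun k b => t k b)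
    (Eventually.of_forall fun k b => hdiam k b b.2) (Eventually.of_forall hcov)
  · refine le_antisymm (hle.trans ?_) zero_le
    have h2 : Tendsto (fun k : ℕ => ENNReal.ofReal (8 ^ d * C) *
        ENNReal.ofReal (1 / ((k : ℝ) + 1))) atTop (𝓝 0) := by
      simpa using ENNReal.Tendsto.const_mul hl (Or.inr ENNReal.ofReal_ne_top)
    exact (liminf_le_liminf (Eventually.of_forall hsum)).trans h2.liminf_eq.le
  · simp_rw [ENNReal.ofReal_mul (show (0 : ℝ) ≤ 8 by norm_num)]
    simpa using ENNReal.Tendsto.const_mul (a := ENNReal.ofReal 8) hl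
      (Or.inr ENNReal.ofReal_ne_top)

end Ahlfors

section Blowup

variable {n d : ℕ}

theorem lintegral_comp_add_smul (x : ES d) {r : ℝ} (hr : 0 < r) (g : ES d → ℝ≥0∞) :
    ∫⁻ z, g z = ENNReal.ofReal (r ^ (d : ℝ)) * ∫⁻ ζ, g (x + r • ζ) := by
  have hm : MeasurableEmbedding fun ζ : ES d => r • ζ :=
    (Homeomorph.smulOfNeZero r hr.ne').measurableEmbedding
  have h := Measure.map_addHaar_smul (volume : Measure (ES d)) hr.ne'
  have h1 : ∫⁻ ζ, g (x + r • ζ) = ∫⁻ z, g (x + z) ∂(Measure.map (r • ·) volume) :=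
    (hm.lintegral_map (fun z => g (x + z))).symm
  rw [h1, h, lintegral_smul_measure, lintegral_add_left_eq_self, finrank_euclideanSpace_fin,
    smul_eq_mul, ← mul_assoc, ← ENNReal.ofReal_mul (by positivity), Real.rpow_natCast,
    abs_of_pos (by positivity), mul_inv_cancel₀ (by positivity), ENNReal.ofReal_one, one_mul]

theorem integral_comp_inv_smul_sub {F : Type*} [NormedAddCommGroup F] [NormedSpace ℝ F]
    (x : ES d) {r : ℝ} (hr : 0 < r) (g : ES d → F) :
    ∫ z, g (r⁻¹ • (z - x)) = r ^ (d : ℝ) • ∫ ζ, g ζ := by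
  rw [integral_sub_right_eq_self (fun z => g (r⁻¹ • z)) x, Measure.integral_comp_inv_smul,
    finrank_euclideanSpace_fin, Real.rpow_natCast, abs_of_pos (by positivity)]

theorem volume_ball_le (x : ES d) {ρ : ℝ} (hρ : 0 < ρ) :
    volume (ball x ρ) = ENNReal.ofReal (ρ ^ (d : ℝ)) * volume (ball (0 : ES d) 1) := by
  rw [Measure.addHaar_ball_of_pos _ _ hρ, finrank_euclideanSpace_fin, Real.rpow_natCast]

/-- Blow-ups of `μ` at `Q` at any sequence of scales converge to `θ` times the image of Lebesgue
measure under `A`, tested against kernels with integrable decay on the support. -/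
def BlowsUp (μ : Measure (ES n)) (d : ℕ) (Q : ES n) (A : ES d →L[ℝ] ES n) (θ : ℝ) : Prop :=
  ∀ (F : Type) [NormedAddCommGroup F] [NormedSpace ℝ F] (s C : ℝ) (r : ℕ → ℝ)
    (Ψ : ℕ → ES n → F) (G : ES d → F), (d : ℝ) < s → (∀ i, 0 < r i) → Tendsto r atTop (𝓝 0) →
    (∀ i, StronglyMeasurable (Ψ i)) → StronglyMeasurable G →
    (∀ i y, Q + r i • y ∈ msupp μ → ‖Ψ i y‖ ≤ C * (1 + ‖y‖) ^ (-s)) →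
    (∀ ζ, ‖G ζ‖ ≤ C * (1 + ‖A ζ‖) ^ (-s)) →
    (∀ ζ, Tendsto (fun p : ℕ × ES n => Ψ p.1 p.2) (atTop ×ˢ 𝓝 (A ζ)) (𝓝 (G ζ))) →
    Tendsto (fun i => (r i ^ (d : ℝ))⁻¹ • ∫ y, Ψ i ((r i)⁻¹ • (y - Q)) ∂μ) atTop
      (𝓝 (θ • ∫ ζ, G ζ))

theorem one_add_rpow_neg_le {a b c s : ℝ} (hs : 0 ≤ s) (hc : 0 < c) (ha : 0 ≤ a)
    (hb : c * a ≤ b) : (1 + b) ^ (-s) ≤ (min 1 c) ^ (-s) * (1 + a) ^ (-s) := by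
  have hm : 0 < min 1 c := lt_min one_pos hc
  rw [← Real.mul_rpow hm.le (by positivity)]
  refine Real.rpow_le_rpow_of_nonpos (by positivity) ?_ (by linarith)
  have h1 : min 1 c * a ≤ c * a := by gcongr; exact min_le_right _ _
  have h2 : min 1 c ≤ 1 := min_le_left _ _
  nlinarith

theorem lintegral_weight_one_lt_top {s : ℝ} (hds : (d : ℝ) < s) :
    ∫⁻ ζ : ES d, ENNReal.ofReal ((1 + ‖ζ‖) ^ (-s)) < ∞ := by
  have hs : 0 < s := (Nat.cast_nonneg d).trans_lt hds
  have := lintegral_weight_le (σ := (volume : Measure (ES d))) (x := 0) (r := 1) (d := d)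
    (C := (volume (ball (0 : ES d) 1)).toReal) one_pos hs (by positivity) fun ρ hρ => by
      rw [volume_ball_le _ hρ, ENNReal.ofReal_mul (by positivity),
        ENNReal.ofReal_toReal measure_ball_lt_top.ne, mul_comm]
  simp only [dist_zero_right, div_one] at this
  exact this.trans_lt (ENNReal.mul_lt_top ENNReal.ofReal_lt_top (lintegral_Ioo_rpow_lt_top hs hds))

theorem integrable_weight {s : ℝ} (hds : (d : ℝ) < s) :
    Integrable fun ζ : ES d => (1 + ‖ζ‖) ^ (-s) := by
  refine ⟨(measurable_norm.const_add 1 |>.pow_const _).aestronglyMeasurable, ?_⟩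
  rw [hasFiniteIntegral_iff_ofReal (Eventually.of_forall fun ζ => by positivity)]
  exact lintegral_weight_one_lt_top hds

/-- If a family of functions is dominated by a weight concentrated at scale `r` and the measure
has zero density, then the normalized integrals tend to zero. -/
theorem tendsto_integral_of_density_zero {X F : Type*} [PseudoMetricSpace X] [MeasurableSpace X]
    [OpensMeasurableSpace X] [NormedAddCommGroup F] [NormedSpace ℝ F]
    {σ : Measure X} {x : X} {C C' d s : ℝ} (hs : 0 < s)
    (hds : d < s) (hC : 0 ≤ C) (hσ : ∀ ρ > 0, σ (ball x ρ) ≤ ENNReal.ofReal (C * ρ ^ d))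
    (hlim : Tendsto (fun ρ => σ (ball x ρ) / ENNReal.ofReal (ρ ^ d)) (𝓝[>] 0) (𝓝 0))
    {r : ℕ → ℝ} (hr : ∀ i, 0 < r i) (hr0 : Tendsto r atTop (𝓝 0)) {v : ℕ → F}
    (hv : ∀ i, ‖v i‖ₑ ≤ ENNReal.ofReal C' *
      ∫⁻ y, ENNReal.ofReal ((1 + dist y x / r i) ^ (-s)) ∂σ) :
    Tendsto (fun i => (r i ^ d)⁻¹ • v i) atTop (𝓝 0) := by
  rw [tendsto_zero_iff_enorm_tendsto_zero]
  have h := ENNReal.Tendsto.const_mul (a := ENNReal.ofReal C')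
    (tendsto_lintegral_weight_div hs hds hC hσ hlim hr hr0) (Or.inr ENNReal.ofReal_ne_top)
  rw [mul_zero] at h
  refine tendsto_of_tendsto_of_tendsto_of_le_of_le tendsto_const_nhds h (fun _ => zero_le)
    fun i => ?_
  have hp : 0 < r i ^ d := Real.rpow_pos_of_pos (hr i) d
  simp only [enorm_smul]
  rw [Real.enorm_eq_ofReal (by positivity), ENNReal.ofReal_inv_of_pos hp, mul_comm,
    ← div_eq_mul_inv, ← mul_div_assoc]
  gcongr
  exact hv i

end Blowup

section Blowup

variable {n d : ℕ}

theorem norm_inv_smul_sub {E : Type*} [NormedAddCommGroup E] [NormedSpace ℝ E] {r : ℝ} (hr : 0 < r)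
    (y x : E) : ‖r⁻¹ • (y - x)‖ = dist y x / r := by
  rw [norm_smul, dist_eq_norm, norm_inv, Real.norm_of_nonneg hr.le]; ring

theorem blowsUp_of_density {μ : Measure (ES n)} {C₀ : ℝ} (hμ : IsAhlfors (d : ℝ) μ C₀)
    {S : Set (ES d)} (hS : MeasurableSet S) {f : ES d → ES n} (hf : Continuous f)
    (hfS : f '' S ⊆ msupp μ) (hfSm : MeasurableSet (f '' S)) {h : ES d → ℝ} (hh : Measurable h)
    {M : ℝ} (h0 : ∀ z, 0 ≤ h z) (hM : ∀ z, h z ≤ M) (hhS : ∀ z ∉ S, h z = 0)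
    (hν : (volume.withDensity fun z => ENNReal.ofReal (h z)).map f = μ.restrict (f '' S))
    {x : ES d} (hx : x ∈ S) {A : ES d →L[ℝ] ES n} (hA : HasFDerivAt f A x) {c₀ : ℝ} (hc₀ : 0 < c₀)
    (hAc : ∀ ζ, c₀ * ‖ζ‖ ≤ ‖A ζ‖) (hfc : ∀ z ∈ S, c₀ * ‖z - x‖ ≤ ‖f z - f x‖)
    (hdens : Tendsto (fun ρ => μ.restrict (f '' S)ᶜ (ball (f x) ρ) / ENNReal.ofReal (ρ ^ (d : ℝ)))
      (𝓝[>] 0) (𝓝 0))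
    (hleb : Tendsto (fun ρ => (volume.withDensity fun z => ENNReal.ofReal |h z - h x|) (ball x ρ) /
      ENNReal.ofReal (ρ ^ (d : ℝ))) (𝓝[>] 0) (𝓝 0)) :
    BlowsUp μ d (f x) A (h x) := by
  intro F _ _ s C r Ψ G hds hr hr0 hΨm hGm hΨ hG hlim
  have hs : 0 < s := (Nat.cast_nonneg d).trans_lt hds
  have hM0 : 0 ≤ M := (h0 x).trans (hM x)
  have hC₀ : 0 < C₀ := by linarith [hμ.1]
  have hC : 0 ≤ C := by
    have := (norm_nonneg _).trans (hG 0)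
    simpa using this
  set ν : Measure (ES d) := volume.withDensity fun z => ENNReal.ofReal (h z) with hνdef
  have hQ : f x ∈ msupp μ := hfS (mem_image_of_mem f hx)
  have hball : ∀ ρ > 0, μ (ball (f x) ρ) ≤ ENNReal.ofReal (C₀ * ρ ^ (d : ℝ)) :=
    fun ρ hρ => (hμ.2 _ hQ ρ hρ).2
  have hνle : ν ≤ ENNReal.ofReal M • volume := by
    rw [← withDensity_const]
    exact withDensity_mono (Eventually.of_forall fun z => ENNReal.ofReal_le_ofReal (hM z))
  have hνS : ∀ᵐ z ∂ν, z ∈ S := by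
    rw [hνdef, ae_withDensity_iff hh.ennreal_ofReal]
    refine Eventually.of_forall fun z hz => ?_
    by_contra hzS
    simp [hhS z hzS] at hz
  set C' := C * (min 1 c₀) ^ (-s) with hC'
  have hC'0 : 0 ≤ C' := by
    have : 0 < min 1 c₀ := lt_min one_pos hc₀
    positivity
  have hG' : ∀ ζ, ‖G ζ‖ ≤ C' * (1 + ‖ζ‖) ^ (-s) := fun ζ => by
    rw [hC', mul_assoc]
    exact (hG ζ).trans (by
      gcongr; exact one_add_rpow_neg_le hs.le hc₀ (norm_nonneg _) (hAc ζ))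
  have hΨ1 : ∀ i y, y ∈ msupp μ →
      ‖Ψ i ((r i)⁻¹ • (y - f x))‖ ≤ C * (1 + dist y (f x) / r i) ^ (-s) := fun i y hy => by
    rw [← norm_inv_smul_sub (hr i)]
    refine hΨ i _ ?_
    rwa [smul_inv_smul₀ (hr i).ne', add_sub_cancel]
  have hΨ2 : ∀ i, ∀ z ∈ S,
      ‖Ψ i ((r i)⁻¹ • (f z - f x))‖ ≤ C' * (1 + ‖(r i)⁻¹ • (z - x)‖) ^ (-s) := fun i z hz => by
    refine (hΨ1 i _ (hfS (mem_image_of_mem f hz))).trans ?_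
    rw [hC', mul_assoc]
    gcongr
    refine one_add_rpow_neg_le hs.le hc₀ (norm_nonneg _) ?_
    rw [norm_inv_smul_sub (hr i), dist_eq_norm, dist_eq_norm, ← mul_div_assoc]
    have := hr i
    gcongr
    exact hfc z hz
  have hcont : ∀ i, Continuous fun y : ES n => (r i)⁻¹ • (y - f x) := fun i => by fun_prop
  have hcont' : ∀ i, Continuous fun z : ES d => (r i)⁻¹ • (z - x) := fun i => by fun_prop
  have hΨsm : ∀ i, StronglyMeasurable fun y => Ψ i ((r i)⁻¹ • (y - f x)) := fun i =>
    (hΨm i).comp_measurable (hcont i).measurable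
  have hGsm : ∀ i, StronglyMeasurable fun z => G ((r i)⁻¹ • (z - x)) := fun i =>
    hGm.comp_measurable (hcont' i).measurable
  -- integrability
  have hae : ∀ᵐ y ∂μ, y ∈ msupp μ := measure_compl_msupp μ
  have hΨint : ∀ i, Integrable (fun y => Ψ i ((r i)⁻¹ • (y - f x))) μ := fun i => by
    have hw : Integrable (fun y => C * (1 + dist y (f x) / r i) ^ (-s)) μ := by
      refine Integrable.const_mul ⟨(measurable_weight _ _ _).aestronglyMeasurable, ?_⟩ C
      rw [hasFiniteIntegral_iff_ofReal (Eventually.of_forall fun ζ => by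
        have := hr i; positivity)]
      exact (lintegral_weight_le (hr i) hs hC₀.le hball).trans_lt
        (ENNReal.mul_lt_top ENNReal.ofReal_lt_top (lintegral_Ioo_rpow_lt_top hs hds))
    exact hw.mono' (hΨsm i).aestronglyMeasurable (hae.mono fun y hy => hΨ1 i y hy)
  have hwvol : ∀ i, Integrable (fun z => C' * (1 + ‖(r i)⁻¹ • (z - x)‖) ^ (-s)) volume := fun i => by
    have := ((integrable_weight hds).comp_smul (inv_ne_zero (hr i).ne')).comp_sub_right x
    exact this.const_mul C'
  have hwν : ∀ i, Integrable (fun z => C' * (1 + ‖(r i)⁻¹ • (z - x)‖) ^ (-s)) ν := fun i =>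
    ((hwvol i).smul_measure ENNReal.ofReal_ne_top).mono_measure hνle
  have hGν : ∀ i, Integrable (fun z => G ((r i)⁻¹ • (z - x))) ν := fun i =>
    (hwν i).mono' (hGsm i).aestronglyMeasurable (Eventually.of_forall fun z => hG' _)
  have hGvol : ∀ i, Integrable (fun z => G ((r i)⁻¹ • (z - x))) volume := fun i =>
    (hwvol i).mono' (hGsm i).aestronglyMeasurable (Eventually.of_forall fun z => hG' _)
  have hΨν : ∀ i, Integrable (fun z => Ψ i ((r i)⁻¹ • (f z - f x))) ν := fun i =>
    (hwν i).mono' ((hΨsm i).comp_measurable hf.measurable).aestronglyMeasurable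
      (hνS.mono fun z hz => hΨ2 i z hz)
  have hhGvol : ∀ i, Integrable (fun z => h z • G ((r i)⁻¹ • (z - x))) volume := fun i => by
    refine Integrable.bdd_smul (hGvol i) M hh.aestronglyMeasurable
      (Eventually.of_forall fun z => ?_)
    rw [Real.norm_of_nonneg (h0 z)]; exact hM z
  -- decomposition
  have hdecomp : ∀ i, ∫ y, Ψ i ((r i)⁻¹ • (y - f x)) ∂μ =
      (∫ y, Ψ i ((r i)⁻¹ • (y - f x)) ∂(μ.restrict (f '' S)ᶜ)) +
      (∫ z, (Ψ i ((r i)⁻¹ • (f z - f x)) - G ((r i)⁻¹ • (z - x))) ∂ν) +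
      (∫ z, (h z - h x) • G ((r i)⁻¹ • (z - x))) + r i ^ (d : ℝ) • h x • ∫ ζ, G ζ := fun i => by
    rw [← integral_add_compl hfSm (hΨint i), ← hν,
      integral_map hf.measurable.aemeasurable (hΨsm i).aestronglyMeasurable,
      integral_sub (hΨν i) (hGν i)]
    have e1 : ∫ z, G ((r i)⁻¹ • (z - x)) ∂ν = ∫ z, h z • G ((r i)⁻¹ • (z - x)) := by
      rw [hνdef, integral_withDensity_eq_integral_toReal_smul hh.ennreal_ofReal
        (Eventually.of_forall fun z => ENNReal.ofReal_lt_top)]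
      simp only [ENNReal.toReal_ofReal (h0 _)]
    have e2 : ∫ z, (h z - h x) • G ((r i)⁻¹ • (z - x)) =
        (∫ z, h z • G ((r i)⁻¹ • (z - x))) - r i ^ (d : ℝ) • h x • ∫ ζ, G ζ := by
      simp only [sub_smul]
      rw [integral_sub (hhGvol i) (by exact (hGvol i).smul (h x)), integral_smul,
        integral_comp_inv_smul_sub x (hr i), smul_comm]
    rw [e1, e2]
    abel
  -- the three error terms
  have hW : Tendsto (fun i => (r i ^ (d : ℝ))⁻¹ •
      ∫ y, Ψ i ((r i)⁻¹ • (y - f x)) ∂(μ.restrict (f '' S)ᶜ)) atTop (𝓝 0) := by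
    refine tendsto_integral_of_density_zero (C' := C) hs hds hC₀.le (fun ρ hρ =>
      (Measure.restrict_apply_le _ _).trans (hball ρ hρ)) hdens hr hr0 fun i => ?_
    refine (enorm_integral_le_lintegral_enorm _).trans ?_
    rw [← lintegral_const_mul' _ _ ENNReal.ofReal_ne_top]
    refine lintegral_mono_ae ((ae_restrict_of_ae hae).mono fun y hy => ?_)
    rw [← ENNReal.ofReal_mul hC, ← ofReal_norm]
    exact ENNReal.ofReal_le_ofReal (hΨ1 i y hy)
  have hV : Tendsto (fun i => (r i ^ (d : ℝ))⁻¹ •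
      ∫ z, (h z - h x) • G ((r i)⁻¹ • (z - x))) atTop (𝓝 0) := by
    have hm : Measurable fun z => ENNReal.ofReal |h z - h x| :=
      (hh.sub_const _).abs.ennreal_ofReal
    refine tendsto_integral_of_density_zero (C' := C')
      (C := M * (volume (ball (0 : ES d) 1)).toReal)
      hs hds (by positivity) (fun ρ hρ => ?_) hleb hr hr0 fun i => ?_
    · rw [withDensity_apply _ measurableSet_ball]
      calc ∫⁻ z in ball x ρ, ENNReal.ofReal |h z - h x| ≤ ∫⁻ z in ball x ρ, ENNReal.ofReal M :=
            lintegral_mono fun z => ENNReal.ofReal_le_ofReal (by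
              rw [abs_le]
              constructor <;> linarith [h0 z, h0 x, hM z, hM x])
        _ = _ := by
            rw [setLIntegral_const, volume_ball_le _ hρ, ENNReal.ofReal_mul (by positivity),
              ENNReal.ofReal_mul hM0, ENNReal.ofReal_toReal measure_ball_lt_top.ne]
            ring
    · refine (enorm_integral_le_lintegral_enorm _).trans ?_
      rw [lintegral_withDensity_eq_lintegral_mul _ hm (measurable_weight _ _ _).ennreal_ofReal,
        ← lintegral_const_mul' _ _ ENNReal.ofReal_ne_top]
      refine lintegral_mono fun z => ?_
      simp only [Pi.mul_apply]
      rw [enorm_smul, Real.enorm_eq_ofReal_abs, mul_left_comm]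
      gcongr
      rw [← ENNReal.ofReal_mul hC'0, ← ofReal_norm, ← norm_inv_smul_sub (hr i)]
      exact ENNReal.ofReal_le_ofReal (hG' _)
  have hU : Tendsto (fun i => (r i ^ (d : ℝ))⁻¹ •
      ∫ z, (Ψ i ((r i)⁻¹ • (f z - f x)) - G ((r i)⁻¹ • (z - x))) ∂ν) atTop (𝓝 0) := by
    rw [tendsto_zero_iff_enorm_tendsto_zero]
    let Φ : ℕ → ES d → ℝ≥0∞ := fun i ζ => S.indicator
      (fun z => ‖Ψ i ((r i)⁻¹ • (f z - f x)) - G ((r i)⁻¹ • (z - x))‖ₑ) (x + r i • ζ)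
    have hΦ : Tendsto (fun i => ENNReal.ofReal M * ∫⁻ ζ, Φ i ζ) atTop (𝓝 0) := by
      rw [← mul_zero (ENNReal.ofReal M)]
      refine ENNReal.Tendsto.const_mul ?_ (Or.inr ENNReal.ofReal_ne_top)
      rw [← lintegral_zero (μ := (volume : Measure (ES d)))]
      refine tendsto_lintegral_of_dominated_convergence
        (fun ζ => ENNReal.ofReal (2 * C' * (1 + ‖ζ‖) ^ (-s))) (fun i => ?_)
        (fun i => Eventually.of_forall fun ζ => ?_) ?_ (Eventually.of_forall fun ζ => ?_)
      · refine Measurable.comp (g := S.indicator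
          (fun z => ‖Ψ i ((r i)⁻¹ • (f z - f x)) - G ((r i)⁻¹ • (z - x))‖ₑ)) ?_ (by fun_prop)
        exact (((hΨsm i).comp_measurable hf.measurable).sub (hGsm i)).enorm.indicator hS
      · simp only [Φ, indicator]
        split_ifs with hz
        · have a1 := hΨ2 i _ hz
          have a2 := hG' ((r i)⁻¹ • (x + r i • ζ - x))
          rw [add_sub_cancel_left, inv_smul_smul₀ (hr i).ne'] at a1 a2
          rw [← ofReal_norm, add_sub_cancel_left, inv_smul_smul₀ (hr i).ne']
          refine ENNReal.ofReal_le_ofReal ((norm_sub_le _ _).trans ?_)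
          linarith
        · exact zero_le
      · simp only [ENNReal.ofReal_mul (mul_nonneg zero_le_two hC'0)]
        rw [lintegral_const_mul' _ _ ENNReal.ofReal_ne_top]
        exact ENNReal.mul_ne_top ENNReal.ofReal_ne_top (lintegral_weight_one_lt_top hds).ne
      · have hd1 : Tendsto (fun i => (r i)⁻¹ • (f (x + r i • ζ) - f x)) atTop (𝓝 (A ζ)) := by
          have hinv : Tendsto (fun i => ‖(r i)⁻¹‖) atTop atTop := by
            refine tendsto_norm_atTop_atTop.comp (Tendsto.inv_tendsto_nhdsGT_zero ?_)
            exact tendsto_nhdsWithin_iff.2 ⟨hr0, Eventually.of_forall hr⟩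
          simpa only [inv_inv] using hA.lim ζ hinv
        have hd2 : Tendsto (fun i => Ψ i ((r i)⁻¹ • (f (x + r i • ζ) - f x))) atTop (𝓝 (G ζ)) :=
          (hlim ζ).comp (tendsto_id.prodMk hd1)
        rw [tendsto_iff_enorm_sub_tendsto_zero] at hd2
        refine tendsto_of_tendsto_of_tendsto_of_le_of_le tendsto_const_nhds hd2
          (fun _ => zero_le) fun i => ?_
        simp only [Φ, indicator]
        split_ifs
        · rw [add_sub_cancel_left, inv_smul_smul₀ (hr i).ne']
        · exact zero_le
    refine tendsto_of_tendsto_of_tendsto_of_le_of_le tendsto_const_nhds hΦ (fun _ => zero_le)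
      fun i => ?_
    have hp : 0 < r i ^ (d : ℝ) := Real.rpow_pos_of_pos (hr i) d
    simp only [enorm_smul]
    rw [Real.enorm_eq_ofReal (by positivity), ENNReal.ofReal_inv_of_pos hp]
    have key : ‖∫ z, (Ψ i ((r i)⁻¹ • (f z - f x)) - G ((r i)⁻¹ • (z - x))) ∂ν‖ₑ ≤
        ENNReal.ofReal (r i ^ (d : ℝ)) * (ENNReal.ofReal M * ∫⁻ ζ, Φ i ζ) := by
      refine (enorm_integral_le_lintegral_enorm _).trans ?_
      rw [hνdef, lintegral_withDensity_eq_lintegral_mul _ hh.ennreal_ofReal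
        (by exact (((hΨsm i).comp_measurable hf.measurable).sub (hGsm i)).enorm), mul_left_comm,
        ← lintegral_comp_add_smul x (hr i) (S.indicator
          (fun z => ‖Ψ i ((r i)⁻¹ • (f z - f x)) - G ((r i)⁻¹ • (z - x))‖ₑ)),
        ← lintegral_const_mul' _ _ ENNReal.ofReal_ne_top]
      refine lintegral_mono fun z => ?_
      simp only [Pi.mul_apply, indicator]
      split_ifs with hz
      · gcongr
        exact hM z
      · simp [hhS z hz]
    calc _ ≤ (ENNReal.ofReal (r i ^ (d : ℝ)))⁻¹ *
          (ENNReal.ofReal (r i ^ (d : ℝ)) * (ENNReal.ofReal M * ∫⁻ ζ, Φ i ζ)) := by gcongr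
      _ = _ := by
        rw [← mul_assoc, ENNReal.inv_mul_cancel (by simpa using hp) ENNReal.ofReal_ne_top, one_mul]
  have hfin := ((hW.add hU).add hV).add_const (h x • ∫ ζ, G ζ)
  simp only [zero_add, add_zero] at hfin
  refine hfin.congr fun i => ?_
  have hp : 0 < r i ^ (d : ℝ) := Real.rpow_pos_of_pos (hr i) d
  rw [hdecomp i, smul_add, smul_add, smul_add, inv_smul_smul₀ hp.ne']

end Blowup

section Tangent

variable {n d : ℕ}

/-- `μ` has a tangent plane blow-up at `Q`. -/
def HasTangentBlowup (μ : Measure (ES n)) (d : ℕ) (Q : ES n) : Prop :=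
  ∃ (A : ES d →L[ℝ] ES n) (θ c₀ : ℝ), 0 < θ ∧ 0 < c₀ ∧ (∀ ζ, c₀ * ‖ζ‖ ≤ ‖A ζ‖) ∧ BlowsUp μ d Q A θ

theorem IsAhlfors.exists_measure_image_le {μ : Measure (ES n)} {C₀ : ℝ}
    (hμ : IsAhlfors (d : ℝ) μ C₀) {f : ES d → ES n} {L : ℝ≥0} (hf : LipschitzWith L f) :
    ∃ M : ℝ≥0, ∀ B, μ (f '' B) ≤ M * volume B := by
  obtain ⟨c, hc⟩ : ∃ c : ℝ≥0, (μH[(d : ℝ)] : Measure (ES d)) = c • volume :=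
    ⟨_, Measure.isAddLeftInvariant_eq_smul _ _⟩
  refine ⟨C₀.toNNReal * (L ^ (d : ℝ) * c), fun B => ?_⟩
  refine (hμ.measure_le_hausdorff (Nat.cast_nonneg d) _).trans ?_
  rw [ENNReal.coe_mul, mul_assoc]
  refine mul_le_mul_right (((hf.hausdorffMeasure_image_le (Nat.cast_nonneg d) B)).trans ?_) _
  rw [hc, Measure.smul_apply, ENNReal.coe_mul, ENNReal.coe_rpow_of_nonneg _ (Nat.cast_nonneg d),
    mul_assoc]
  rfl

theorem exists_bounded_density {X : Type*} [MeasurableSpace X] {ν lam : Measure X} [SFinite ν]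
    [SigmaFinite lam] {M : ℝ≥0} (h : ∀ B, MeasurableSet B → ν B ≤ M * lam B) {S : Set X}
    (hS : MeasurableSet S) (hνS : ν Sᶜ = 0) :
    ∃ g : X → ℝ, Measurable g ∧ (∀ z, 0 ≤ g z) ∧ (∀ z, g z ≤ M) ∧ (∀ z ∉ S, g z = 0) ∧
      lam.withDensity (fun z => ENNReal.ofReal (g z)) = ν := by
  have hac : ν ≪ lam := Measure.AbsolutelyContinuous.mk fun B hB h0 => by
    have := h B hB
    rwa [h0, mul_zero, nonpos_iff_eq_zero] at this
  set ρ := ν.rnDeriv lam with hρ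
  have hρm : Measurable ρ := Measure.measurable_rnDeriv _ _
  have hρν : lam.withDensity ρ = ν := Measure.withDensity_rnDeriv_eq _ _ hac
  have hle : ρ ≤ᵐ[lam] fun _ => (M : ℝ≥0∞) := by
    refine ae_le_of_forall_setLIntegral_le_of_sigmaFinite hρm fun B hB _ => ?_
    rw [← withDensity_apply _ hB, hρν, setLIntegral_const]
    exact h B hB
  refine ⟨S.indicator fun z => (min (ρ z) M).toReal, ?_, fun z => ?_, fun z => ?_, fun z hz => ?_, ?_⟩
  · exact ((hρm.min measurable_const).ennreal_toReal).indicator hS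
  · exact indicator_nonneg (fun _ _ => ENNReal.toReal_nonneg) z
  · refine indicator_le' (fun z _ => ?_) (fun z _ => M.2) z
    exact ENNReal.toReal_le_coe_of_le_coe (min_le_right _ _)
  · exact indicator_of_notMem hz _
  · have e : (fun z => ENNReal.ofReal (S.indicator (fun z => (min (ρ z) M).toReal) z)) =ᵐ[lam]
        S.indicator ρ := by
      filter_upwards [hle] with z hz
      by_cases hzS : z ∈ S
      · simp only [indicator_of_mem hzS]
        rw [min_eq_left hz, ENNReal.ofReal_toReal (ne_top_of_le_ne_top ENNReal.coe_ne_top hz)]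
      · simp [indicator_of_notMem hzS]
    rw [withDensity_congr_ae e, withDensity_indicator hS, ← restrict_withDensity hS, hρν]
    exact Measure.restrict_eq_self_of_ae_mem hνS

theorem ae_tendsto_withDensity_ball_div {h : ES d → ℝ} (hh : LocallyIntegrable h volume) :
    ∀ᵐ x : ES d, Tendsto (fun ρ =>
      (volume.withDensity fun z => ENNReal.ofReal |h z - h x|) (ball x ρ) /
        ENNReal.ofReal (ρ ^ (d : ℝ))) (𝓝[>] 0) (𝓝 0) := by
  filter_upwards [(Besicovitch.vitaliFamily volume).ae_tendsto_lintegral_enorm_sub_div hh] with x hx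
  have h1 := hx.comp (Besicovitch.tendsto_filterAt volume x)
  have h2 := ENNReal.Tendsto.mul_const (b := volume (ball (0 : ES d) 1)) h1
    (Or.inr measure_ball_lt_top.ne)
  rw [zero_mul] at h2
  refine tendsto_of_tendsto_of_tendsto_of_le_of_le' tendsto_const_nhds h2
    (Eventually.of_forall fun _ => zero_le) ?_
  filter_upwards [self_mem_nhdsWithin] with ρ (hρ : 0 < ρ)
  have hp : 0 < ρ ^ (d : ℝ) := Real.rpow_pos_of_pos hρ _
  have hv : volume (ball (0 : ES d) 1) ≠ 0 := (measure_ball_pos _ _ one_pos).ne'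
  simp only [Function.comp]
  rw [withDensity_apply _ measurableSet_ball, Measure.addHaar_closedBall _ _ hρ.le,
    finrank_euclideanSpace_fin, ← Real.rpow_natCast]
  simp only [Real.enorm_eq_ofReal_abs]
  rw [← ENNReal.mul_div_right_comm, ENNReal.mul_div_mul_right _ _ hv measure_ball_lt_top.ne]
  gcongr
  exact ball_subset_closedBall

theorem IsAhlfors.ae_tendsto_density {μ : Measure (ES n)} {C₀ δ : ℝ}
    (hμ : IsAhlfors δ μ C₀) {T : Set (ES n)} (hT : MeasurableSet T) :
    ∀ᵐ Q ∂μ, Q ∈ T → Tendsto (fun ρ => μ.restrict Tᶜ (ball Q ρ) / ENNReal.ofReal (ρ ^ δ))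
      (𝓝[>] 0) (𝓝 0) := by
  have := hμ.isLocallyFiniteMeasure
  have hae : ∀ᵐ y ∂μ, y ∈ msupp μ := measure_compl_msupp μ
  filter_upwards [Besicovitch.ae_tendsto_measure_inter_div_of_measurableSet μ hT.compl, hae]
    with Q hQ hQE hQT
  rw [indicator_of_notMem (by simpa using hQT)] at hQ
  have h2 := ENNReal.Tendsto.mul_const (b := ENNReal.ofReal (C₀ * 2 ^ δ)) hQ
    (Or.inr ENNReal.ofReal_ne_top)
  rw [zero_mul] at h2
  refine tendsto_of_tendsto_of_tendsto_of_le_of_le' tendsto_const_nhds h2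
    (Eventually.of_forall fun _ => zero_le) ?_
  filter_upwards [self_mem_nhdsWithin] with ρ (hρ : 0 < ρ)
  have hp : 0 < ρ ^ δ := Real.rpow_pos_of_pos hρ _
  have hC : 0 ≤ C₀ := by linarith [hμ.1]
  have hb : μ (closedBall Q ρ) ≤ ENNReal.ofReal (C₀ * 2 ^ δ) * ENNReal.ofReal (ρ ^ δ) := by
    rw [← ENNReal.ofReal_mul (by positivity), mul_assoc, ← Real.mul_rpow zero_le_two hρ.le]
    exact (measure_mono (closedBall_subset_ball (by linarith))).trans
      (hμ.2 Q hQE (2 * ρ) (by positivity)).2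
  have hb0 : μ (closedBall Q ρ) ≠ 0 :=
    ((hQE ρ hρ).trans_le (measure_mono ball_subset_closedBall)).ne'
  have hbt : μ (closedBall Q ρ) ≠ ∞ := ne_top_of_le_ne_top
    (ENNReal.mul_ne_top ENNReal.ofReal_ne_top ENNReal.ofReal_ne_top) hb
  rw [ENNReal.div_le_iff (by simpa using hp) ENNReal.ofReal_ne_top, mul_assoc]
  refine le_trans ?_ (mul_le_mul_right hb _)
  rw [ENNReal.div_mul_cancel hb0 hbt, Measure.restrict_apply measurableSet_ball, inter_comm]
  gcongr
  exact ball_subset_closedBall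

theorem IsAhlfors.ae_hasTangentBlowup_of_injective {μ : Measure (ES n)} {C₀ : ℝ}
    (hμ : IsAhlfors (d : ℝ) μ C₀) {f : ES d → ES n} {L : ℝ≥0} (hf : LipschitzWith L f)
    {S : Set (ES d)} (hS : MeasurableSet S) (hfS : f '' S ⊆ msupp μ)
    (hd : ∀ x ∈ S, DifferentiableAt ℝ f x ∧ Function.Injective (fderiv ℝ f x)) {c : ℝ≥0}
    (hc : 0 < c) (hfc : ∀ x ∈ S, ∀ y ∈ S, c * ‖x - y‖ ≤ ‖f x - f y‖) :
    ∀ᵐ Q ∂μ, Q ∈ f '' S → HasTangentBlowup μ d Q := by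
  have := hμ.isLocallyFiniteMeasure
  have hinj : InjOn f S := fun x hx y hy hxy => by
    have := hfc x hx y hy
    rw [hxy, sub_self, norm_zero] at this
    have h0 : ‖x - y‖ ≤ 0 := nonpos_of_mul_nonpos_right this hc
    rwa [norm_le_zero_iff, sub_eq_zero] at h0
  have hT : MeasurableSet (f '' S) := hS.image_of_continuousOn_injOn hf.continuous.continuousOn hinj
  have hginv : LipschitzOnWith c⁻¹ (Function.invFunOn f S) (f '' S) := by
    refine LipschitzOnWith.of_dist_le_mul ?_
    rintro _ ⟨x, hx, rfl⟩ _ ⟨y, hy, rfl⟩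
    rw [hinj.leftInvOn_invFunOn hx, hinj.leftInvOn_invFunOn hy, NNReal.coe_inv, inv_mul_eq_div,
      le_div_iff₀ (by exact_mod_cast hc), mul_comm, dist_eq_norm, dist_eq_norm]
    exact hfc x hx y hy
  obtain ⟨g, hg, hgeq⟩ := hginv.extend_finite_dimension
  have hgf : ∀ x ∈ S, g (f x) = x := fun x hx => by
    rw [← hgeq (mem_image_of_mem f hx), hinj.leftInvOn_invFunOn hx]
  have hfg : ∀ y ∈ f '' S, f (g y) = y := by
    rintro _ ⟨x, hx, rfl⟩
    rw [hgf x hx]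
  have hgm : Measurable g := hg.continuous.measurable
  obtain ⟨M, hM⟩ := hμ.exists_measure_image_le hf
  set ν : Measure (ES d) := (μ.restrict (f '' S)).map g with hν
  have hνM : ∀ B, MeasurableSet B → ν B ≤ M * volume B := fun B hB => by
    rw [hν, Measure.map_apply hgm hB, Measure.restrict_apply (hgm hB)]
    refine (measure_mono ?_).trans (hM B)
    rintro _ ⟨h1, x, hx, rfl⟩
    rw [mem_preimage, hgf x hx] at h1
    exact mem_image_of_mem f h1
  have hνS : ν Sᶜ = 0 := by
    rw [hν, Measure.map_apply hgm hS.compl, Measure.restrict_apply (hgm hS.compl)]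
    convert measure_empty (μ := μ)
    refine eq_empty_of_forall_notMem ?_
    rintro _ ⟨h1, x, hx, rfl⟩
    rw [mem_preimage, hgf x hx] at h1
    exact h1 hx
  obtain ⟨h, hhm, h0, hhM, hhS, hhν⟩ := exists_bounded_density hνM hS hνS
  have hmap : ν.map f = μ.restrict (f '' S) := by
    rw [hν, Measure.map_map hf.continuous.measurable hgm]
    refine (Measure.map_congr ?_).trans Measure.map_id
    filter_upwards [ae_restrict_mem hT] with y hy using hfg y hy
  have hloc : LocallyIntegrable h volume := by
    refine (locallyIntegrable_const (M : ℝ)).mono hhm.aestronglyMeasurable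
      (Eventually.of_forall fun z => ?_)
    rw [Real.norm_of_nonneg (h0 z)]
    exact (hhM z).trans (le_abs_self _)
  have hgood : ∀ᵐ z ∂ν, 0 < h z ∧ Tendsto (fun ρ =>
      (volume.withDensity fun w => ENNReal.ofReal |h w - h z|) (ball z ρ) /
        ENNReal.ofReal (ρ ^ (d : ℝ))) (𝓝[>] 0) (𝓝 0) := by
    rw [← hhν, ae_withDensity_iff hhm.ennreal_ofReal]
    filter_upwards [ae_tendsto_withDensity_ball_div hloc] with z hz hpos
    exact ⟨by simpa using hpos, hz⟩
  have hgood' := (ae_restrict_iff' hT).1 (ae_of_ae_map hgm.aemeasurable hgood)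
  filter_upwards [hgood', hμ.ae_tendsto_density hT]
  rintro _ hQ1 hQ2 ⟨x, hx, rfl⟩
  obtain ⟨hpos, hleb⟩ := hQ1 (mem_image_of_mem f hx)
  rw [hgf x hx] at hpos hleb
  obtain ⟨hdx, hix⟩ := hd x hx
  obtain ⟨κ, hκ, hanti⟩ := (fderiv ℝ f x).exists_antilipschitzWith
    (LinearMap.ker_eq_bot.2 hix)
  set c₁ : ℝ := min c (κ : ℝ)⁻¹ with hc₁
  have hκ' : (0 : ℝ) < κ := by exact_mod_cast hκ
  have hc' : (0 : ℝ) < c := by exact_mod_cast hc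
  have hc₁0 : 0 < c₁ := lt_min hc' (by positivity)
  have hA : ∀ ζ, c₁ * ‖ζ‖ ≤ ‖fderiv ℝ f x ζ‖ := fun ζ => by
    have h1 := hanti.le_mul_dist ζ 0
    rw [dist_zero_right, map_zero, dist_zero_right] at h1
    calc c₁ * ‖ζ‖ ≤ (κ : ℝ)⁻¹ * ‖ζ‖ := by gcongr; exact min_le_right _ _
      _ ≤ _ := by rw [inv_mul_le_iff₀ hκ']; exact h1
  refine ⟨fderiv ℝ f x, h x, c₁, hpos, hc₁0, hA, ?_⟩
  refine blowsUp_of_density hμ hS hf.continuous hfS hT hhm h0 hhM hhS ?_ hx hdx.hasFDerivAt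
    hc₁0 hA (fun z hz => ?_) (hQ2 (mem_image_of_mem f hx)) hleb
  · rw [hhν, hmap]
  · refine le_trans ?_ (hfc z hz x hx)
    gcongr
    exact min_le_left _ _

end Tangent

section Sard

variable {n d : ℕ}

theorem hausdorffMeasure_image_le_of_norm_sub_le {f : ES d → ES n} {S : Set (ES d)}
    (M : ES d →ₗ[ℝ] ES d) (h : ∀ x ∈ S, ∀ y ∈ S, ‖f x - f y‖ ≤ ‖M (x - y)‖) :
    μH[(d : ℝ)] (f '' S) ≤ ENNReal.ofReal |LinearMap.det M| * μH[(d : ℝ)] S := by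
  rw [← Measure.addHaar_image_linearMap]
  have hi : ∀ u ∈ M '' S, Function.invFunOn M S u ∈ S ∧ M (Function.invFunOn M S u) = u :=
    fun u hu => Function.invFunOn_pos hu
  have hg : LipschitzOnWith 1 (f ∘ Function.invFunOn M S) (M '' S) := by
    refine LipschitzOnWith.of_dist_le_mul fun u hu w hw => ?_
    rw [NNReal.coe_one, one_mul, dist_eq_norm, dist_eq_norm]
    refine (h _ (hi u hu).1 _ (hi w hw).1).trans ?_
    rw [map_sub, (hi u hu).2, (hi w hw).2]
  have := hg.hausdorffMeasure_image_le (d := (d : ℝ)) (Nat.cast_nonneg d)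
  rw [ENNReal.coe_one, ENNReal.one_rpow, one_mul] at this
  refine (measure_mono ?_).trans this
  rintro _ ⟨x, hx, rfl⟩
  have hx' := hi _ (mem_image_of_mem M hx)
  refine ⟨M x, mem_image_of_mem M hx, ?_⟩
  have := h _ hx'.1 x hx
  rw [map_sub, hx'.2, sub_self, norm_zero, norm_le_zero_iff, sub_eq_zero] at this
  exact this

theorem exists_linearMap_det_le (A : ES d →L[ℝ] ES n) (hA : ¬ Function.Injective A) {r : ℝ}
    (hr : 0 < r) (hr1 : r ≤ 1) :
    ∃ M : ES d →ₗ[ℝ] ES d, |LinearMap.det M| ≤ (2 * (‖A‖ + 2)) ^ d * r ∧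
      ∀ ζ, ‖A ζ‖ + r * ‖ζ‖ ≤ ‖M ζ‖ := by
  obtain ⟨w, hw, hw0⟩ : ∃ w, A w = 0 ∧ w ≠ 0 := by
    by_contra! hcon
    exact hA ((injective_iff_map_eq_zero A).2 hcon)
  obtain ⟨v, hv, hv1⟩ : ∃ v, A v = 0 ∧ ‖v‖ = 1 :=
    ⟨‖w‖⁻¹ • w, by simp [hw], norm_smul_inv_norm hw0⟩
  set a : ℝ := ‖A‖ + 1 + r with ha
  have ha1 : 1 ≤ a := by have := norm_nonneg A; linarith
  have ha0 : 0 < a := by linarith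
  let φ : Module.Dual ℝ (ES d) := (((r - a) / a) • innerSL ℝ v : ES d →L[ℝ] ℝ).toLinearMap
  refine ⟨(2 * a) • LinearMap.transvection φ v, ?_, fun ζ => ?_⟩
  · have hφ : 1 + φ v = r / a := by
      simp [φ, hv1]
      field_simp
      ring
    rw [LinearMap.det_smul, LinearMap.transvection.det, hφ, finrank_euclideanSpace_fin,
      abs_of_nonneg (by positivity)]
    have h1 : r / a ≤ r := div_le_self hr.le ha1
    have h2 : 2 * a ≤ 2 * (‖A‖ + 2) := by linarith
    gcongr
  · set t : ℝ := inner ℝ v ζ with ht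
    set p := ζ - t • v with hp
    have hζ : ζ = p + t • v := by rw [hp]; abel
    have hpv : inner ℝ v p = 0 := by
      rw [hp, inner_sub_right, inner_smul_right, real_inner_self_eq_norm_sq, hv1, ← ht]; ring
    have hAζ : ‖A ζ‖ ≤ ‖A‖ * ‖p‖ := by
      rw [hζ, map_add, map_smul, hv, smul_zero, add_zero]
      exact A.le_opNorm p
    have hζn : ‖ζ‖ ≤ ‖p‖ + |t| := by
      conv_lhs => rw [hζ]
      refine (norm_add_le _ _).trans ?_
      rw [norm_smul, hv1, mul_one, Real.norm_eq_abs]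
    have hM : ((2 * a) • LinearMap.transvection φ v) ζ = (2 * a) • p + (2 * r * t) • v := by
      have : LinearMap.transvection φ v ζ = ζ + (((r - a) / a) * t) • v := by
        simp [LinearMap.transvection.apply, φ, ht]
      rw [LinearMap.smul_apply, this, hp]
      match_scalars
      · ring
      · field_simp
        ring
    rw [hM]
    have hstep : ‖A ζ‖ + r * ‖ζ‖ ≤ a * ‖p‖ + r * |t| := by
      have := norm_nonneg p
      nlinarith [abs_nonneg t]
    refine hstep.trans (le_of_sq_le_sq ?_ (norm_nonneg _))
    rw [norm_add_sq_real, inner_smul_left, inner_smul_right, real_inner_comm, hpv, norm_smul,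
      norm_smul, hv1, Real.norm_of_nonneg (by positivity), Real.norm_eq_abs, mul_one,
      sq_abs]
    simp only [mul_zero, add_zero]
    have ht2 : (r * |t|) ^ 2 = (r * t) ^ 2 := by rw [mul_pow, sq_abs, mul_pow]
    nlinarith [sq_nonneg (a * ‖p‖ - r * |t|), sq_nonneg (a * ‖p‖), sq_nonneg (r * |t|)]

theorem hausdorffMeasure_image_eq_zero_of_fderiv_not_injective {f : ES d → ES n} {s : Set (ES d)}
    (hd : ∀ x ∈ s, DifferentiableAt ℝ f x) (hs : ∀ x ∈ s, ¬ Function.Injective (fderiv ℝ f x)) :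
    μH[(d : ℝ)] (f '' s) = 0 := by
  suffices H : ∀ R : ℕ, μH[(d : ℝ)] (f '' (s ∩ closedBall 0 R)) = 0 by
    refine measure_mono_null ?_ (measure_iUnion_null H)
    rintro _ ⟨x, hx, rfl⟩
    obtain ⟨R, hR⟩ := exists_nat_ge ‖x‖
    exact mem_iUnion.2 ⟨R, x, ⟨hx, by simpa using hR⟩, rfl⟩
  intro R
  rcases (s ∩ closedBall 0 (R : ℝ)).eq_empty_or_nonempty with he | hne
  · simp [he]
  have hfin : (μH[(d : ℝ)] : Measure (ES d)) (closedBall 0 (R : ℝ)) < ∞ :=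
    (isCompact_closedBall _ _).measure_lt_top
  have key : ∀ δ : ℝ, 0 < δ → μH[(d : ℝ)] (f '' (s ∩ closedBall 0 (R : ℝ))) ≤
      ENNReal.ofReal δ * (μH[(d : ℝ)] : Measure (ES d)) (closedBall 0 (R : ℝ)) := by
    intro δ hδ
    let r : (ES d →L[ℝ] ES n) → ℝ≥0 := fun A => min 1 (Real.toNNReal (δ / (2 * (‖A‖ + 2)) ^ d))
    have hr0 : ∀ A, 0 < r A := fun A => lt_min one_pos (Real.toNNReal_pos.2 (by positivity))
    have hr1 : ∀ A, (r A : ℝ) ≤ 1 := fun A => by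
      exact_mod_cast min_le_left 1 (Real.toNNReal (δ / (2 * (‖A‖ + 2)) ^ d))
    have hrδ : ∀ A : ES d →L[ℝ] ES n, (2 * (‖A‖ + 2)) ^ d * (r A : ℝ) ≤ δ := fun A => by
      have hp : 0 < (2 * (‖A‖ + 2)) ^ d := by positivity
      have h1 : (r A : ℝ) ≤ δ / (2 * (‖A‖ + 2)) ^ d := by
        have : (r A : ℝ) ≤ (Real.toNNReal (δ / (2 * (‖A‖ + 2)) ^ d) : ℝ) := by
          exact_mod_cast min_le_right 1 (Real.toNNReal (δ / (2 * (‖A‖ + 2)) ^ d))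
        rwa [Real.coe_toNNReal _ (by positivity)] at this
      rwa [le_div_iff₀ hp, mul_comm] at h1
    obtain ⟨t, A, hdisj, htm, hcov, happ, hA⟩ :=
      exists_partition_approximatesLinearOn_of_hasFDerivWithinAt f (s ∩ closedBall 0 (R : ℝ))
        (fun x => fderiv ℝ f x) (fun x hx => (hd x hx.1).hasFDerivAt.hasFDerivWithinAt) r
        (fun A => (hr0 A).ne')
    have hpiece : ∀ k, μH[(d : ℝ)] (f '' (s ∩ closedBall 0 (R : ℝ) ∩ t k)) ≤
        ENNReal.ofReal δ * (μH[(d : ℝ)] : Measure (ES d)) (closedBall 0 (R : ℝ) ∩ t k) := fun k => by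
      obtain ⟨y, hy, hAy⟩ := hA hne k
      obtain ⟨M, hM1, hM2⟩ := exists_linearMap_det_le (A k) (by rw [hAy]; exact hs y hy.1)
        (NNReal.coe_pos.2 (hr0 (A k))) (hr1 (A k))
      refine (hausdorffMeasure_image_le_of_norm_sub_le M fun x hx y hy => ?_).trans ?_
      · refine le_trans ?_ (hM2 (x - y))
        have := happ k x hx y hy
        calc ‖f x - f y‖ = ‖A k (x - y) + (f x - f y - A k (x - y))‖ := by congr 1; abel
          _ ≤ _ := (norm_add_le _ _).trans (by gcongr)
      · gcongr
        · exact hM1.trans (hrδ _)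
        · exact inter_subset_right
    calc μH[(d : ℝ)] (f '' (s ∩ closedBall 0 (R : ℝ)))
        ≤ μH[(d : ℝ)] (⋃ k, f '' (s ∩ closedBall 0 (R : ℝ) ∩ t k)) := by
          refine measure_mono ?_
          rintro _ ⟨x, hx, rfl⟩
          obtain ⟨k, hk⟩ := mem_iUnion.1 (hcov hx)
          exact mem_iUnion.2 ⟨k, x, ⟨hx, hk⟩, rfl⟩
      _ ≤ ∑' k, ENNReal.ofReal δ *
          (μH[(d : ℝ)] : Measure (ES d)) (closedBall 0 (R : ℝ) ∩ t k) :=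
          (measure_iUnion_le _).trans (ENNReal.tsum_le_tsum hpiece)
      _ = ENNReal.ofReal δ *
          (μH[(d : ℝ)] : Measure (ES d)) (⋃ k, closedBall 0 (R : ℝ) ∩ t k) := by
          rw [ENNReal.tsum_mul_left, measure_iUnion (fun i j hij =>
            (hdisj hij).mono inter_subset_right inter_subset_right)
            fun k => measurableSet_closedBall.inter (htm k)]
      _ ≤ _ := by
          gcongr
          exact iUnion_subset fun k => inter_subset_left
  have hlim : Tendsto (fun δ : ℝ => ENNReal.ofReal δ *
      (μH[(d : ℝ)] : Measure (ES d)) (closedBall 0 (R : ℝ))) (𝓝[>] 0) (𝓝 0) := by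
    have h0 : Tendsto (fun δ : ℝ => ENNReal.ofReal δ) (𝓝[>] 0) (𝓝 0) := by
      have := (ENNReal.continuous_ofReal.tendsto (0 : ℝ)).mono_left
        (nhdsWithin_le_nhds (s := Ioi 0))
      rwa [ENNReal.ofReal_zero] at this
    have := ENNReal.Tendsto.mul_const (b := (μH[(d : ℝ)] : Measure (ES d)) (closedBall 0 (R : ℝ)))
      h0 (Or.inr hfin.ne)
    rwa [zero_mul] at this
  exact le_antisymm (ge_of_tendsto hlim (eventually_nhdsWithin_of_forall fun δ hδ => key δ hδ))
    zero_le

theorem IsAhlfors.ae_hasTangentBlowup {μ : Measure (ES n)} {C₀ : ℝ}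
    (hμ : IsAhlfors (d : ℝ) μ C₀) (hR : RectSet n d (msupp μ)) :
    ∀ᵐ Q ∂μ, HasTangentBlowup μ d Q := by
  obtain ⟨F, hF, hnull⟩ := hR
  have hd0 : (0 : ℝ) ≤ d := Nat.cast_nonneg d
  have hnull_of : ∀ s : Set (ES n), μH[(d : ℝ)] s = 0 → ∀ᵐ Q ∂μ, Q ∉ s := fun s hs => by
    have := hμ.measure_le_hausdorff hd0 s
    rw [hs, mul_zero, nonpos_iff_eq_zero] at this
    exact measure_eq_zero_iff_ae_notMem.1 this
  have hpiece : ∀ i, ∀ᵐ Q ∂μ, Q ∈ range (F i) → HasTangentBlowup μ d Q := by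
    intro i
    obtain ⟨L, hf⟩ := hF i
    set f := F i
    -- points of non-differentiability
    have h1 : μH[(d : ℝ)] (f '' {x | ¬ DifferentiableAt ℝ f x}) = 0 := by
      have h0 : (μH[(d : ℝ)] : Measure (ES d)) {x | ¬ DifferentiableAt ℝ f x} = 0 :=
        hf.ae_differentiableAt
      have := hf.hausdorffMeasure_image_le hd0 {x | ¬ DifferentiableAt ℝ f x}
      rwa [h0, mul_zero, nonpos_iff_eq_zero] at this
    have h2 := hausdorffMeasure_image_eq_zero_of_fderiv_not_injective (f := f)
      (s := {x | DifferentiableAt ℝ f x ∧ ¬ Function.Injective (fderiv ℝ f x)})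
      (fun x hx => hx.1) (fun x hx => hx.2)
    set s : Set (ES d) := {x | DifferentiableAt ℝ f x} ∩
      fderiv ℝ f ⁻¹' {A | Function.Injective A} ∩ f ⁻¹' (msupp μ) with hs
    have hsm : MeasurableSet s := by
      refine ((measurableSet_of_differentiableAt ℝ f).inter ?_).inter
        ((isClosed_msupp μ).preimage hf.continuous).measurableSet
      exact measurable_fderiv ℝ f ContinuousLinearMap.isOpen_injective.measurableSet
    have hanti : ∀ A : ES d →L[ℝ] ES n, ∃ c : ℝ≥0, 0 < c ∧
        (Function.Injective A → ∀ ζ, 2 * c * ‖ζ‖ ≤ ‖A ζ‖) := fun A => by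
      by_cases hA : Function.Injective A
      · obtain ⟨κ, hκ, hκA⟩ := A.exists_antilipschitzWith (LinearMap.ker_eq_bot.2 hA)
        refine ⟨(2 * κ)⁻¹, by positivity, fun _ ζ => ?_⟩
        have h1 := hκA.le_mul_dist ζ 0
        rw [dist_zero_right, map_zero, dist_zero_right] at h1
        have hκ' : (0 : ℝ) < κ := by exact_mod_cast hκ
        push_cast
        rw [mul_inv, ← mul_assoc, mul_inv_cancel₀ two_ne_zero, one_mul, inv_mul_le_iff₀ hκ']
        exact h1
      · exact ⟨1, one_pos, fun h => absurd h hA⟩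
    choose c hc0 hc using hanti
    obtain ⟨t, A, hdisj, htm, hcov, happ, hA⟩ :=
      exists_partition_approximatesLinearOn_of_hasFDerivWithinAt f s
        (fun x => fderiv ℝ f x) (fun x hx => hx.1.1.hasFDerivAt.hasFDerivWithinAt) c
        (fun A => (hc0 A).ne')
    have hk : ∀ k, ∀ᵐ Q ∂μ, Q ∈ f '' (s ∩ t k) → HasTangentBlowup μ d Q := by
      intro k
      rcases s.eq_empty_or_nonempty with he | hne
      · simp [he]
      obtain ⟨y, hy, hAy⟩ := hA hne k
      refine hμ.ae_hasTangentBlowup_of_injective hf (hsm.inter (htm k)) ?_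
        (fun x hx => hx.1.1) (hc0 (A k)) fun x hx z hz => ?_
      · rintro _ ⟨x, hx, rfl⟩
        exact hx.1.2
      · have h3 := happ k x hx z hz
        have h4 := hc (A k) (by rw [hAy]; exact hy.1.2) (x - z)
        have h5 : ‖A k (x - z)‖ ≤ ‖f x - f z‖ + ‖f x - f z - A k (x - z)‖ := by
          calc ‖A k (x - z)‖ = ‖(f x - f z) - (f x - f z - A k (x - z))‖ := by congr 1; abel
            _ ≤ _ := norm_sub_le _ _
        linarith
    filter_upwards [hnull_of _ h1, hnull_of _ h2, ae_all_iff.2 hk, (measure_compl_msupp μ :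
      ∀ᵐ Q ∂μ, Q ∈ msupp μ)]
    rintro _ hQ1 hQ2 hQ3 hQE ⟨x, rfl⟩
    have hx1 : DifferentiableAt ℝ f x := by
      by_contra hcon
      exact hQ1 (mem_image_of_mem f hcon)
    have hx2 : Function.Injective (fderiv ℝ f x) := by
      by_contra hcon
      exact hQ2 (mem_image_of_mem f ⟨hx1, hcon⟩)
    have hx : x ∈ s := ⟨⟨hx1, hx2⟩, hQE⟩
    obtain ⟨k, hxk⟩ := mem_iUnion.1 (hcov hx)
    exact hQ3 k (mem_image_of_mem f ⟨hx, hxk⟩)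
  filter_upwards [ae_all_iff.2 hpiece, hnull_of _ hnull, (measure_compl_msupp μ :
      ∀ᵐ Q ∂μ, Q ∈ msupp μ)] with Q h1 h2 h3
  by_contra hcon
  exact h2 ⟨h3, fun h4 => by
    obtain ⟨i, hi⟩ := mem_iUnion.1 h4
    exact hcon (h1 i hi)⟩

end Sard

section Derivative

variable {n : ℕ} {d α C₀ B c : ℝ} {μ : Measure (ES n)} {K : ES n → ℝ}

theorem IsAhlfors.integrable_weight (hμ : IsAhlfors d μ C₀) {Q : ES n} (hQ : Q ∈ msupp μ) {r s : ℝ}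
    (hr : 0 < r) (hs : 0 < s) (hds : d < s) :
    Integrable (fun y => (1 + dist y Q / r) ^ (-s)) μ := by
  refine ⟨(measurable_weight _ _ _).aestronglyMeasurable, ?_⟩
  rw [hasFiniteIntegral_iff_ofReal (Eventually.of_forall fun ζ => by positivity)]
  exact (lintegral_weight_le hr hs (by linarith [hμ.1]) fun ρ hρ => (hμ.2 Q hQ ρ hρ).2).trans_lt
    (ENNReal.mul_lt_top ENNReal.ofReal_lt_top (lintegral_Ioo_rpow_lt_top hs hds))

theorem rpow_neg_le_weight {s a b Λ : ℝ} (hs : 0 ≤ s) (ha : 0 < a) (hΛ : 0 < Λ) (hb : 0 ≤ b)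
    (h : 1 + b ≤ Λ * a) : a ^ (-s) ≤ Λ ^ s * (1 + b) ^ (-s) := by
  have h1 : (Λ * a) ^ (-s) ≤ (1 + b) ^ (-s) :=
    Real.rpow_le_rpow_of_nonpos (by positivity) h (by linarith)
  rw [Real.mul_rpow hΛ.le ha.le, Real.rpow_neg hΛ.le] at h1
  have := Real.rpow_pos_of_pos hΛ s
  rwa [inv_mul_le_iff₀ this] at h1

theorem KernelBounds.kern_pos (hK : KernelBounds K B c) (s : ℝ) {z : ES n} (hz : z ≠ 0) :
    0 < kern s K z :=
  div_pos (hK.pos_c.trans_le (hK.lower z hz)) (Real.rpow_pos_of_pos (norm_pos_iff.2 hz) _)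

theorem RK_eq : RK d α K μ = fun x => ∫ y, kern (d + α) K (x - y) ∂μ := rfl

theorem hasFDerivAt_RK_aux (hμ : IsAhlfors d μ C₀) (hd : 0 ≤ d) (hα : 0 < α)
    (hK : KernelBounds K B c) {Q : ES n} (hQ : Q ∈ msupp μ) {x : ES n} (hx : x ∉ msupp μ) :
    Integrable (fun y => kern (d + α) K (x - y)) μ ∧
      Integrable (fun y => kernDeriv (d + α) K (x - y)) μ ∧
      HasFDerivAt (RK d α K μ) (∫ y, kernDeriv (d + α) K (x - y) ∂μ) x := by
  set s := d + α with hs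
  have hs0 : 0 < s := by positivity
  have hne : (msupp μ).Nonempty := ⟨Q, hQ⟩
  have hδ : 0 < infDist x (msupp μ) := ((isClosed_msupp μ).notMem_iff_infDist_pos hne).1 hx
  set δ := infDist x (msupp μ) / 2 with hδdef
  have hδ0 : 0 < δ := by positivity
  set Λ := (1 + δ + dist x Q) / δ + 1 with hΛ
  have hΛ0 : 0 < Λ := by positivity
  have hae : ∀ᵐ y ∂μ, y ∈ msupp μ := measure_compl_msupp μ
  have hfar : ∀ x' ∈ ball x δ, ∀ y ∈ msupp μ, δ ≤ ‖x' - y‖ := fun x' hx' y hy => by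
    have h1 := infDist_le_dist_of_mem (x := x) hy
    have h2 := dist_triangle x x' y
    rw [mem_ball, dist_comm] at hx'
    rw [← dist_eq_norm]
    linarith
  have hw : ∀ x' ∈ ball x δ, ∀ y ∈ msupp μ,
      ‖x' - y‖ ^ (-s) ≤ Λ ^ s * (1 + dist y Q / 1) ^ (-s) := fun x' hx' y hy => by
    have h1 := hfar x' hx' y hy
    refine rpow_neg_le_weight hs0.le (hδ0.trans_le h1) hΛ0 (by positivity) ?_
    rw [div_one]
    have h2 : dist y Q ≤ ‖x' - y‖ + δ + dist x Q := by
      have h3 := dist_triangle4 y x' x Q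
      rw [dist_comm y x', dist_eq_norm x' y] at h3
      rw [mem_ball] at hx'
      linarith
    have h4 : (1 + δ + dist x Q) ≤ (1 + δ + dist x Q) / δ * ‖x' - y‖ := by
      rw [div_mul_eq_mul_div, le_div_iff₀ hδ0]
      gcongr
    rw [hΛ, add_mul, one_mul]
    linarith
  have hwi := hμ.integrable_weight hQ one_pos hs0 (by linarith : d < s)
  have hsub : ∀ x' : ES n, Measurable fun y => x' - y := fun x' => by fun_prop
  have hm1 : ∀ x' : ES n, AEStronglyMeasurable (fun y => kern s K (x' - y)) μ := fun x' =>
    ((hK.measurable_kern s).comp (hsub x')).aestronglyMeasurable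
  have hm2 : ∀ x' : ES n, AEStronglyMeasurable (fun y => kernDeriv s K (x' - y)) μ := fun x' =>
    ((hK.measurable_kernDeriv s).comp (hsub x')).aestronglyMeasurable
  have hxb : x ∈ ball x δ := mem_ball_self hδ0
  have hnz : ∀ x' ∈ ball x δ, ∀ y ∈ msupp μ, x' - y ≠ 0 := fun x' hx' y hy h0 => by
    have := hfar x' hx' y hy
    rw [h0, norm_zero] at this
    linarith
  have hD : ∀ x' ∈ ball x δ, ∀ y ∈ msupp μ, ‖kernDeriv s K (x' - y)‖ ≤
      (1 + s) * B * δ⁻¹ * Λ ^ s * (1 + dist y Q / 1) ^ (-s) := fun x' hx' y hy => by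
    refine (hK.norm_kernDeriv_le hs0 (hnz x' hx' y hy)).trans ?_
    have h1 := hfar x' hx' y hy
    have hp : 0 < ‖x' - y‖ := hδ0.trans_le h1
    rw [Real.rpow_sub hp, Real.rpow_one, div_eq_inv_mul, mul_assoc ((1 + s) * B * δ⁻¹),
      mul_assoc ((1 + s) * B)]
    have := hK.pos_B
    gcongr
    exact hw x' hx' y hy
  have hi1 : Integrable (fun y => kern s K (x - y)) μ := by
    refine ((hwi.const_mul (Λ ^ s)).const_mul B).mono' (hm1 x) (hae.mono fun y hy => ?_)
    refine (hK.norm_kern_le s (hnz x hxb y hy)).trans ?_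
    have := hK.pos_B
    gcongr
    exact hw x hxb y hy
  have hi2 : Integrable (fun y => kernDeriv s K (x - y)) μ :=
    (hwi.const_mul _).mono' (hm2 x) (hae.mono fun y hy => hD x hxb y hy)
  refine ⟨hi1, hi2, ?_⟩
  rw [RK_eq]
  refine hasFDerivAt_integral_of_dominated_of_fderiv_le (s := ball x δ)
    (F := fun x' y => kern s K (x' - y))
    (F' := fun x' y => kernDeriv s K (x' - y)) (ball_mem_nhds x hδ0)
    (Eventually.of_forall hm1) hi1 (hm2 x) (hae.mono fun y hy x' hx' => hD x' hx' y hy)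
    (hwi.const_mul _) (hae.mono fun y hy x' hx' => ?_)
  have h0 := hnz x' hx' y hy
  have := (hasFDerivAt_kern s h0 (hK.diff _ h0)).comp x' ((hasFDerivAt_id x').sub_const y)
  exact this

theorem RK_pos (hμ : IsAhlfors d μ C₀) (hd : 0 ≤ d) (hα : 0 < α)
    (hK : KernelBounds K B c) {Q : ES n} (hQ : Q ∈ msupp μ) {x : ES n} (hx : x ∉ msupp μ) :
    0 < RK d α K μ x := by
  have hi := (hasFDerivAt_RK_aux hμ hd hα hK hQ hx).1
  have hae : ∀ᵐ y ∂μ, y ∈ msupp μ := measure_compl_msupp μ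
  have hpos : ∀ᵐ y ∂μ, 0 < kern (d + α) K (x - y) := hae.mono fun y hy =>
    hK.kern_pos _ (sub_ne_zero.2 fun h => hx (h ▸ hy))
  rw [RK_eq]
  refine lt_of_le_of_ne (integral_nonneg_of_ae (hpos.mono fun y hy => hy.le)) fun h0 => ?_
  have h1 := (integral_eq_zero_iff_of_nonneg_ae (hpos.mono fun y hy => hy.le) hi).1 h0.symm
  have h2 : ∀ᵐ y ∂μ, False := by
    filter_upwards [h1, hpos] with y h3 h4
    rw [h3] at h4
    exact lt_irrefl _ h4
  have h3 : μ = 0 := by rwa [eventually_false_iff_eq_bot, ae_eq_bot] at h2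
  have := hQ 1 one_pos
  simp [h3] at this

theorem hasFDerivAt_DK (hμ : IsAhlfors d μ C₀) (hd : 0 ≤ d) (hα : 0 < α)
    (hK : KernelBounds K B c) {Q : ES n} (hQ : Q ∈ msupp μ) {x : ES n} (hx : x ∉ msupp μ) :
    HasFDerivAt (DK d α K μ)
      ((-α⁻¹ * RK d α K μ x ^ (-α⁻¹ - 1)) • ∫ y, kernDeriv (d + α) K (x - y) ∂μ) x :=
  (hasFDerivAt_RK_aux hμ hd hα hK hQ hx).2.2.rpow_const (Or.inl (RK_pos hμ hd hα hK hQ hx).ne')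

theorem norm_gradient_eq (f : ES n → ℝ) (x : ES n) : ‖gradient f x‖ = ‖fderiv ℝ f x‖ := by
  simp [gradient]

theorem norm_gradient_DK (hμ : IsAhlfors d μ C₀) (hd : 0 ≤ d) (hα : 0 < α)
    (hK : KernelBounds K B c) {Q : ES n} (hQ : Q ∈ msupp μ) {x : ES n} (hx : x ∉ msupp μ) :
    ‖gradient (DK d α K μ) x‖ =
      α⁻¹ * RK d α K μ x ^ (-α⁻¹ - 1) * ‖∫ y, kernDeriv (d + α) K (x - y) ∂μ‖ := by
  have := RK_pos hμ hd hα hK hQ hx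
  rw [norm_gradient_eq, (hasFDerivAt_DK hμ hd hα hK hQ hx).fderiv, norm_smul, norm_mul, norm_neg,
    Real.norm_of_nonneg (by positivity), Real.norm_of_nonneg (by positivity)]

end Derivative

section Flat

variable {n d : ℕ}

theorem integrable_of_norm_le_weight {F : Type*} [NormedAddCommGroup F] {A : ES d →L[ℝ] ES n}
    {c₀ s C : ℝ} (hc₀ : 0 < c₀) (hA : ∀ ζ, c₀ * ‖ζ‖ ≤ ‖A ζ‖) (hds : (d : ℝ) < s) {G : ES d → F}
    (hG : StronglyMeasurable G) (hb : ∀ ζ, ‖G ζ‖ ≤ C * (1 + ‖A ζ‖) ^ (-s)) :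
    Integrable G := by
  have hd : (0 : ℝ) ≤ d := Nat.cast_nonneg d
  have hC : 0 ≤ C := by
    have h0 := (norm_nonneg _).trans (hb 0)
    simpa using h0
  refine ((integrable_weight hds).const_mul (C * (min 1 c₀) ^ (-s))).mono'
    hG.aestronglyMeasurable (Eventually.of_forall fun ζ => (hb ζ).trans ?_)
  rw [mul_assoc]
  gcongr
  exact one_add_rpow_neg_le (by linarith) hc₀ (norm_nonneg _) (hA ζ)

theorem exists_eq_add_orthogonal (A : ES d →L[ℝ] ES n) (w : ES n) :
    ∃ (ζ₀ : ES d) (u : ES n), w = A ζ₀ + u ∧ ∀ ζ, inner ℝ u (A ζ) = 0 := by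
  set p := LinearMap.range A.toLinearMap
  obtain ⟨y, hy, z, hz, h⟩ := p.exists_add_mem_mem_orthogonal w
  obtain ⟨ζ₀, rfl⟩ := hy
  refine ⟨ζ₀, z, h, fun ζ => ?_⟩
  have := (Submodule.mem_orthogonal' _ _).1 hz (A ζ) ⟨ζ, rfl⟩
  exact this

theorem norm_sub_map_sq {A : ES d →L[ℝ] ES n} {ζ₀ : ES d} {u : ES n}
    (hu : ∀ ζ, inner ℝ u (A ζ) = 0) (ζ : ES d) :
    ‖A ζ₀ + u - A ζ‖ ^ 2 = ‖u‖ ^ 2 + ‖A (ζ - ζ₀)‖ ^ 2 := by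
  have h : A ζ₀ + u - A ζ = u - A (ζ - ζ₀) := by
    rw [map_sub]; abel
  rw [h, norm_sub_sq_real, hu]
  ring

theorem norm_sub_map_rpow {A : ES d →L[ℝ] ES n} {ζ₀ : ES d} {u : ES n}
    (hu : ∀ ζ, inner ℝ u (A ζ) = 0) (hu0 : u ≠ 0) (p : ℝ) (ζ : ES d) :
    ‖A ζ₀ + u - A ζ‖ ^ (-p) =
      ‖u‖ ^ (-p) * (1 + ‖A (‖u‖⁻¹ • (ζ - ζ₀))‖ ^ 2) ^ (-p / 2) := by
  have hu' : 0 < ‖u‖ := norm_pos_iff.2 hu0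
  have e : ∀ t : ℝ, 0 ≤ t → t ^ (-p) = (t ^ 2) ^ (-p / 2) := fun t ht => by
    rw [← Real.rpow_natCast, ← Real.rpow_mul ht]
    congr 1; push_cast; ring
  rw [e _ (norm_nonneg _), e _ (norm_nonneg u), norm_sub_map_sq hu,
    ← Real.mul_rpow (by positivity) (by positivity)]
  congr 1
  rw [map_smul, norm_smul, norm_inv, norm_norm]
  field_simp

theorem integral_norm_sub_map_rpow {A : ES d →L[ℝ] ES n} {ζ₀ : ES d} {u : ES n}
    (hu : ∀ ζ, inner ℝ u (A ζ) = 0) (hu0 : u ≠ 0) (p : ℝ) :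
    ∫ ζ, ‖A ζ₀ + u - A ζ‖ ^ (-p) =
      ‖u‖ ^ ((d : ℝ) - p) * ∫ ζ, (1 + ‖A ζ‖ ^ 2) ^ (-p / 2) := by
  have hu' : 0 < ‖u‖ := norm_pos_iff.2 hu0
  simp_rw [norm_sub_map_rpow hu hu0 p]
  rw [integral_const_mul,
    integral_comp_inv_smul_sub ζ₀ hu' fun ξ => (1 + ‖A ξ‖ ^ 2) ^ (-p / 2), smul_eq_mul,
    ← mul_assoc, ← Real.rpow_add hu']
  congr 2
  ring

theorem integral_norm_sub_map_rpow_smul {A : ES d →L[ℝ] ES n} {ζ₀ : ES d} {u : ES n}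
    (hu : ∀ ζ, inner ℝ u (A ζ) = 0) (hu0 : u ≠ 0) (p : ℝ)
    (hi : Integrable fun ζ => ‖A ζ₀ + u - A ζ‖ ^ (-p) • (innerSL ℝ (A ζ₀ + u - A ζ) : ES n →L[ℝ] ℝ)) :
    ∫ ζ, ‖A ζ₀ + u - A ζ‖ ^ (-p) • (innerSL ℝ (A ζ₀ + u - A ζ) : ES n →L[ℝ] ℝ) =
      (‖u‖ ^ ((d : ℝ) - p) * ∫ ζ, (1 + ‖A ζ‖ ^ 2) ^ (-p / 2)) • innerSL ℝ u := by
  set G := fun ζ => ‖A ζ₀ + u - A ζ‖ ^ (-p) • (innerSL ℝ (A ζ₀ + u - A ζ) : ES n →L[ℝ] ℝ) with hG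
  have hrefl : ∫ ζ, G ((2 : ℝ) • ζ₀ - ζ) = ∫ ζ, G ζ := integral_sub_left_eq_self G volume _
  have hi2 : Integrable fun ζ => G ((2 : ℝ) • ζ₀ - ζ) := hi.comp_sub_left _
  have hn : ∀ ζ, ‖A ζ₀ + u - A ((2 : ℝ) • ζ₀ - ζ)‖ = ‖A ζ₀ + u - A ζ‖ := fun ζ => by
    rw [← sq_eq_sq₀ (norm_nonneg _) (norm_nonneg _), norm_sub_map_sq hu, norm_sub_map_sq hu,
      ← norm_neg (A _), ← map_neg]
    congr 4
    rw [two_smul]; abel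
  have hsum : ∀ ζ, G ζ + G ((2 : ℝ) • ζ₀ - ζ) =
      (2 * ‖A ζ₀ + u - A ζ‖ ^ (-p)) • (innerSL ℝ u : ES n →L[ℝ] ℝ) := fun ζ => by
    simp only [hG]
    have h : A ζ₀ + u - A ζ + (A ζ₀ + u - A ((2 : ℝ) • ζ₀ - ζ)) = (2 : ℝ) • u := by
      rw [map_sub, map_smul, two_smul, two_smul]; abel
    rw [hn, ← smul_add, ← map_add, h]
    ext v
    simp only [smul_apply, innerSL_apply_apply, inner_smul_left, smul_eq_mul,
      conj_trivial]
    ring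
  have h2 : (2 : ℝ) • ∫ ζ, G ζ =
      (2 : ℝ) • (‖u‖ ^ ((d : ℝ) - p) * ∫ ζ, (1 + ‖A ζ‖ ^ 2) ^ (-p / 2)) •
        (innerSL ℝ u : ES n →L[ℝ] ℝ) := by
    rw [two_smul]
    nth_rw 2 [← hrefl]
    rw [← integral_add hi hi2]
    simp_rw [hsum]
    rw [integral_smul_const, integral_const_mul, integral_norm_sub_map_rpow hu hu0, mul_smul]
  exact smul_right_injective _ (two_ne_zero' ℝ) h2

end Flat

section Sequences

variable {n d : ℕ} {α C₀ B c θ c₀ η : ℝ} {μ : Measure (ES n)} {K : ES n → ℝ} {Q : ES n}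
  {A : ES d →L[ℝ] ES n} {r : ℕ → ℝ} {w : ℕ → ES n} {w₀ : ES n}

theorem BlowsUp.le_norm_sub_map (hbl : BlowsUp μ d Q A θ) (hθ : 0 < θ) (hc₀ : 0 < c₀)
    (hA : ∀ ζ, c₀ * ‖ζ‖ ≤ ‖A ζ‖) (hη1 : η ≤ 1) (hr : ∀ i, 0 < r i)
    (hr0 : Tendsto r atTop (𝓝 0)) (hw1 : ∀ i, ‖w i‖ = 1) (hw : Tendsto w atTop (𝓝 w₀))
    (hsep : ∀ i y, Q + r i • y ∈ msupp μ → η ≤ ‖w i - y‖) (ζ : ES d) : η ≤ ‖w₀ - A ζ‖ := by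
  have hd : (0 : ℝ) ≤ d := Nat.cast_nonneg d
  have hw01 : ‖w₀‖ = 1 := tendsto_nhds_unique hw.norm (by simp [hw1])
  set G : ES d → ℝ := fun ζ => max 0 (η - ‖w₀ - A ζ‖) with hGdef
  have hGc : Continuous G := by fun_prop
  have hGb : ∀ ζ, ‖G ζ‖ ≤ 3 ^ ((d : ℝ) + 1) * (1 + ‖A ζ‖) ^ (-((d : ℝ) + 1)) := fun ζ => by
    rw [Real.norm_of_nonneg (le_max_left _ _)]
    rcases le_total (η - ‖w₀ - A ζ‖) 0 with h | h
    · rw [max_eq_left h]; positivity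
    · have h1 : 1 + ‖A ζ‖ ≤ 3 * 1 := by
        have := norm_sub_norm_le (A ζ) w₀
        rw [norm_sub_rev] at this
        linarith
      have h2 := rpow_neg_le_weight (s := (d : ℝ) + 1) (by linarith) one_pos (by norm_num : (0 : ℝ) < 3)
        (norm_nonneg (A ζ)) h1
      rw [Real.one_rpow] at h2
      refine le_trans ?_ h2
      exact max_le zero_le_one (by linarith [norm_nonneg (w₀ - A ζ)])
  have hlim := hbl ℝ ((d : ℝ) + 1) (3 ^ ((d : ℝ) + 1)) r (fun i y => max 0 (η - ‖w i - y‖)) G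
    (by linarith) hr hr0 (fun i => (by fun_prop : Continuous _).stronglyMeasurable)
    hGc.stronglyMeasurable (fun i y hy => ?_) hGb (fun ζ => ?_)
  · have hz : ∀ i, ∫ y, max 0 (η - ‖w i - (r i)⁻¹ • (y - Q)‖) ∂μ = 0 := fun i => by
      refine integral_eq_zero_of_ae ?_
      have hae : ∀ᵐ y ∂μ, y ∈ msupp μ := measure_compl_msupp μ
      filter_upwards [hae] with y hy
      refine max_eq_left (sub_nonpos.2 (hsep i _ ?_))
      rwa [smul_inv_smul₀ (hr i).ne', add_sub_cancel]
    simp_rw [hz, smul_zero] at hlim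
    have h0 : ∫ ζ, G ζ = 0 := by
      have := tendsto_nhds_unique hlim tendsto_const_nhds
      exact (smul_eq_zero.1 this).resolve_left hθ.ne'
    have hGi : Integrable G :=
      integrable_of_norm_le_weight hc₀ hA (by linarith) hGc.stronglyMeasurable hGb
    rw [integral_eq_zero_iff_of_nonneg (show 0 ≤ G from fun ζ => le_max_left _ _) hGi] at h0
    have h1 := (Continuous.ae_eq_iff_eq volume hGc continuous_const).1 h0
    have h2 : G ζ = 0 := congrFun h1 ζ
    have h3 : η - ‖w₀ - A ζ‖ ≤ G ζ := le_max_right _ _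
    rw [h2] at h3
    linarith
  · rw [max_eq_left (sub_nonpos.2 (hsep i y hy)), norm_zero]
    positivity
  · have h1 : Tendsto (fun p : ℕ × ES n => w p.1 - p.2) (atTop ×ˢ 𝓝 (A ζ)) (𝓝 (w₀ - A ζ)) :=
      (hw.comp tendsto_fst).sub tendsto_snd
    exact (tendsto_const_nhds (x := (0 : ℝ))).max (h1.norm.const_sub η)

theorem weight_of_le_norm_sub {E : Type*} [NormedAddCommGroup E] {s : ℝ} (hs : 0 ≤ s) (hη : 0 < η)
    {w y : E} (hw : ‖w‖ = 1) (h : η ≤ ‖w - y‖) :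
    ‖w - y‖ ^ (-s) ≤ (2 / η + 1) ^ s * (1 + ‖y‖) ^ (-s) := by
  refine rpow_neg_le_weight hs (hη.trans_le h) (by positivity) (norm_nonneg _) ?_
  have h1 := norm_sub_norm_le y w
  rw [norm_sub_rev, hw] at h1
  have h2 : 2 ≤ 2 / η * ‖w - y‖ := by
    rw [div_mul_eq_mul_div, le_div_iff₀ hη]; gcongr
  linarith

theorem kern_smul (s : ℝ) {t : ℝ} (ht : 0 < t) (z : ES n) :
    t ^ s * kern s K (t • z) = K (t • z) * ‖z‖ ^ (-s) := by
  have := (Real.rpow_pos_of_pos ht s).ne'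
  rw [kern, norm_smul, Real.norm_of_nonneg ht.le, Real.mul_rpow ht.le (norm_nonneg _),
    Real.rpow_neg (norm_nonneg _)]
  field_simp

theorem kernDeriv_smul (s : ℝ) {t : ℝ} (ht : 0 < t) (z : ES n) :
    t ^ (s + 1) • kernDeriv s K (t • z) = ‖z‖ ^ (-s) • (t • fderiv ℝ K (t • z)) -
      (s * K (t • z)) • (‖z‖ ^ (-(s + 2)) • (innerSL ℝ z : ES n →L[ℝ] ℝ)) := by
  have e1 : t ^ (s + 1) * t ^ (-s) = t := by
    rw [← Real.rpow_add ht]; simp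
  have e2 : t ^ (s + 1) * t ^ (-s - 2) * t = 1 := by
    rw [← Real.rpow_add ht, ← Real.rpow_add_one ht.ne']; ring_nf; simp
  rw [kernDeriv, norm_smul, Real.norm_of_nonneg ht.le, Real.mul_rpow ht.le (norm_nonneg _),
    Real.mul_rpow ht.le (norm_nonneg _), smul_sub, neg_add']
  ext v
  simp only [sub_apply, smul_apply, smul_eq_mul, innerSL_apply_apply, inner_smul_left, conj_trivial]
  linear_combination (‖z‖ ^ (-s) * fderiv ℝ K (t • z) v) * e1 -
    (s * K (t • z) * ‖z‖ ^ (-s - 2) * inner ℝ z v) * e2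

end Sequences

section Limits

variable {n d : ℕ} {α C₀ B c θ c₀ η κ : ℝ} {μ : Measure (ES n)} {K : ES n → ℝ} {Q : ES n}
  {A : ES d →L[ℝ] ES n} {r : ℕ → ℝ} {x w : ℕ → ES n} {w₀ : ES n}

theorem tendsto_smul_sub_nhdsNE {ζ : ES n} (hr : ∀ i, 0 < r i) (hr0 : Tendsto r atTop (𝓝 0))
    (hw : Tendsto w atTop (𝓝 w₀)) (hne : w₀ - ζ ≠ 0) :
    Tendsto (fun p : ℕ × ES n => r p.1 • (w p.1 - p.2)) (atTop ×ˢ 𝓝 ζ) (𝓝[≠] 0) := by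
  have h1 : Tendsto (fun p : ℕ × ES n => w p.1 - p.2) (atTop ×ˢ 𝓝 ζ) (𝓝 (w₀ - ζ)) :=
    (hw.comp tendsto_fst).sub tendsto_snd
  refine tendsto_nhdsWithin_iff.2 ⟨?_, ?_⟩
  · have := (hr0.comp (tendsto_fst (g := 𝓝 ζ))).smul h1
    rwa [zero_smul] at this
  · filter_upwards [h1.eventually_ne hne] with p hp
    exact smul_ne_zero (hr _).ne' hp

theorem stronglyMeasurable_norm_sub_map_rpow (p : ℝ) :
    StronglyMeasurable fun ζ => ‖w₀ - A ζ‖ ^ (-p) := by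
  have h : Measurable fun ζ => ‖w₀ - A ζ‖ :=
    (by fun_prop : Continuous fun ζ => ‖w₀ - A ζ‖).measurable
  exact (h.pow_const _).stronglyMeasurable

theorem stronglyMeasurable_norm_sub_map_rpow_smul (p : ℝ) :
    StronglyMeasurable fun ζ => ‖w₀ - A ζ‖ ^ (-p) • (innerSL ℝ (w₀ - A ζ) : ES n →L[ℝ] ℝ) :=
  (stronglyMeasurable_norm_sub_map_rpow p).smul
    (by fun_prop : Continuous fun ζ => (innerSL ℝ (w₀ - A ζ) : ES n →L[ℝ] ℝ)).stronglyMeasurable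

/-- The common non-tangential limit determined by the blow-up of the kernel and of the measure. -/
noncomputable def ntLimit (A : ES d →L[ℝ] ES n) (α θ κ : ℝ) : ℝ :=
  α⁻¹ * (θ * (κ * ∫ ζ, (1 + ‖A ζ‖ ^ 2) ^ (-(d + α) / 2))) ^ (-α⁻¹ - 1) *
    (θ * ((d + α) * κ * ∫ ζ, (1 + ‖A ζ‖ ^ 2) ^ (-(d + α + 2) / 2)))

theorem BlowsUp.tendsto_integral_kern (hα : 0 < α)
    (hK : KernelBounds K B c) (hbl : BlowsUp μ d Q A θ)
    (h1 : Tendsto K (𝓝[≠] 0) (𝓝 κ)) (hη : 0 < η) (hr : ∀ i, 0 < r i)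
    (hr0 : Tendsto r atTop (𝓝 0)) (hw1 : ∀ i, ‖w i‖ = 1) (hw : Tendsto w atTop (𝓝 w₀))
    (hsep : ∀ i y, Q + r i • y ∈ msupp μ → η ≤ ‖w i - y‖)
    (hsep₀ : ∀ ζ, η ≤ ‖w₀ - A ζ‖) :
    Tendsto (fun i => r i ^ α * RK d α K μ (Q + r i • w i)) atTop
      (𝓝 (θ * (κ * ∫ ζ, ‖w₀ - A ζ‖ ^ (-(d + α))))) := by
  have hd : (0 : ℝ) ≤ d := Nat.cast_nonneg d
  have hw01 : ‖w₀‖ = 1 := tendsto_nhds_unique hw.norm (by simp [hw1])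
  set s : ℝ := d + α with hs
  have hs0 : 0 < s := by positivity
  have hB := hK.pos_B
  have hne : ∀ ζ, w₀ - A ζ ≠ 0 := fun ζ => norm_pos_iff.1 (hη.trans_le (hsep₀ ζ))
  have hlim := hbl ℝ s (max B |κ| * (2 / η + 1) ^ s) r
    (fun i y => r i ^ s * kern s K (r i • (w i - y))) (fun ζ => κ * ‖w₀ - A ζ‖ ^ (-s))
    (by linarith) hr hr0 (fun i => ?_)
    ((stronglyMeasurable_norm_sub_map_rpow s).const_mul κ) (fun i y hy => ?_) (fun ζ => ?_)
    (fun ζ => ?_)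
  · rw [integral_const_mul] at hlim
    refine hlim.congr fun i => ?_
    have e : ∀ y : ES n, r i • (w i - (r i)⁻¹ • (y - Q)) = Q + r i • w i - y := fun y => by
      rw [smul_sub, smul_inv_smul₀ (hr i).ne']; abel
    simp_rw [e]
    rw [integral_const_mul, RK_eq, smul_eq_mul, ← mul_assoc]
    congr 1
    rw [hs, Real.rpow_add (hr i)]
    have := (Real.rpow_pos_of_pos (hr i) d).ne'
    field_simp
  · have hm : Measurable fun y : ES n => r i • (w i - y) := by fun_prop
    exact (((hK.measurable_kern s).comp hm).const_mul _).stronglyMeasurable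
  · have h2 := hsep i y hy
    have h3 : w i - y ≠ 0 := norm_pos_iff.1 (hη.trans_le h2)
    rw [kern_smul s (hr i), norm_mul, Real.norm_of_nonneg (Real.rpow_nonneg (norm_nonneg _) _),
      mul_assoc]
    gcongr
    · exact (hK.upper _ (smul_ne_zero (hr i).ne' h3)).trans (le_max_left _ _)
    · exact weight_of_le_norm_sub hs0.le hη (hw1 i) h2
  · rw [norm_mul, Real.norm_of_nonneg (Real.rpow_nonneg (norm_nonneg _) _), mul_assoc]
    gcongr
    · exact le_max_right _ _
    · exact weight_of_le_norm_sub hs0.le hη hw01 (hsep₀ ζ)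
  · have h4 := tendsto_smul_sub_nhdsNE hr hr0 hw (hne ζ)
    have h5 : Tendsto (fun p : ℕ × ES n => w p.1 - p.2) (atTop ×ˢ 𝓝 (A ζ)) (𝓝 (w₀ - A ζ)) :=
      (hw.comp tendsto_fst).sub tendsto_snd
    refine ((h1.comp h4).mul (h5.norm.rpow_const (p := -s)
      (Or.inl (norm_ne_zero_iff.2 (hne ζ))))).congr fun p => ?_
    exact (kern_smul s (hr p.1) _).symm

theorem BlowsUp.tendsto_integral_kernDeriv (hα : 0 < α)
    (hK : KernelBounds K B c) (hbl : BlowsUp μ d Q A θ)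
    (h1 : Tendsto K (𝓝[≠] 0) (𝓝 κ))
    (h1' : Tendsto (fun x => ‖x‖ * ‖fderiv ℝ K x‖) (𝓝[≠] 0) (𝓝 0))
    (hη : 0 < η) (hr : ∀ i, 0 < r i)
    (hr0 : Tendsto r atTop (𝓝 0)) (hw1 : ∀ i, ‖w i‖ = 1) (hw : Tendsto w atTop (𝓝 w₀))
    (hsep : ∀ i y, Q + r i • y ∈ msupp μ → η ≤ ‖w i - y‖)
    (hsep₀ : ∀ ζ, η ≤ ‖w₀ - A ζ‖) :
    Tendsto (fun i => r i ^ (α + 1) • ∫ y, kernDeriv (d + α) K (Q + r i • w i - y) ∂μ) atTop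
      (𝓝 (-(θ * ((d + α) * κ)) • ∫ ζ, ‖w₀ - A ζ‖ ^ (-(d + α + 2)) •
        (innerSL ℝ (w₀ - A ζ) : ES n →L[ℝ] ℝ))) := by
  have hd : (0 : ℝ) ≤ d := Nat.cast_nonneg d
  have hw01 : ‖w₀‖ = 1 := tendsto_nhds_unique hw.norm (by simp [hw1])
  set s : ℝ := d + α with hs
  have hs0 : 0 < s := by positivity
  have hB := hK.pos_B
  have hne : ∀ ζ, w₀ - A ζ ≠ 0 := fun ζ => norm_pos_iff.1 (hη.trans_le (hsep₀ ζ))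
  have hlim := hbl (ES n →L[ℝ] ℝ) s (max ((1 + s) * B) (s * |κ|) * η⁻¹ * (2 / η + 1) ^ s) r
    (fun i y => r i ^ (s + 1) • kernDeriv s K (r i • (w i - y)))
    (fun ζ => -(s * κ) • (‖w₀ - A ζ‖ ^ (-(s + 2)) • (innerSL ℝ (w₀ - A ζ) : ES n →L[ℝ] ℝ)))
    (by linarith) hr hr0 (fun i => ?_)
    ((stronglyMeasurable_norm_sub_map_rpow_smul (s + 2)).fun_const_smul _) (fun i y hy => ?_)
    (fun ζ => ?_) (fun ζ => ?_)
  · rw [integral_smul, smul_smul, mul_neg] at hlim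
    refine hlim.congr fun i => ?_
    have e : ∀ y : ES n, r i • (w i - (r i)⁻¹ • (y - Q)) = Q + r i • w i - y := fun y => by
      rw [smul_sub, smul_inv_smul₀ (hr i).ne']; abel
    simp_rw [e]
    rw [integral_smul, smul_smul]
    congr 1
    rw [hs, add_assoc, Real.rpow_add (hr i)]
    have := (Real.rpow_pos_of_pos (hr i) d).ne'
    field_simp
  · have hm : Measurable fun y : ES n => r i • (w i - y) := by fun_prop
    exact ((hK.measurable_kernDeriv s).comp hm).stronglyMeasurable.fun_const_smul _
  · have h2 := hsep i y hy
    have h3 : 0 < ‖w i - y‖ := hη.trans_le h2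
    have h4 := hK.norm_kernDeriv_le hs0 (smul_ne_zero (hr i).ne' (norm_pos_iff.1 h3))
    rw [norm_smul, Real.norm_of_nonneg (Real.rpow_nonneg (hr i).le _)]
    rw [norm_smul, Real.norm_of_nonneg (hr i).le, Real.mul_rpow (hr i).le h3.le] at h4
    have e1 : r i ^ (s + 1) * r i ^ (-s - 1) = 1 := by
      rw [← Real.rpow_add (hr i)]; ring_nf; simp
    calc r i ^ (s + 1) * ‖kernDeriv s K (r i • (w i - y))‖
        ≤ r i ^ (s + 1) * ((1 + s) * B * (r i ^ (-s - 1) * ‖w i - y‖ ^ (-s - 1))) := by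
          have := hr i
          gcongr
      _ = (1 + s) * B * ‖w i - y‖ ^ (-s - 1) := by
          linear_combination ((1 + s) * B * ‖w i - y‖ ^ (-s - 1)) * e1
      _ = (1 + s) * B * ‖w i - y‖⁻¹ * ‖w i - y‖ ^ (-s) := by
          rw [Real.rpow_sub h3, Real.rpow_one]; ring
      _ ≤ max ((1 + s) * B) (s * |κ|) * η⁻¹ * ((2 / η + 1) ^ s * (1 + ‖y‖) ^ (-s)) := by
          gcongr
          · exact le_max_left _ _
          · exact weight_of_le_norm_sub hs0.le hη (hw1 i) h2
      _ = _ := by ring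
  · have h3 : 0 < ‖w₀ - A ζ‖ := hη.trans_le (hsep₀ ζ)
    rw [norm_smul, norm_smul, norm_neg, norm_mul, Real.norm_of_nonneg hs0.le, innerSL_apply_norm,
      Real.norm_of_nonneg (Real.rpow_nonneg (norm_nonneg _) _)]
    calc s * ‖κ‖ * (‖w₀ - A ζ‖ ^ (-(s + 2)) * ‖w₀ - A ζ‖)
        = s * |κ| * ‖w₀ - A ζ‖⁻¹ * ‖w₀ - A ζ‖ ^ (-s) := by
          rw [neg_add', Real.rpow_sub h3, Real.rpow_two, Real.norm_eq_abs]
          field_simp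
      _ ≤ max ((1 + s) * B) (s * |κ|) * η⁻¹ * ((2 / η + 1) ^ s * (1 + ‖A ζ‖) ^ (-s)) := by
          gcongr
          · exact le_max_right _ _
          · exact hsep₀ ζ
          · exact weight_of_le_norm_sub hs0.le hη hw01 (hsep₀ ζ)
      _ = _ := by ring
  · have h4 := tendsto_smul_sub_nhdsNE hr hr0 hw (hne ζ)
    have h5 : Tendsto (fun p : ℕ × ES n => w p.1 - p.2) (atTop ×ˢ 𝓝 (A ζ)) (𝓝 (w₀ - A ζ)) :=
      (hw.comp tendsto_fst).sub tendsto_snd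
    have hn0 : ‖w₀ - A ζ‖ ≠ 0 := norm_ne_zero_iff.2 (hne ζ)
    have h6 : Tendsto (fun p : ℕ × ES n => r p.1 • fderiv ℝ K (r p.1 • (w p.1 - p.2)))
        (atTop ×ˢ 𝓝 (A ζ)) (𝓝 0) := by
      rw [tendsto_zero_iff_norm_tendsto_zero]
      have := (h1'.comp h4).div h5.norm hn0
      rw [zero_div] at this
      refine this.congr' ?_
      filter_upwards [h5.norm.eventually_ne hn0] with p hp
      simp only [Function.comp_apply, Pi.div_apply]
      rw [norm_smul, norm_smul]
      field_simp
    have h7 : Tendsto (fun p : ℕ × ES n => (innerSL ℝ (w p.1 - p.2) : ES n →L[ℝ] ℝ))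
        (atTop ×ˢ 𝓝 (A ζ)) (𝓝 (innerSL ℝ (w₀ - A ζ))) :=
      ((innerSL ℝ : ES n →L⋆[ℝ] ES n →L[ℝ] ℝ).continuous.tendsto _).comp h5
    have h8 := ((h5.norm.rpow_const (p := -s) (Or.inl hn0)).smul h6).sub
      (((h1.comp h4).const_mul s).smul
        ((h5.norm.rpow_const (p := -(s + 2)) (Or.inl hn0)).smul h7))
    rw [smul_zero, zero_sub, ← neg_smul] at h8
    refine h8.congr fun p => ?_
    exact (kernDeriv_smul s (hr p.1) _).symm

end Limits

section NonTangential

variable {n d : ℕ} {α C₀ B c θ c₀ η κ : ℝ} {μ : Measure (ES n)} {K : ES n → ℝ} {Q : ES n}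
  {A : ES d →L[ℝ] ES n} {r : ℕ → ℝ} {x w : ℕ → ES n} {w₀ : ES n}

theorem continuous_one_add_norm_map_sq_rpow (A : ES d →L[ℝ] ES n) (p : ℝ) :
    Continuous fun ζ => (1 + ‖A ζ‖ ^ 2) ^ (-p / 2) :=
  (by fun_prop : Continuous fun ζ => 1 + ‖A ζ‖ ^ 2).rpow_const fun ζ => Or.inl (by positivity)

theorem integrable_one_add_norm_map_sq_rpow (hc₀ : 0 < c₀) (hA : ∀ ζ, c₀ * ‖ζ‖ ≤ ‖A ζ‖) {p : ℝ}
    (hp : (d : ℝ) < p) : Integrable fun ζ => (1 + ‖A ζ‖ ^ 2) ^ (-p / 2) := by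
  have hd : (0 : ℝ) ≤ d := Nat.cast_nonneg d
  refine integrable_of_norm_le_weight (C := 2 ^ (p / 2)) hc₀ hA hp
    (continuous_one_add_norm_map_sq_rpow A p).stronglyMeasurable fun ζ => ?_
  rw [Real.norm_of_nonneg (by positivity)]
  have h1 : (1 + ‖A ζ‖) ^ 2 ≤ 2 * (1 + ‖A ζ‖ ^ 2) := by nlinarith [sq_nonneg (1 - ‖A ζ‖)]
  have h2 : (2 * (1 + ‖A ζ‖ ^ 2)) ^ (-p / 2) ≤ ((1 + ‖A ζ‖) ^ 2) ^ (-p / 2) :=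
    Real.rpow_le_rpow_of_nonpos (by positivity) h1 (by linarith)
  rw [Real.mul_rpow (by positivity) (by positivity), neg_div, Real.rpow_neg zero_le_two,
    inv_mul_le_iff₀ (by positivity), ← neg_div, ← Real.rpow_natCast (1 + ‖A ζ‖),
    ← Real.rpow_mul (by positivity)] at h2
  have e : ((2 : ℕ) : ℝ) * (-p / 2) = -p := by push_cast; ring
  rwa [e] at h2

theorem integral_one_add_norm_map_sq_rpow_pos (hc₀ : 0 < c₀) (hA : ∀ ζ, c₀ * ‖ζ‖ ≤ ‖A ζ‖) {p : ℝ}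
    (hp : (d : ℝ) < p) : 0 < ∫ ζ, (1 + ‖A ζ‖ ^ 2) ^ (-p / 2) :=
  integral_pos_of_integrable_nonneg_nonzero (continuous_one_add_norm_map_sq_rpow A p)
    (integrable_one_add_norm_map_sq_rpow hc₀ hA hp) (fun ζ => by positivity) (x := 0) (by simp)

theorem BlowsUp.tendsto_norm_gradient_DK (hμ : IsAhlfors (d : ℝ) μ C₀) (hα : 0 < α)
    (hK : KernelBounds K B c) (hQ : Q ∈ msupp μ) (hθ : 0 < θ) (hc₀ : 0 < c₀)
    (hA : ∀ ζ, c₀ * ‖ζ‖ ≤ ‖A ζ‖) (hbl : BlowsUp μ d Q A θ) (hκ : 0 < κ)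
    (h1 : Tendsto K (𝓝[≠] 0) (𝓝 κ))
    (h1' : Tendsto (fun x => ‖x‖ * ‖fderiv ℝ K x‖) (𝓝[≠] 0) (𝓝 0))
    (hη : 0 < η) (hη1 : η ≤ 1) (hr : ∀ i, 0 < r i)
    (hr0 : Tendsto r atTop (𝓝 0)) (hw1 : ∀ i, ‖w i‖ = 1) (hw : Tendsto w atTop (𝓝 w₀))
    (hx : ∀ i, Q + r i • w i ∉ msupp μ)
    (hsep : ∀ i y, Q + r i • y ∈ msupp μ → η ≤ ‖w i - y‖) :
    Tendsto (fun i => ‖gradient (DK d α K μ) (Q + r i • w i)‖) atTop (𝓝 (ntLimit A α θ κ)) := by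
  have hd : (0 : ℝ) ≤ d := Nat.cast_nonneg d
  have hsep₀ := hbl.le_norm_sub_map hθ hc₀ hA hη1 hr hr0 hw1 hw hsep
  have hR := hbl.tendsto_integral_kern hα hK h1 hη hr hr0 hw1 hw hsep hsep₀
  have hV := hbl.tendsto_integral_kernDeriv hα hK h1 h1' hη hr hr0 hw1 hw hsep hsep₀
  have hw01 : ‖w₀‖ = 1 := tendsto_nhds_unique hw.norm (by simp [hw1])
  obtain ⟨ζ₀, u, rfl, hu⟩ := exists_eq_add_orthogonal A w₀
  have hu0 : u ≠ 0 := by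
    rintro rfl
    have := hsep₀ ζ₀
    rw [add_zero, sub_self, norm_zero] at this
    linarith
  have hu' : 0 < ‖u‖ := norm_pos_iff.2 hu0
  have hi : Integrable fun ζ => ‖A ζ₀ + u - A ζ‖ ^ (-((d : ℝ) + α + 2)) •
      (innerSL ℝ (A ζ₀ + u - A ζ) : ES n →L[ℝ] ℝ) := by
    refine integrable_of_norm_le_weight (C := (2 / η + 1) ^ (d + α + 1)) hc₀ hA
      (by linarith : (d : ℝ) < d + α + 1) (stronglyMeasurable_norm_sub_map_rpow_smul _) fun ζ => ?_
    have h3 : 0 < ‖A ζ₀ + u - A ζ‖ := hη.trans_le (hsep₀ ζ)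
    rw [norm_smul, innerSL_apply_norm, Real.norm_of_nonneg (by positivity),
      ← Real.rpow_add_one h3.ne']
    refine le_of_eq_of_le ?_ (weight_of_le_norm_sub (by positivity) hη hw01 (hsep₀ ζ))
    congr 1; ring
  rw [integral_norm_sub_map_rpow hu hu0] at hR
  rw [integral_norm_sub_map_rpow_smul hu hu0 _ hi] at hV
  have hI1 := integral_one_add_norm_map_sq_rpow_pos hc₀ hA (by linarith : (d : ℝ) < d + α)
  have hI2 := integral_one_add_norm_map_sq_rpow_pos hc₀ hA (by linarith : (d : ℝ) < d + α + 2)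
  rw [ntLimit]
  set I1 := ∫ ζ, (1 + ‖A ζ‖ ^ 2) ^ (-((d : ℝ) + α) / 2)
  set I2 := ∫ ζ, (1 + ‖A ζ‖ ^ 2) ^ (-((d : ℝ) + α + 2) / 2)
  clear_value I1 I2
  have hpos : θ * (κ * (‖u‖ ^ ((d : ℝ) - (d + α)) * I1)) ≠ 0 := by positivity
  have hlim := ((hR.rpow_const (p := -α⁻¹ - 1) (Or.inl hpos)).const_mul α⁻¹).mul hV.norm
  have e : ∀ i, α⁻¹ * (r i ^ α * RK d α K μ (Q + r i • w i)) ^ (-α⁻¹ - 1) *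
      ‖r i ^ (α + 1) • ∫ y, kernDeriv (d + α) K (Q + r i • w i - y) ∂μ‖ =
      ‖gradient (DK d α K μ) (Q + r i • w i)‖ := fun i => by
    have hri := hr i
    rw [norm_gradient_DK hμ hd hα hK hQ (hx i), norm_smul, Real.norm_of_nonneg (by positivity),
      Real.mul_rpow (by positivity) (RK_pos hμ hd hα hK hQ (hx i)).le, ← Real.rpow_mul hri.le]
    have e1 : r i ^ (α * (-α⁻¹ - 1)) * r i ^ (α + 1) = 1 := by
      rw [← Real.rpow_add hri]
      have : α * (-α⁻¹ - 1) + (α + 1) = 0 := by field_simp; ring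
      rw [this, Real.rpow_zero]
    linear_combination (α⁻¹ * RK d α K μ (Q + r i • w i) ^ (-α⁻¹ - 1) *
      ‖∫ y, kernDeriv (d + α) K (Q + r i • w i - y) ∂μ‖) * e1
  simp_rw [e] at hlim
  convert hlim using 2
  rw [norm_smul, norm_smul, norm_neg, innerSL_apply_norm,
    Real.norm_of_nonneg (by positivity), Real.norm_of_nonneg (by positivity)]
  have e3 : θ * (κ * (‖u‖ ^ ((d : ℝ) - (d + α)) * I1)) = ‖u‖ ^ (-α) * (θ * (κ * I1)) := by
    rw [sub_add_cancel_left]; ring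
  rw [e3, Real.mul_rpow (x := ‖u‖ ^ (-α)) (by positivity) (by positivity), ← Real.rpow_mul hu'.le]
  have e2 : ‖u‖ ^ (-α * (-α⁻¹ - 1)) * (‖u‖ ^ ((d : ℝ) - (d + α + 2)) * ‖u‖) = 1 := by
    rw [← Real.rpow_add_one hu'.ne', ← Real.rpow_add hu']
    have : -α * (-α⁻¹ - 1) + (d - (d + α + 2) + 1) = 0 := by field_simp; ring
    rw [this, Real.rpow_zero]
  linear_combination -(α⁻¹ * (θ * (κ * I1)) ^ (-α⁻¹ - 1) * (θ * ((d + α) * κ * I2))) * e2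

theorem HasTangentBlowup.exists_hasNTLimit (hμ : IsAhlfors (d : ℝ) μ C₀) (hα : 0 < α)
    (hK : KernelBounds K B c) (hQ : Q ∈ msupp μ) (hT : HasTangentBlowup μ d Q) (hκ : 0 < κ)
    (h1 : Tendsto K (𝓝[≠] 0) (𝓝 κ))
    (h1' : Tendsto (fun x => ‖x‖ * ‖fderiv ℝ K x‖) (𝓝[≠] 0) (𝓝 0)) :
    ∃ L, ∀ η ∈ Ioo (0 : ℝ) 1,
      HasNTLimit (msupp μ) (fun x => ‖gradient (DK d α K μ) x‖) Q η L := by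
  obtain ⟨A, θ, c₀, hθ, hc₀, hA, hbl⟩ := hT
  refine ⟨ntLimit A α θ κ, fun η hη ε hε => ?_⟩
  by_contra! hcon
  choose x hx hxε using fun i : ℕ => hcon (1 / (i + 1)) (by positivity)
  have hne : ∀ i, 0 < ‖x i - Q‖ := fun i => norm_pos_iff.2 (sub_ne_zero.2 fun h => (hx i).1 (h ▸ hQ))
  set r := fun i => ‖x i - Q‖ with hr
  set w := fun i => (r i)⁻¹ • (x i - Q) with hwdef
  have hxw : ∀ i, Q + r i • w i = x i := fun i => by
    rw [hwdef]; simp only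
    rw [smul_inv_smul₀ (hne i).ne', add_sub_cancel]
  have hw1 : ∀ i, ‖w i‖ = 1 := fun i => by
    rw [hwdef]; simp only
    rw [norm_smul, norm_inv, hr, norm_norm, inv_mul_cancel₀ (hne i).ne']
  have hr0 : Tendsto r atTop (𝓝 0) := by
    refine squeeze_zero (fun i => norm_nonneg _) (fun i => ?_) tendsto_one_div_add_atTop_nhds_zero_nat
    rw [hr]; simp only
    rw [← dist_eq_norm]
    exact (hx i).2.1.le
  have hsep : ∀ i y, Q + r i • y ∈ msupp μ → η ≤ ‖w i - y‖ := fun i y hy => by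
    have h2 := (hx i).2.2.trans (infDist_le_dist_of_mem hy)
    rw [dist_eq_norm, dist_eq_norm, ← hxw i, add_sub_add_left_eq_sub, ← smul_sub, norm_smul, hxw,
      Real.norm_of_nonneg (hne i).le, mul_comm] at h2
    exact le_of_mul_le_mul_left h2 (hne i)
  obtain ⟨w₀, -, φ, hφ, hw⟩ := (isCompact_sphere (0 : ES n) 1).tendsto_subseq
    (x := w) fun i => by simp [hw1]
  have hlim := hbl.tendsto_norm_gradient_DK hμ hα hK hQ hθ hc₀ hA hκ h1 h1' hη.1 hη.2.le
    (fun i => hne (φ i)) (hr0.comp hφ.tendsto_atTop) (fun i => hw1 (φ i)) hw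
    (fun i => by rw [hxw]; exact (hx _).1) (fun i => hsep (φ i))
  obtain ⟨i, hi⟩ := ((Metric.tendsto_nhds.1 hlim) ε hε).exists
  rw [hxw, Real.dist_eq] at hi
  exact absurd hi (not_lt.2 (hxε _))

end NonTangential

section KernelLimit

variable {n : ℕ} {B c κ : ℝ} {K : ES n → ℝ}

theorem tendsto_nhdsNE_zero_of_tendstoUniformlyOn_sphere {F : Type*} [PseudoMetricSpace F]
    {g : ℝ → ES n → F} {a : F}
    (h : TendstoUniformlyOn g (fun _ => a) (𝓝[>] (0 : ℝ)) (sphere 0 1)) :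
    Tendsto (fun x => g ‖x‖ (‖x‖⁻¹ • x)) (𝓝[≠] (0 : ES n)) (𝓝 a) := by
  rw [Metric.tendsto_nhds]
  intro ε hε
  rw [Metric.tendstoUniformlyOn_iff] at h
  filter_upwards [tendsto_norm_nhdsNE_zero.eventually (h ε hε), self_mem_nhdsWithin] with x hx hx0
  have hx' : ‖x‖ ≠ 0 := norm_ne_zero_iff.2 hx0
  rw [dist_comm]
  refine hx _ ?_
  rw [mem_sphere_zero_iff_norm, norm_smul, norm_inv, norm_norm, inv_mul_cancel₀ hx']

theorem tendstoUniformlyOn_kernel_iff (c : ℝ) :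
    (∀ A : Set (ES n), IsCompact A → A ⊆ {(0 : ES n)}ᶜ →
      TendstoUniformlyOn (fun (lam : ℝ) (x : ES n) => K (lam • x))
        (fun _ => c) (𝓝[>] (0 : ℝ)) A ∧
      TendstoUniformlyOn (fun (lam : ℝ) (x : ES n) => fderiv ℝ (fun y => K (lam • y)) x)
        (fun _ => 0) (𝓝[>] (0 : ℝ)) A) ↔
    Tendsto K (𝓝[≠] 0) (𝓝 c) ∧ Tendsto (fun x => ‖x‖ * ‖fderiv ℝ K x‖) (𝓝[≠] 0) (𝓝 0) := by
  constructor
  · intro h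
    obtain ⟨h1, h2⟩ := h (sphere 0 1) (isCompact_sphere _ _) fun x hx h0 => by
      rw [mem_singleton_iff] at h0
      simp [h0] at hx
    have e : ∀ x : ES n, x ≠ 0 → ‖x‖ • ‖x‖⁻¹ • x = x := fun x hx =>
      smul_inv_smul₀ (norm_ne_zero_iff.2 hx) x
    refine ⟨(tendsto_nhdsNE_zero_of_tendstoUniformlyOn_sphere h1).congr' ?_,
      (tendsto_nhdsNE_zero_of_tendstoUniformlyOn_sphere h2).norm.congr' ?_ |>.trans_eq ?_⟩
    · filter_upwards [self_mem_nhdsWithin] with x hx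
      rw [e x hx]
    · filter_upwards [self_mem_nhdsWithin] with x hx
      rw [fderiv_comp_smul, e x hx, norm_smul, norm_norm]
    · rw [norm_zero]
  · rintro ⟨h1, h2⟩ A hA hA0
    rcases A.eq_empty_or_nonempty with rfl | hne
    · exact ⟨tendstoUniformlyOn_empty, tendstoUniformlyOn_empty⟩
    obtain ⟨x₀, hx₀, hmin⟩ := hA.exists_isMinOn hne continuous_norm.continuousOn
    have ha : 0 < ‖x₀‖ := norm_pos_iff.2 (hA0 hx₀)
    obtain ⟨M, hM⟩ := hA.isBounded.exists_norm_le
    have hsmall : ∀ p : ES n → Prop, (∀ᶠ z in 𝓝[≠] 0, p z) →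
        ∀ᶠ lam : ℝ in 𝓝[>] 0, ∀ x ∈ A, p (lam • x) := fun p hp => by
      rw [eventually_nhdsWithin_iff, Metric.eventually_nhds_iff] at hp
      obtain ⟨δ, hδ, hp⟩ := hp
      have hM0 : 0 < M := ha.trans_le (hM _ hx₀)
      filter_upwards [Ioo_mem_nhdsGT (div_pos hδ hM0)] with lam hlam x hx
      refine hp ?_ (smul_ne_zero hlam.1.ne' (hA0 hx))
      rw [dist_zero_right, norm_smul, Real.norm_of_nonneg hlam.1.le]
      calc lam * ‖x‖ ≤ lam * M := by
            have := hlam.1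
            gcongr; exact hM x hx
        _ < δ := (lt_div_iff₀ hM0).1 hlam.2
    rw [Metric.tendstoUniformlyOn_iff, Metric.tendstoUniformlyOn_iff]
    refine ⟨fun ε hε => ?_, fun ε hε => ?_⟩
    · have := hsmall _ (Metric.tendsto_nhds.1 h1 ε hε)
      filter_upwards [this] with lam hlam x hx
      rw [dist_comm]
      exact hlam x hx
    · have := hsmall _ (Metric.tendsto_nhds.1 h2 (ε * ‖x₀‖) (by positivity))
      filter_upwards [this, self_mem_nhdsWithin] with lam hlam hlam0 x hx
      have hlam0 : 0 < lam := hlam0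
      have h3 := hlam x hx
      have hx' : ‖x₀‖ ≤ ‖x‖ := hmin hx
      rw [dist_zero_right, norm_mul, norm_norm, norm_norm, norm_smul] at h3
      rw [dist_zero_left, fderiv_comp_smul, norm_smul]
      refine lt_of_mul_lt_mul_right (lt_of_le_of_lt ?_ h3) ha.le
      calc ‖lam‖ * ‖fderiv ℝ K (lam • x)‖ * ‖x₀‖ ≤ ‖lam‖ * ‖fderiv ℝ K (lam • x)‖ * ‖x‖ := by gcongr
        _ = _ := by ring

theorem KernelBounds.norm_fderiv_sub_le (hK : KernelBounds K B c) {x y : ES n} (hx : x ≠ 0)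
    (hy : ‖y - x‖ ≤ ‖x‖ / 2) :
    ‖fderiv ℝ K y - fderiv ℝ K x‖ ≤ 4 * B / ‖x‖ ^ 2 * ‖y - x‖ := by
  have hx' : 0 < ‖x‖ := norm_pos_iff.2 hx
  have hfar : ∀ z ∈ closedBall x (‖x‖ / 2), ‖x‖ / 2 ≤ ‖z‖ := fun z hz => by
    rw [mem_closedBall, dist_eq_norm, norm_sub_rev] at hz
    linarith [norm_sub_norm_le x z]
  have h0 : ∀ z ∈ closedBall x (‖x‖ / 2), z ≠ 0 := fun z hz =>
    norm_pos_iff.1 (by linarith [hfar z hz])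
  refine (convex_closedBall x (‖x‖ / 2)).norm_image_sub_le_of_norm_fderiv_le
    (fun z hz => hK.diff_fderiv z (h0 z hz)) (fun z hz => ?_)
    (mem_closedBall_self (by positivity)) (by rwa [mem_closedBall, dist_eq_norm])
  have h1 := hK.fderiv_fderiv_le z (h0 z hz)
  have h2 := hfar z hz
  rw [le_div_iff₀ (by positivity)]
  have h3 : ‖x‖ ^ 2 ≤ 4 * ‖z‖ ^ 2 := by nlinarith
  nlinarith [norm_nonneg (fderiv ℝ (fderiv ℝ K) z)]

theorem KernelBounds.norm_taylor_le (hK : KernelBounds K B c) {x v : ES n} (hx : x ≠ 0)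
    (hv : ‖v‖ ≤ ‖x‖ / 2) :
    |K (x + v) - K x - fderiv ℝ K x v| ≤ 4 * B / ‖x‖ ^ 2 * ‖v‖ * ‖v‖ := by
  have hx' : 0 < ‖x‖ := norm_pos_iff.2 hx
  have h0 : ∀ z ∈ closedBall x ‖v‖, z ≠ 0 := fun z hz => by
    rw [mem_closedBall, dist_eq_norm, norm_sub_rev] at hz
    exact norm_pos_iff.1 (by linarith [norm_sub_norm_le x z])
  have := (convex_closedBall x ‖v‖).norm_image_sub_le_of_norm_fderiv_le'
    (C := 4 * B / ‖x‖ ^ 2 * ‖v‖) (φ := fderiv ℝ K x)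
    (fun z hz => hK.diff z (h0 z hz)) (fun z hz => ?_)
    (mem_closedBall_self (norm_nonneg v)) (y := x + v)
    (by rw [mem_closedBall, dist_eq_norm, add_sub_cancel_left])
  · rwa [add_sub_cancel_left, Real.norm_eq_abs] at this
  · rw [mem_closedBall, dist_eq_norm] at hz
    refine (hK.norm_fderiv_sub_le hx (hz.trans hv)).trans ?_
    have := hK.pos_B
    gcongr

theorem KernelBounds.tendsto_norm_mul_norm_fderiv (hK : KernelBounds K B c)
    (h : Tendsto K (𝓝[≠] 0) (𝓝 κ)) :
    Tendsto (fun x => ‖x‖ * ‖fderiv ℝ K x‖) (𝓝[≠] 0) (𝓝 0) := by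
  have hB := hK.pos_B
  rw [Metric.tendsto_nhds]
  intro ε hε
  obtain ⟨δ, hδ0, hδ, hδε⟩ : ∃ δ : ℝ, 0 < δ ∧ δ ≤ 1 / 2 ∧ 4 * B * δ ≤ ε / 4 := by
    refine ⟨min (1 / 2) (ε / (16 * B)), by positivity, min_le_left _ _, ?_⟩
    calc 4 * B * min (1 / 2) (ε / (16 * B)) ≤ 4 * B * (ε / (16 * B)) := by
          gcongr; exact min_le_right _ _
      _ = ε / 4 := by field_simp; norm_num
  have h1 := Metric.tendsto_nhds.1 h (ε * δ / 8) (by positivity)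
  rw [eventually_nhdsWithin_iff, Metric.eventually_nhds_iff] at h1
  obtain ⟨ρ, hρ, h1⟩ := h1
  have h2 : ∀ᶠ x : ES n in 𝓝[≠] 0, x ∈ ball (0 : ES n) (ρ / 2) :=
    mem_nhdsWithin_of_mem_nhds (ball_mem_nhds _ (by positivity))
  filter_upwards [h2, self_mem_nhdsWithin] with x hxρ hx
  have hx' : 0 < ‖x‖ := norm_pos_iff.2 hx
  rw [mem_ball_zero_iff] at hxρ
  have key : ‖fderiv ℝ K x‖ ≤ (ε / 2) / ‖x‖ := by
    refine ContinuousLinearMap.opNorm_le_of_unit_norm (by positivity) fun v hv => ?_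
    set u := (δ * ‖x‖) • v with hu
    have hun : ‖u‖ = δ * ‖x‖ := by
      rw [hu, norm_smul, hv, mul_one, Real.norm_of_nonneg (by positivity)]
    have hu2 : ‖u‖ ≤ ‖x‖ / 2 := by rw [hun]; nlinarith
    have h3 := hK.norm_taylor_le hx hu2
    have hxu : x + u ≠ 0 := fun h0 => by
      have : ‖x‖ = ‖u‖ := by rw [eq_neg_of_add_eq_zero_left h0, norm_neg]
      linarith
    have h4 := h1 (y := x) (by rw [dist_zero_right]; linarith) hx
    have h5 := h1 (y := x + u) (by rw [dist_zero_right]; linarith [norm_add_le x u]) hxu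
    rw [Real.dist_eq] at h4 h5
    have h6 : fderiv ℝ K x u = δ * ‖x‖ * fderiv ℝ K x v := by rw [hu, map_smul, smul_eq_mul]
    have h7 : 4 * B / ‖x‖ ^ 2 * ‖u‖ * ‖u‖ = 4 * B * δ * δ := by rw [hun]; field_simp
    rw [h7] at h3
    have h8 : |fderiv ℝ K x u| ≤ δ * (ε / 2) := by
      have : 4 * B * δ * δ ≤ ε / 4 * δ := by gcongr
      rw [abs_lt] at h4 h5
      rw [abs_le] at h3 ⊢
      constructor <;> linarith [h3.1, h3.2, h4.1, h4.2, h5.1, h5.2]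
    rw [h6, abs_mul, abs_of_pos (by positivity), mul_assoc] at h8
    rw [Real.norm_eq_abs, le_div_iff₀ hx', mul_comm]
    exact le_of_mul_le_mul_left h8 hδ0
  rw [dist_zero_right, norm_mul, norm_norm, norm_norm]
  rw [le_div_iff₀ hx'] at key
  linarith

end KernelLimit

section FlatMeasure

variable {n d : ℕ}

theorem exists_linearIsometry_orthogonal (hdn : d < n) :
    ∃ (ι : ES d →ₗᵢ[ℝ] ES n) (e : ES n), ‖e‖ = 1 ∧ ∀ ζ, inner ℝ e (ι ζ) = 0 := by
  set b := EuclideanSpace.basisFun (Fin d) ℝ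
  set b' := EuclideanSpace.basisFun (Fin n) ℝ
  set v : Fin d → ES n := fun j => b' (Fin.castLE hdn.le j) with hv
  set f : ES d →ₗ[ℝ] ES n := b.toBasis.constr ℝ v with hf
  have hfb : ∀ j, f (b j) = v j := fun j => by
    rw [← b.coe_toBasis]
    exact b.toBasis.constr_basis ℝ v j
  have horth : Orthonormal ℝ (f ∘ b.toBasis) := by
    have : f ∘ b.toBasis = b' ∘ Fin.castLE hdn.le := by
      ext1 j
      rw [Function.comp_apply, b.coe_toBasis, hfb]; rfl
    rw [this]
    exact b'.orthonormal.comp _ (Fin.castLE_injective _)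
  have hb : Orthonormal ℝ b.toBasis := by rw [b.coe_toBasis]; exact b.orthonormal
  refine ⟨f.isometryOfOrthonormal hb horth, b' ⟨d, hdn⟩, b'.norm_eq_one _, fun ζ => ?_⟩
  rw [LinearMap.coe_isometryOfOrthonormal, ← b.sum_repr ζ, map_sum, inner_sum]
  refine Finset.sum_eq_zero fun j _ => ?_
  rw [map_smul, hfb, inner_smul_right, hv]
  simp only
  rw [b'.inner_eq_zero (by intro h; have := congrArg Fin.val h; simp at this; omega), mul_zero]

/-- Lebesgue measure on the image of a linear isometry. -/
noncomputable def flatMeasure (ι : ES d →ₗᵢ[ℝ] ES n) : Measure (ES n) := (volume : Measure (ES d)).map ι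

variable (ι : ES d →ₗᵢ[ℝ] ES n)

theorem measurableEmbedding_isometry : MeasurableEmbedding ι :=
  ι.isometry.isClosedEmbedding.measurableEmbedding

theorem flatMeasure_ball (ζ : ES d) {R : ℝ} (hR : 0 < R) :
    flatMeasure ι (ball (ι ζ) R) = ENNReal.ofReal (R ^ (d : ℝ)) * volume (ball (0 : ES d) 1) := by
  rw [flatMeasure, (measurableEmbedding_isometry ι).map_apply, ι.isometry.preimage_ball,
    Measure.addHaar_ball_of_pos _ _ hR]
  simp

theorem msupp_flatMeasure : msupp (flatMeasure ι) = range ι := by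
  refine Subset.antisymm (fun x hx => ?_) ?_
  · by_contra hcon
    have hcl : IsClosed (range ι) := ι.isometry.isClosedEmbedding.isClosed_range
    obtain ⟨r, hr, hsub⟩ := Metric.isOpen_iff.1 hcl.isOpen_compl x hcon
    have h1 := hx r hr
    rw [flatMeasure, (measurableEmbedding_isometry ι).map_apply] at h1
    have : ι ⁻¹' ball x r = ∅ := eq_empty_of_forall_notMem fun ζ hζ => hsub hζ ⟨ζ, rfl⟩
    simp [this] at h1
  · rintro _ ⟨ζ, rfl⟩ r hr
    rw [flatMeasure_ball ι ζ hr]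
    exact ENNReal.mul_pos (ENNReal.ofReal_pos.2 (Real.rpow_pos_of_pos hr _)).ne'
      (measure_ball_pos _ _ one_pos).ne'

theorem exists_isAhlfors_flatMeasure : ∃ C, IsAhlfors (d : ℝ) (flatMeasure ι) C := by
  set V := (volume (ball (0 : ES d) 1)).toReal with hV
  have hfin : volume (ball (0 : ES d) 1) ≠ ⊤ := measure_ball_lt_top.ne
  have hV0 : 0 < V := ENNReal.toReal_pos (measure_ball_pos _ _ one_pos).ne' hfin
  have hVe : volume (ball (0 : ES d) 1) = ENNReal.ofReal V := (ENNReal.ofReal_toReal hfin).symm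
  refine ⟨max 1 (max V V⁻¹), le_max_left _ _, ?_⟩
  rw [msupp_flatMeasure]
  rintro _ ⟨ζ, rfl⟩ R hR
  have hRd : 0 < R ^ (d : ℝ) := Real.rpow_pos_of_pos hR _
  rw [flatMeasure_ball ι ζ hR, hVe, ← ENNReal.ofReal_mul hRd.le, mul_comm _ V]
  constructor
  · refine ENNReal.ofReal_le_ofReal ?_
    gcongr
    exact inv_le_of_inv_le₀ hV0 ((le_max_right _ _).trans (le_max_right _ _))
  · refine ENNReal.ofReal_le_ofReal ?_
    gcongr
    exact (le_max_left _ _).trans (le_max_right _ _)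

theorem rectSet_flatMeasure : RectSet n d (msupp (flatMeasure ι)) := by
  refine ⟨fun _ => ι, fun _ => ⟨1, ι.lipschitz⟩, ?_⟩
  rw [msupp_flatMeasure, iUnion_const, Set.sdiff_self, measure_empty]

theorem integral_flatMeasure (g : ES n → ℝ) : ∫ y, g y ∂(flatMeasure ι) = ∫ ζ, g (ι ζ) :=
  (measurableEmbedding_isometry ι).integral_map g

/-- The profile of `R_{K,μ,α}` on scale `t` when `μ` is flat and `K` is radial with profile `Kt`. -/
noncomputable def radialProfile (d : ℕ) (α : ℝ) (Kt : ℝ → ℝ) (t : ℝ) : ℝ :=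
  ∫ ζ : ES d, Kt (t * √(1 + ‖ζ‖ ^ 2)) * (1 + ‖ζ‖ ^ 2) ^ (-(d + α) / 2)

theorem RK_flatMeasure {α : ℝ} {K : ES n → ℝ} {Kt : ℝ → ℝ}
    (hrad : ∀ x : ES n, x ≠ 0 → K x = Kt ‖x‖) {u : ES n} (hu : ∀ ζ, inner ℝ u (ι ζ) = 0)
    (hu0 : u ≠ 0) (a : ES d) :
    RK d α K (flatMeasure ι) (ι a + u) = ‖u‖ ^ (-α) * radialProfile d α Kt ‖u‖ := by
  have hu' : 0 < ‖u‖ := norm_pos_iff.2 hu0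
  set A := ι.toContinuousLinearMap with hA
  have huA : ∀ ζ, inner ℝ u (A ζ) = 0 := hu
  have hn : ∀ ζ, ‖ι a + u - ι ζ‖ = ‖u‖ * √(1 + ‖‖u‖⁻¹ • (ζ - a)‖ ^ 2) := fun ζ => by
    have h1 : ‖ι a + u - ι ζ‖ ^ 2 = ‖u‖ ^ 2 + ‖ι (ζ - a)‖ ^ 2 := norm_sub_map_sq huA ζ
    rw [ι.norm_map] at h1
    rw [← sq_eq_sq₀ (norm_nonneg _) (by positivity), h1, mul_pow, Real.sq_sqrt (by positivity),
      norm_smul, norm_inv, norm_norm]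
    field_simp
  have hk : ∀ ζ, K (ι a + u - ι ζ) / ‖ι a + u - ι ζ‖ ^ ((d : ℝ) + α) =
      ‖u‖ ^ (-((d : ℝ) + α)) * (fun ξ : ES d => Kt (‖u‖ * √(1 + ‖ξ‖ ^ 2)) *
        (1 + ‖ξ‖ ^ 2) ^ (-((d : ℝ) + α) / 2)) (‖u‖⁻¹ • (ζ - a)) := fun ζ => by
    have hz : ι a + u - ι ζ ≠ 0 := by
      rw [← norm_pos_iff, hn]; positivity
    rw [hrad _ hz, div_eq_mul_inv, ← Real.rpow_neg (norm_nonneg _)]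
    have h2 : ‖ι a + u - ι ζ‖ ^ (-((d : ℝ) + α)) = _ := norm_sub_map_rpow huA hu0 (d + α) ζ
    have h3 : ‖A (‖u‖⁻¹ • (ζ - a))‖ = ‖‖u‖⁻¹ • (ζ - a)‖ := ι.norm_map _
    rw [h3] at h2
    rw [h2, hn]
    ring
  rw [RK, integral_flatMeasure ι fun y => K (ι a + u - y) / ‖ι a + u - y‖ ^ ((d : ℝ) + α)]
  simp_rw [hk]
  rw [integral_const_mul, integral_comp_inv_smul_sub a hu' fun ξ : ES d =>
    Kt (‖u‖ * √(1 + ‖ξ‖ ^ 2)) * (1 + ‖ξ‖ ^ 2) ^ (-((d : ℝ) + α) / 2), smul_eq_mul, ← mul_assoc,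
    ← Real.rpow_add hu', radialProfile]
  congr 2
  ring

end FlatMeasure

section RadialKernel

variable {n d : ℕ} {α B c : ℝ} {K : ES n → ℝ} {Kt : ℝ → ℝ}

theorem radial_eq (hrad : ∀ x : ES n, x ≠ 0 → K x = Kt ‖x‖) {e : ES n} (he : ‖e‖ = 1) {t : ℝ}
    (ht : 0 < t) : K (t • e) = Kt t := by
  have he0 : e ≠ 0 := norm_pos_iff.1 (by rw [he]; exact one_pos)
  rw [hrad _ (smul_ne_zero ht.ne' he0), norm_smul, he, mul_one, Real.norm_of_nonneg ht.le]

theorem KernelBounds.radial_mem_Icc (hK : KernelBounds K B c)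
    (hrad : ∀ x : ES n, x ≠ 0 → K x = Kt ‖x‖) {e : ES n} (he : ‖e‖ = 1) {t : ℝ} (ht : 0 < t) :
    Kt t ∈ Icc c B := by
  have he0 : e ≠ 0 := norm_pos_iff.1 (by rw [he]; exact one_pos)
  rw [← radial_eq hrad he ht]
  exact ⟨hK.lower _ (smul_ne_zero ht.ne' he0),
    (le_abs_self _).trans (hK.upper _ (smul_ne_zero ht.ne' he0))⟩

theorem KernelBounds.abs_radial_sub_le (hK : KernelBounds K B c)
    (hrad : ∀ x : ES n, x ≠ 0 → K x = Kt ‖x‖) {e : ES n} (he : ‖e‖ = 1) {a b : ℝ} (ha : 0 < a)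
    (hab : a ≤ b) : |Kt b - Kt a| ≤ B / a * (b - a) := by
  have he0 : e ≠ 0 := norm_pos_iff.1 (by rw [he]; exact one_pos)
  have hB := hK.pos_B
  have hder : ∀ t ∈ Icc a b, HasDerivWithinAt (fun t : ℝ => K (t • e)) (fderiv ℝ K (t • e) e)
      (Icc a b) t := fun t ht => by
    have h1 : HasDerivAt (fun t : ℝ => t • e) e t := by
      simpa using (hasDerivAt_id t).smul_const e
    exact ((hK.diff _ (smul_ne_zero (ha.trans_le ht.1).ne' he0)).hasFDerivAt.comp_hasDerivAt t
      h1).hasDerivWithinAt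
  have := (convex_Icc a b).norm_image_sub_le_of_norm_hasDerivWithin_le (C := B / a) hder
    (fun t ht => ?_) (left_mem_Icc.2 hab) (right_mem_Icc.2 hab)
  · simp only [radial_eq hrad he ha, radial_eq hrad he (ha.trans_le hab)] at this
    rwa [Real.norm_eq_abs, Real.norm_eq_abs, abs_of_nonneg (sub_nonneg.2 hab)] at this
  · have ht0 : 0 < t := ha.trans_le ht.1
    have h2 := hK.fderiv_le _ (smul_ne_zero ht0.ne' he0)
    rw [norm_smul, he, mul_one, Real.norm_of_nonneg ht0.le] at h2
    refine ((fderiv ℝ K (t • e)).le_opNorm e).trans ?_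
    rw [he, mul_one, le_div_iff₀ ha]
    refine le_trans ?_ h2
    gcongr
    exact ht.1

theorem KernelBounds.continuousOn_radial (hK : KernelBounds K B c)
    (hrad : ∀ x : ES n, x ≠ 0 → K x = Kt ‖x‖) {e : ES n} (he : ‖e‖ = 1) :
    ContinuousOn Kt (Ioi 0) := by
  have he0 : e ≠ 0 := norm_pos_iff.1 (by rw [he]; exact one_pos)
  have h : ContinuousOn (fun t : ℝ => K (t • e)) (Ioi 0) :=
    hK.continuousOn.comp (by fun_prop) fun t ht => smul_ne_zero (ne_of_gt ht) he0
  exact h.congr fun t ht => (radial_eq hrad he ht).symm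

end RadialKernel

section Profile

variable {n d : ℕ} {α B c : ℝ} {K : ES n → ℝ} {Kt : ℝ → ℝ}

theorem integrable_one_add_norm_sq_rpow {p : ℝ} (hp : (d : ℝ) < p) :
    Integrable fun ζ : ES d => (1 + ‖ζ‖ ^ 2) ^ (-p / 2) := by
  have := integrable_one_add_norm_map_sq_rpow (A := ContinuousLinearMap.id ℝ (ES d)) one_pos
    (fun ζ => by simp) hp
  simpa using this

theorem integral_one_add_norm_sq_rpow_pos {p : ℝ} (hp : (d : ℝ) < p) :
    0 < ∫ ζ : ES d, (1 + ‖ζ‖ ^ 2) ^ (-p / 2) := by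
  have := integral_one_add_norm_map_sq_rpow_pos (A := ContinuousLinearMap.id ℝ (ES d)) one_pos
    (fun ζ => by simp) hp
  simpa using this

theorem continuous_profile_integrand (hKc : ContinuousOn Kt (Ioi 0)) (p : ℝ) {t : ℝ} (ht : 0 < t) :
    Continuous fun ζ : ES d => Kt (t * √(1 + ‖ζ‖ ^ 2)) * (1 + ‖ζ‖ ^ 2) ^ (-p / 2) := by
  have h1 : Continuous fun ζ : ES d => (1 + ‖ζ‖ ^ 2) ^ (-p / 2) := by
    have := continuous_one_add_norm_map_sq_rpow (ContinuousLinearMap.id ℝ (ES d)) p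
    simpa using this
  refine Continuous.mul ?_ h1
  refine hKc.comp_continuous (by fun_prop) fun ζ => ?_
  rw [mem_Ioi]; positivity

theorem integrable_profile_integrand (hKc : ContinuousOn Kt (Ioi 0))
    (hKB : ∀ t, 0 < t → Kt t ∈ Icc c B) (hc : 0 < c) {p : ℝ} (hp : (d : ℝ) < p) {t : ℝ}
    (ht : 0 < t) :
    Integrable fun ζ : ES d => Kt (t * √(1 + ‖ζ‖ ^ 2)) * (1 + ‖ζ‖ ^ 2) ^ (-p / 2) := by
  refine ((integrable_one_add_norm_sq_rpow hp).const_mul B).mono'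
    (continuous_profile_integrand hKc p ht).aestronglyMeasurable (Eventually.of_forall fun ζ => ?_)
  have h := hKB (t * √(1 + ‖ζ‖ ^ 2)) (by positivity)
  rw [norm_mul, Real.norm_of_nonneg (hc.le.trans h.1), Real.norm_of_nonneg (by positivity)]
  gcongr
  exact h.2

theorem radialProfile_mem_Icc (hα : 0 < α) (hKc : ContinuousOn Kt (Ioi 0))
    (hKB : ∀ t, 0 < t → Kt t ∈ Icc c B) (hc : 0 < c) {t : ℝ} (ht : 0 < t) :
    radialProfile d α Kt t ∈ Icc (c * ∫ ζ : ES d, (1 + ‖ζ‖ ^ 2) ^ (-(d + α) / 2))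
      (B * ∫ ζ : ES d, (1 + ‖ζ‖ ^ 2) ^ (-(d + α) / 2)) := by
  have hp : (d : ℝ) < d + α := by linarith
  have hi := integrable_one_add_norm_sq_rpow hp
  have hi2 := integrable_profile_integrand hKc hKB hc hp ht
  rw [radialProfile, ← integral_const_mul, ← integral_const_mul]
  constructor
  · refine integral_mono (hi.const_mul c) hi2 fun ζ => ?_
    simp only
    gcongr
    exact (hKB _ (by positivity)).1
  · refine integral_mono hi2 (hi.const_mul B) fun ζ => ?_
    simp only
    gcongr
    exact (hKB _ (by positivity)).2

theorem hasDerivAt_profile_and_norm_gradient (hα : 0 < α) (hK : KernelBounds K B c)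
    (hrad : ∀ x : ES n, x ≠ 0 → K x = Kt ‖x‖) {ι : ES d →ₗᵢ[ℝ] ES n} {e : ES n} (he : ‖e‖ = 1)
    (heι : ∀ ζ, inner ℝ e (ι ζ) = 0) (a : ES d) {t : ℝ} (ht : 0 < t) :
    ∃ D' : ℝ, HasDerivAt (fun t => t * radialProfile d α Kt t ^ (-α⁻¹)) D' t ∧
      ‖gradient (DK d α K (flatMeasure ι)) (ι a + t • e)‖ = |D'| := by
  have hd : (0 : ℝ) ≤ d := Nat.cast_nonneg d
  have he0 : e ≠ 0 := norm_pos_iff.1 (by rw [he]; exact one_pos)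
  have hKB : ∀ t, 0 < t → Kt t ∈ Icc c B := fun t ht => hK.radial_mem_Icc hrad he ht
  have hKc := hK.continuousOn_radial hrad he
  have hpos : ∀ t, 0 < t → 0 < radialProfile d α Kt t := fun t ht =>
    (mul_pos hK.pos_c (integral_one_add_norm_sq_rpow_pos (by linarith : (d : ℝ) < d + α))).trans_le
      (radialProfile_mem_Icc hα hKc hKB hK.pos_c ht).1
  obtain ⟨C, hC⟩ := exists_isAhlfors_flatMeasure ι
  set D := DK d α K (flatMeasure ι) with hD
  have hDeq : ∀ (b : ES d) (u : ES n), (∀ ζ, inner ℝ u (ι ζ) = 0) → u ≠ 0 →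
      D (ι b + u) = ‖u‖ * radialProfile d α Kt ‖u‖ ^ (-α⁻¹) := fun b u hu hu0 => by
    have hu' : 0 < ‖u‖ := norm_pos_iff.2 hu0
    rw [hD, DK, RK_flatMeasure ι hrad hu hu0,
      Real.mul_rpow (by positivity) (hpos _ hu').le, ← Real.rpow_mul hu'.le]
    congr 1
    have : -α * -α⁻¹ = 1 := by field_simp
    rw [this, Real.rpow_one]
  set x := ι a + t • e with hx
  have hxE : x ∉ msupp (flatMeasure ι) := by
    rw [msupp_flatMeasure]
    rintro ⟨b, hb⟩
    have h1 : inner ℝ e (ι b) = inner ℝ e x := by rw [hb]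
    rw [heι, hx, inner_add_right, heι, inner_smul_right, real_inner_self_eq_norm_sq, he] at h1
    norm_num at h1
    exact ht.ne h1
  have hQ : ι a ∈ msupp (flatMeasure ι) := by rw [msupp_flatMeasure]; exact ⟨a, rfl⟩
  obtain ⟨D', hD'⟩ : ∃ D', HasFDerivAt D D' x := ⟨_, hasFDerivAt_DK hC hd hα hK hQ hxE⟩
  refine ⟨D' e, ?_, ?_⟩
  · have h1 : HasDerivAt (fun τ : ℝ => ι a + τ • e) e t := by
      simpa using ((hasDerivAt_id t).smul_const e).const_add (ι a)
    refine (hD'.comp_hasDerivAt t h1).congr_of_eventuallyEq ?_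
    filter_upwards [lt_mem_nhds ht] with τ hτ
    have h2 : ‖τ • e‖ = τ := by rw [norm_smul, he, mul_one, Real.norm_of_nonneg hτ.le]
    simp only [Function.comp_apply]
    rw [hDeq a (τ • e) (fun ζ => by rw [inner_smul_left, heι, mul_zero])
      (smul_ne_zero hτ.ne' he0), h2]
  · have horth : ∀ v : ES n, inner ℝ e v = 0 → D' v = 0 := fun v hv => by
      obtain ⟨b, v', rfl, hv'⟩ := exists_eq_add_orthogonal ι.toContinuousLinearMap v
      have hv'' : ∀ ζ, inner ℝ v' (ι ζ) = 0 := hv'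
      have hev : inner ℝ e v' = 0 := by
        rw [inner_add_right] at hv
        have : inner ℝ e (ι b) = 0 := heι b
        simpa [this] using hv
      set f : ℝ → ℝ := fun τ => D (x + τ • (ι b + v')) with hf
      have hfeq : ∀ τ, f (-τ) = f τ := fun τ => by
        have h1 : ∀ τ : ℝ, f τ = ‖t • e + τ • v'‖ *
            radialProfile d α Kt ‖t • e + τ • v'‖ ^ (-α⁻¹) := fun τ => by
          rw [← hDeq (a + τ • b)]
          · simp only [hf, hx, map_add, map_smul]
            congr 1
            rw [smul_add]; abel
          · intro ζ
            rw [inner_add_left, inner_smul_left, inner_smul_left, heι, hv'']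
            simp
          · intro h0
            have : inner ℝ e (t • e + τ • v') = 0 := by rw [h0, inner_zero_right]
            rw [inner_add_right, inner_smul_right, inner_smul_right, hev,
              real_inner_self_eq_norm_sq, he] at this
            norm_num at this
            exact ht.ne' this
        have h2 : ‖t • e + (-τ) • v'‖ = ‖t • e + τ • v'‖ := by
          rw [neg_smul, ← sub_eq_add_neg, ← sq_eq_sq₀ (norm_nonneg _) (norm_nonneg _),
            norm_sub_sq_real, norm_add_sq_real, inner_smul_left, inner_smul_right, hev]
          simp
        rw [h1, h1, h2]
      have hfd : HasDerivAt f (D' (ι b + v')) 0 := by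
        have h1 : HasDerivAt (fun τ : ℝ => x + τ • (ι b + v')) (ι b + v') 0 := by
          simpa using ((hasDerivAt_id (0 : ℝ)).smul_const (ι b + v')).const_add x
        have h2 : HasFDerivAt D D' (x + (0 : ℝ) • (ι b + v')) := by simpa using hD'
        exact h2.comp_hasDerivAt 0 h1
      have hfd2 : HasDerivAt (fun τ => f (-τ)) (-(D' (ι b + v'))) 0 := by
        have h3 : HasDerivAt f (D' (ι b + v')) (-0) := by rwa [neg_zero]
        have h4 := h3.comp (0 : ℝ) (hasDerivAt_neg (0 : ℝ))
        rw [mul_neg_one] at h4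
        exact h4
      rw [show (fun τ => f (-τ)) = f from funext hfeq] at hfd2
      exact self_eq_neg.1 (hfd.unique hfd2)
    rw [norm_gradient_eq, hD'.fderiv]
    refine le_antisymm (ContinuousLinearMap.opNorm_le_bound _ (abs_nonneg _) fun v => ?_) ?_
    · have h1 : D' v = inner ℝ e v * D' e := by
        have h2 := horth (v - inner ℝ e v • e) (by
          rw [inner_sub_right, inner_smul_right, real_inner_self_eq_norm_sq, he]; ring)
        rw [map_sub, map_smul, smul_eq_mul, sub_eq_zero] at h2
        exact h2
      rw [h1, norm_mul, mul_comm, Real.norm_eq_abs]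
      gcongr
      have h3 := norm_inner_le_norm (𝕜 := ℝ) e v
      rwa [he, one_mul] at h3
    · have h1 := D'.le_opNorm e
      rwa [he, mul_one] at h1

end Profile

theorem IsAhlfors.exists_mem_of_ae {n : ℕ} {d : ℕ} {μ : Measure (ES n)} {C : ℝ}
    (h : IsAhlfors (d : ℝ) μ C) (hne : (msupp μ).Nonempty) {p : ES n → Prop}
    (hp : ∀ᵐ Q ∂((μH[(d : ℝ)]).restrict (msupp μ)), p Q) : ∃ Q ∈ msupp μ, p Q := by
  by_contra! hcon
  rw [ae_restrict_iff' (isClosed_msupp μ).measurableSet] at hp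
  have h1 : μH[(d : ℝ)] (msupp μ) = 0 :=
    measure_mono_null (fun Q hQ => by simpa [hQ] using hcon Q hQ) (ae_iff.1 hp)
  have h2 := h.measure_le_hausdorff (Nat.cast_nonneg d) (msupp μ)
  rw [h1, mul_zero, nonpos_iff_eq_zero] at h2
  obtain ⟨Q, hQ⟩ := hne
  have h3 : μ univ = 0 := by
    rw [← union_compl_self (msupp μ)]
    exact measure_union_null h2 (measure_compl_msupp μ)
  exact (hQ 1 one_pos).ne' (measure_mono_null (subset_univ _) h3)

section Profile

variable {n d : ℕ} {α B c : ℝ} {K : ES n → ℝ} {Kt : ℝ → ℝ}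

theorem add_smul_mem_NTcone {ι : ES d →ₗᵢ[ℝ] ES n} {e : ES n} (he : ‖e‖ = 1)
    (heι : ∀ ζ, inner ℝ e (ι ζ) = 0) (a : ES d) {t R η : ℝ} (ht : 0 < t) (htR : t < R)
    (hη : η ≤ 1) : ι a + t • e ∈ NTcone (range ι) (ι a) R η := by
  have hd : dist (ι a + t • e) (ι a) = t := by
    rw [dist_eq_norm, add_sub_cancel_left, norm_smul, he, mul_one, Real.norm_of_nonneg ht.le]
  have hle : ∀ ζ, t ≤ dist (ι a + t • e) (ι ζ) := fun ζ => by
    have h1 : inner ℝ e (ι a + t • e - ι ζ) = t := by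
      rw [inner_sub_right, inner_add_right, heι, heι, inner_smul_right,
        real_inner_self_eq_norm_sq, he]
      ring
    have h2 := real_inner_le_norm e (ι a + t • e - ι ζ)
    rwa [h1, he, one_mul, ← dist_eq_norm] at h2
  refine ⟨?_, by rwa [hd], ?_⟩
  · rintro ⟨ζ, hζ⟩
    have := hle ζ
    rw [hζ, dist_self] at this
    exact this.not_gt ht
  · rw [hd]
    refine (mul_le_of_le_one_left ht.le hη).trans ((le_infDist (range_nonempty _)).2 ?_)
    rintro _ ⟨ζ, rfl⟩
    exact hle ζ

theorem exists_tendsto_radialProfile (hα : 0 < α) (hK : KernelBounds K B c)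
    (hrad : ∀ x : ES n, x ≠ 0 → K x = Kt ‖x‖) {ι : ES d →ₗᵢ[ℝ] ES n} {e : ES n} (he : ‖e‖ = 1)
    (heι : ∀ ζ, inner ℝ e (ι ζ) = 0) {a : ES d} {η L : ℝ} (hη : η ≤ 1)
    (hL : HasNTLimit (range ι) (fun x => ‖gradient (DK d α K (flatMeasure ι)) x‖) (ι a) η L) :
    ∃ ℓ, Tendsto (radialProfile d α Kt) (𝓝[>] 0) (𝓝 ℓ) := by
  have hKB : ∀ t, 0 < t → Kt t ∈ Icc c B := fun t ht => hK.radial_mem_Icc hrad he ht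
  have hC1 := integral_one_add_norm_sq_rpow_pos (by linarith : (d : ℝ) < d + α)
  have hΦ := fun t (ht : 0 < t) =>
    radialProfile_mem_Icc (d := d) hα (hK.continuousOn_radial hrad he) hKB hK.pos_c ht
  set C1 := ∫ ζ : ES d, (1 + ‖ζ‖ ^ 2) ^ (-(d + α) / 2)
  have hc1 : 0 < c * C1 := mul_pos hK.pos_c hC1
  have hB1 : 0 < B * C1 := mul_pos hK.pos_B hC1
  have hpos : ∀ t, 0 < t → 0 < radialProfile d α Kt t := fun t ht => hc1.trans_le (hΦ t ht).1
  have hneg : -α⁻¹ ≤ 0 := by simpa using hα.le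
  set Ψ : ℝ → ℝ := fun t => radialProfile d α Kt t ^ (-α⁻¹) with hΨ
  choose! D' hD' hgrad using fun t (ht : 0 < t) =>
    hasDerivAt_profile_and_norm_gradient hα hK hrad he heι a ht
  have hΨ_le : ∀ t, 0 < t → Ψ t ≤ (c * C1) ^ (-α⁻¹) := fun t ht =>
    Real.rpow_le_rpow_of_nonpos hc1 (hΦ t ht).1 hneg
  have hΨ_ge : ∀ t, 0 < t → (B * C1) ^ (-α⁻¹) ≤ Ψ t := fun t ht =>
    Real.rpow_le_rpow_of_nonpos (hpos t ht) (hΦ t ht).2 hneg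
  have hB2 : 0 < (B * C1) ^ (-α⁻¹) := Real.rpow_pos_of_pos hB1 _
  have hΨ_pos : ∀ t, 0 < t → 0 < Ψ t := fun t ht => hB2.trans_le (hΨ_ge t ht)
  have hmvt : ∀ t, 0 < t → ∃ ξ ∈ Ioo 0 t, |D' ξ| = Ψ t := fun t ht => by
    have hcont : ContinuousOn (fun t => t * Ψ t) (Icc 0 t) := by
      intro τ hτ
      rcases hτ.1.eq_or_lt with rfl | h0
      · rw [ContinuousWithinAt, zero_mul]
        have hlim : Tendsto (fun s : ℝ => s * (c * C1) ^ (-α⁻¹)) (𝓝[Icc 0 t] 0) (𝓝 0) := by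
          have : Tendsto (fun s : ℝ => s * (c * C1) ^ (-α⁻¹)) (𝓝 0) (𝓝 (0 * (c * C1) ^ (-α⁻¹))) :=
            tendsto_id.mul_const _
          rw [zero_mul] at this
          exact this.mono_left nhdsWithin_le_nhds
        refine squeeze_zero' ?_ ?_ hlim
        all_goals
          filter_upwards [self_mem_nhdsWithin] with s hs
          rcases hs.1.eq_or_lt with rfl | hs0
          · simp
        · exact (mul_pos hs0 (hΨ_pos s hs0)).le
        · exact mul_le_mul_of_nonneg_left (hΨ_le s hs0) hs0.le
      · exact (hD' τ h0).continuousAt.continuousWithinAt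
    obtain ⟨ξ, hξ, h⟩ := exists_hasDerivAt_eq_slope (fun t => t * Ψ t) D' ht hcont
      fun τ hτ => hD' τ hτ.1
    refine ⟨ξ, hξ, ?_⟩
    rw [h, zero_mul, sub_zero, sub_zero, mul_div_cancel_left₀ _ ht.ne', abs_of_pos (hΨ_pos t ht)]
  have hlim : Tendsto Ψ (𝓝[>] 0) (𝓝 L) := by
    rw [Metric.tendsto_nhds]
    intro ε hε
    obtain ⟨R, hR, h⟩ := hL ε hε
    filter_upwards [Ioo_mem_nhdsGT hR] with t ht
    obtain ⟨ξ, hξ, h1⟩ := hmvt t ht.1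
    rw [← h1, ← hgrad ξ hξ.1]
    exact h _ (add_smul_mem_NTcone he heι a hξ.1 (hξ.2.trans ht.2) hη)
  have hLpos : 0 < L := hB2.trans_le <| ge_of_tendsto hlim <| by
    filter_upwards [self_mem_nhdsWithin] with t ht using hΨ_ge t ht
  refine ⟨L ^ (-α), (hlim.rpow_const (Or.inl hLpos.ne')).congr' ?_⟩
  filter_upwards [self_mem_nhdsWithin] with t ht
  rw [hΨ, ← Real.rpow_mul (hpos t ht).le]
  have : -α⁻¹ * -α = 1 := by field_simp
  rw [this, Real.rpow_one]

end Profile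

section NormSqTransform

/-- The integral of `ζ ↦ g (v + ‖ζ‖ ^ 2)` over `d`-dimensional Euclidean space. -/
noncomputable def normSqTransform (d : ℕ) (g : ℝ → ℝ) (v : ℝ) : ℝ := ∫ ζ : ES d, g (v + ‖ζ‖ ^ 2)

/-- Continuity on `(0, ∞)` together with a power bound `|g u| ≤ C u ^ (-p)`. -/
structure PowerDecay (p : ℝ) (g : ℝ → ℝ) : Prop where
  continuousOn : ContinuousOn g (Ioi 0)
  bound : ∃ C, 0 ≤ C ∧ ∀ u, 0 < u → |g u| ≤ C * u ^ (-p)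

variable {d : ℕ} {p : ℝ} {g : ℝ → ℝ}

theorem integrable_add_norm_sq_rpow (hp : (d : ℝ) < 2 * p) {v : ℝ} (hv : 0 < v) :
    Integrable fun ζ : ES d => (v + ‖ζ‖ ^ 2) ^ (-p) := by
  have hp0 : 0 < p := by have : (0 : ℝ) ≤ d := Nat.cast_nonneg d; linarith
  have hm : 0 < min v 1 := lt_min hv one_pos
  have h1 := (integrable_one_add_norm_sq_rpow hp).const_mul ((min v 1) ^ (-p))
  refine h1.mono' (Continuous.aestronglyMeasurable ?_) (Eventually.of_forall fun ζ => ?_)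
  · exact Continuous.rpow_const (by fun_prop) fun ζ => Or.inl (by positivity)
  · rw [Real.norm_of_nonneg (by positivity), show -(2 * p) / 2 = -p by ring,
      ← Real.mul_rpow hm.le (by positivity)]
    refine Real.rpow_le_rpow_of_nonpos (by positivity) ?_ (by linarith)
    have h2 : min v 1 ≤ v := min_le_left _ _
    have h3 : min v 1 * ‖ζ‖ ^ 2 ≤ 1 * ‖ζ‖ ^ 2 := by gcongr; exact min_le_right _ _
    linarith

theorem integral_add_norm_sq (d : ℕ) (f : ℝ → ℝ) {v : ℝ} (hv : 0 < v) :
    ∫ ζ : ES d, f (v + ‖ζ‖ ^ 2) = v ^ ((d : ℝ) / 2) * ∫ ζ : ES d, f (v * (1 + ‖ζ‖ ^ 2)) := by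
  have hs : 0 < √v := Real.sqrt_pos.2 hv
  have h1 := Measure.integral_comp_smul (volume : Measure (ES d)) (fun ζ => f (v + ‖ζ‖ ^ 2)) (√v)
  have h2 : ∀ ζ : ES d, v + ‖√v • ζ‖ ^ 2 = v * (1 + ‖ζ‖ ^ 2) := fun ζ => by
    rw [norm_smul, mul_pow, Real.norm_of_nonneg hs.le, Real.sq_sqrt hv.le]; ring
  simp only [h2, finrank_euclideanSpace, Fintype.card_fin, smul_eq_mul] at h1
  have h3 : v ^ ((d : ℝ) / 2) = √v ^ d := by
    rw [Real.sqrt_eq_rpow, ← Real.rpow_natCast, ← Real.rpow_mul hv.le]; congr 1; ring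
  rw [h1, h3, abs_of_pos (by positivity), ← mul_assoc, mul_inv_cancel₀ (by positivity), one_mul]

theorem PowerDecay.continuous_comp (hg : PowerDecay p g) {v : ℝ} (hv : 0 < v) :
    Continuous fun ζ : ES d => g (v + ‖ζ‖ ^ 2) :=
  hg.continuousOn.comp_continuous (by fun_prop) fun ζ => by rw [mem_Ioi]; positivity

theorem PowerDecay.integrable (hg : PowerDecay p g) (hp : (d : ℝ) < 2 * p) {v : ℝ} (hv : 0 < v) :
    Integrable fun ζ : ES d => g (v + ‖ζ‖ ^ 2) := by
  obtain ⟨C, -, hC⟩ := hg.bound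
  exact ((integrable_add_norm_sq_rpow hp hv).const_mul C).mono'
    (hg.continuous_comp hv).aestronglyMeasurable
    (Eventually.of_forall fun ζ => hC _ (by positivity))

theorem PowerDecay.transform (hg : PowerDecay p g) (hp : (d : ℝ) < 2 * p) :
    PowerDecay (p - d / 2) (normSqTransform d g) := by
  obtain ⟨C, hC0, hC⟩ := hg.bound
  have hp0 : 0 < p := by have : (0 : ℝ) ≤ d := Nat.cast_nonneg d; linarith
  refine ⟨fun v hv => ?_, C * ∫ ζ : ES d, (1 + ‖ζ‖ ^ 2) ^ (-p), by positivity, fun v hv => ?_⟩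
  · have hv : 0 < v := hv
    have hnhds : ∀ᶠ w in 𝓝 v, v / 2 < w := lt_mem_nhds (by linarith)
    refine (continuousAt_of_dominated (bound := fun ζ => C * (v / 2 + ‖ζ‖ ^ 2) ^ (-p))
      ?_ ?_ ((integrable_add_norm_sq_rpow hp (half_pos hv)).const_mul C) ?_).continuousWithinAt
    · filter_upwards [hnhds] with w hw
      exact (hg.continuous_comp ((half_pos hv).trans hw)).aestronglyMeasurable
    · filter_upwards [hnhds] with w hw
      have hw0 : 0 < w := (half_pos hv).trans hw
      refine Eventually.of_forall fun ζ => (hC _ (by positivity)).trans ?_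
      refine mul_le_mul_of_nonneg_left ?_ hC0
      exact Real.rpow_le_rpow_of_nonpos (by positivity) (by linarith) (by linarith)
    · refine Eventually.of_forall fun ζ => ?_
      have h1 : ContinuousAt g (v + ‖ζ‖ ^ 2) :=
        hg.continuousOn.continuousAt (Ioi_mem_nhds (by positivity))
      exact h1.comp (f := fun w => w + ‖ζ‖ ^ 2) (by fun_prop)
  · have h1 : ∫ ζ : ES d, (v + ‖ζ‖ ^ 2) ^ (-p) =
        v ^ (-(p - d / 2)) * ∫ ζ : ES d, (1 + ‖ζ‖ ^ 2) ^ (-p) := by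
      rw [integral_add_norm_sq d (fun u => u ^ (-p)) hv]
      simp_rw [fun ζ : ES d => Real.mul_rpow (z := -p) hv.le (by positivity : 0 ≤ 1 + ‖ζ‖ ^ 2)]
      rw [integral_const_mul, ← mul_assoc, ← Real.rpow_add hv]
      congr 2; ring
    calc |normSqTransform d g v| ≤ ∫ ζ : ES d, C * (v + ‖ζ‖ ^ 2) ^ (-p) :=
          norm_integral_le_of_norm_le (f := fun ζ : ES d => g (v + ‖ζ‖ ^ 2)) ((integrable_add_norm_sq_rpow hp hv).const_mul C)
            (Eventually.of_forall fun ζ => hC _ (by positivity))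
      _ = _ := by rw [integral_const_mul, h1]; ring

theorem normSqTransform_zero (g : ℝ → ℝ) (v : ℝ) : normSqTransform 0 g v = g v := by
  have h (ζ : ES 0) : ζ = 0 := Subsingleton.elim _ _
  simp [normSqTransform, h, volume_euclideanSpace_eq_dirac]

theorem exists_measurePreserving_prod (d : ℕ) : ∃ e : ES (d + 1) ≃ᵐ ℝ × ES d,
    MeasurePreserving e ∧ ∀ ζ, ‖ζ‖ ^ 2 = (e ζ).1 ^ 2 + ‖(e ζ).2‖ ^ 2 := by
  refine ⟨(MeasurableEquiv.toLp 2 (Fin (d + 1) → ℝ)).symm.trans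
    ((MeasurableEquiv.piFinSuccAbove (fun _ => ℝ) 0).trans
      (MeasurableEquiv.prodCongr (MeasurableEquiv.refl ℝ) (MeasurableEquiv.toLp 2 (Fin d → ℝ)))),
    ?_, fun ζ => ?_⟩
  · exact (((MeasurePreserving.id volume).prod (PiLp.volume_preserving_toLp (Fin d))).comp
      (volume_preserving_piFinSuccAbove (fun _ => ℝ) 0)).comp
      (EuclideanSpace.volume_preserving_symm_measurableEquiv_toLp (Fin (d + 1)))
  · rw [EuclideanSpace.real_norm_sq_eq, EuclideanSpace.real_norm_sq_eq, Fin.sum_univ_succ]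
    rfl

theorem PowerDecay.normSqTransform_succ (hg : PowerDecay p g) (hp : (d : ℝ) + 1 < 2 * p) {v : ℝ}
    (hv : 0 < v) : normSqTransform (d + 1) g v =
      ∫ x : ℝ, normSqTransform d g (v + x ^ 2) := by
  obtain ⟨e, he, hnorm⟩ := exists_measurePreserving_prod d
  set F : ℝ × ES d → ℝ := fun z => g (v + z.1 ^ 2 + ‖z.2‖ ^ 2) with hF
  have heq : (fun ζ : ES (d + 1) => g (v + ‖ζ‖ ^ 2)) = F ∘ e := by
    ext ζ
    simp only [hF, Function.comp_apply, hnorm, add_assoc]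
  have hint : Integrable F := by
    rw [← he.integrable_comp_emb e.measurableEmbedding, ← heq]
    exact hg.integrable (by push_cast; linarith) hv
  rw [normSqTransform, heq]
  exact (he.integral_comp' F).trans (integral_prod F hint)

theorem PowerDecay.eq_zero_of_normSqTransform_two (hg : PowerDecay p g) (hp : 1 < p)
    (h0 : ∀ v, 0 < v → normSqTransform 2 g v = 0) {u : ℝ} (hu : 0 < u) : g u = 0 := by
  obtain ⟨C, hC0, hC⟩ := hg.bound
  have hintv : ∀ v, 0 < v → IntegrableOn g (Ioi v) := fun v hv => by
    refine ((integrableOn_Ioi_rpow_of_lt (by linarith : -p < -1) hv).const_mul C).mono'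
      ((hg.continuousOn.mono fun x hx => hv.trans hx).aestronglyMeasurable measurableSet_Ioi) ?_
    rw [ae_restrict_iff' measurableSet_Ioi]
    exact Eventually.of_forall fun x hx => hC x (hv.trans hx)
  have hzero : ∀ v, 0 < v → ∫ x in Ioi v, g x = 0 := fun v hv => by
    have h1 := integral_fun_norm_addHaar (volume : Measure (ES 2)) (fun y => g (v + y ^ 2))
    have h2 := h0 v hv
    rw [normSqTransform, h1] at h2
    have hb : (volume : Measure (ES 2)).real (ball 0 1) ≠ 0 :=
      (ENNReal.toReal_pos (measure_ball_pos _ _ one_pos).ne' measure_ball_lt_top.ne).ne'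
    simp only [finrank_euclideanSpace, Fintype.card_fin, smul_eq_mul, nsmul_eq_mul,
      mul_eq_zero, hb, false_or] at h2
    have h3 : ∫ y in Ioi (0 : ℝ), y ^ (2 - 1) * g (v + y ^ 2) = 0 := by
      rcases h2 with h2 | h2
      · norm_num at h2
      · exact h2
    have h4 := integral_comp_rpow_Ioi_of_pos (g := fun u => g (v + u)) two_pos
    have h5 := (measurePreserving_add_left volume v).setIntegral_preimage_emb
      (measurableEmbedding_addLeft v) g (Ioi v)
    rw [preimage_const_add_Ioi, sub_self] at h5
    have h6 := integral_const_mul (μ := volume.restrict (Ioi (0 : ℝ))) (2 : ℝ)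
      fun y => y ^ (2 - 1) * g (v + y ^ 2)
    rw [h3, mul_zero] at h6
    rw [← h5, ← h4]
    refine Eq.trans ?_ h6
    refine setIntegral_congr_fun measurableSet_Ioi fun y _ => ?_
    norm_num
    ring
  have hii : ∀ a b, 0 < a → a ≤ b → ∫ x in a..b, g x = 0 := fun a b ha hab => by
    have := intervalIntegral.integral_Ioi_sub_Ioi (hintv a ha) hab (μ := volume)
    rw [hzero a ha, hzero b (ha.trans_le hab), sub_zero] at this
    exact this.symm
  have hder : HasDerivAt (fun x => ∫ y in (u / 2)..x, g y) (g u) u := by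
    have hc : ContinuousAt g u := hg.continuousOn.continuousAt (Ioi_mem_nhds hu)
    refine intervalIntegral.integral_hasDerivAt_right ?_ ?_ hc
    · exact (hg.continuousOn.mono fun x hx => by
        rw [uIcc_of_le (by linarith)] at hx
        exact (half_pos hu).trans_le hx.1).intervalIntegrable
    · exact hg.continuousOn.stronglyMeasurableAtFilter isOpen_Ioi u hu
  refine hder.unique ((hasDerivAt_const u (0 : ℝ)).congr_of_eventuallyEq ?_)
  filter_upwards [lt_mem_nhds (half_lt_self hu)] with x hx
  exact hii _ _ (half_pos hu) hx.le

theorem PowerDecay.eq_zero_of_normSqTransform (hg : PowerDecay p g) (hp : (d : ℝ) + 1 < 2 * p)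
    (h0 : ∀ v, 0 < v → normSqTransform d g v = 0) {u : ℝ} (hu : 0 < u) : g u = 0 := by
  induction d generalizing u with
  | zero => rw [← normSqTransform_zero g u]; exact h0 u hu
  | succ k ih =>
    push_cast at hp
    refine ih (by linarith) (fun v hv => ?_) hu
    refine (hg.transform (by linarith)).eq_zero_of_normSqTransform_two (by linarith)
      (fun w hw => ?_) hv
    rw [(hg.transform (by linarith)).normSqTransform_succ (d := 1)
      (by push_cast; linarith) hw]
    have h1 : ∀ x : ℝ, normSqTransform 1 (normSqTransform k g) (w + x ^ 2) = 0 :=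
      fun x => by
        have hx : 0 < w + x ^ 2 := by positivity
        rw [(hg.transform (by linarith)).normSqTransform_succ (d := 0)
          (by push_cast; linarith) hx]
        simp_rw [normSqTransform_zero]
        rw [← hg.normSqTransform_succ (by linarith) hx, h0 _ hx]
    simp_rw [h1, integral_zero]

end NormSqTransform

section Rigidity

variable {d : ℕ} {α B : ℝ} {f : ℝ → ℝ}

theorem continuousOn_Ioi_of_abs_sub_le
    (hLip : ∀ a b, 0 < a → a ≤ b → |f b - f a| ≤ B / a * (b - a)) : ContinuousOn f (Ioi 0) := by
  intro x hx
  have hx : 0 < x := hx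
  have hB : 0 ≤ B := by
    have := (abs_nonneg _).trans (hLip 1 2 one_pos one_le_two)
    norm_num at this
    exact this
  refine ContinuousAt.continuousWithinAt ?_
  rw [ContinuousAt, tendsto_iff_dist_tendsto_zero]
  have hlim : Tendsto (fun y => B / (x / 2) * |y - x|) (𝓝 x) (𝓝 0) := by
    have : ContinuousAt (fun y => B / (x / 2) * |y - x|) x := by fun_prop
    simpa [ContinuousAt] using this
  refine squeeze_zero' (Eventually.of_forall fun _ => dist_nonneg) ?_ hlim
  filter_upwards [lt_mem_nhds (half_lt_self hx)] with y hy
  have hy0 : 0 < y := (half_pos hx).trans hy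
  rw [Real.dist_eq]
  rcases le_total x y with h | h
  · rw [abs_of_nonneg (sub_nonneg.2 h)]
    refine (hLip x y hx h).trans ?_
    have := sub_nonneg.2 h
    gcongr
    linarith
  · rw [abs_sub_comm, abs_sub_comm y, abs_of_nonneg (sub_nonneg.2 h)]
    refine (hLip y x hy0 h).trans ?_
    have := sub_nonneg.2 h
    gcongr

theorem rpow_neg_sub_rpow_neg_add_le {p u h : ℝ} (hp : 0 ≤ p) (hu : 0 < u) (hh : 0 ≤ h) :
    |u ^ (-p) - (u + h) ^ (-p)| ≤ p * h * u ^ (-(p + 1)) := by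
  have h1 : (u + h) ^ (-p) ≤ u ^ (-p) :=
    Real.rpow_le_rpow_of_nonpos hu (by linarith) (by linarith)
  have hq : 0 < 1 + h / u := by positivity
  have h2 : (u + h) ^ (-p) = u ^ (-p) * (1 + h / u) ^ (-p) := by
    rw [← Real.mul_rpow hu.le hq.le]; congr 1; field_simp
  have h3 : 1 - p * (h / u) ≤ (1 + h / u) ^ (-p) := by
    rw [Real.rpow_def_of_pos hq]
    have h4 := Real.add_one_le_exp (Real.log (1 + h / u) * -p)
    have h5 := Real.log_le_sub_one_of_pos hq
    nlinarith
  have h6 : u ^ (-(p + 1)) = u ^ (-p) / u := by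
    rw [neg_add, ← sub_eq_add_neg, Real.rpow_sub_one hu.ne']
  have h7 : 0 < u ^ (-p) := by positivity
  rw [abs_of_nonneg (by linarith), h2, h6]
  have h8 : p * h * (u ^ (-p) / u) = u ^ (-p) * (p * (h / u)) := by ring
  rw [h8]
  nlinarith

theorem abs_comp_sqrt_sub_le (hLip : ∀ a b, 0 < a → a ≤ b → |f b - f a| ≤ B / a * (b - a))
    (hB : 0 ≤ B) {u h : ℝ} (hu : 0 < u) (hh : 0 ≤ h) : |f √u - f √(u + h)| ≤ B * h / u := by
  have hs : 0 < √u := Real.sqrt_pos.2 hu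
  have h1 : √(u + h) ≤ √u + h / √u := by
    refine Real.sqrt_le_iff.2 ⟨by positivity, ?_⟩
    have : (√u + h / √u) ^ 2 = √u ^ 2 + 2 * h + (h / √u) ^ 2 := by field_simp; ring
    rw [this, Real.sq_sqrt hu.le]
    nlinarith [sq_nonneg (h / √u)]
  rw [abs_sub_comm]
  refine (hLip _ _ hs (Real.sqrt_le_sqrt (by linarith))).trans ?_
  calc B / √u * (√(u + h) - √u) ≤ B / √u * (h / √u) := by gcongr; linarith
    _ = B * h / √u ^ 2 := by field_simp
    _ = _ := by rw [Real.sq_sqrt hu.le]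

theorem powerDecay_comp_sqrt (hf : ContinuousOn f (Ioi 0)) {M p : ℝ}
    (hM : ∀ t, 0 < t → |f t| ≤ M) : PowerDecay p fun u => f √u * u ^ (-p) := by
  have hM0 : 0 ≤ M := (abs_nonneg _).trans (hM 1 one_pos)
  refine ⟨ContinuousOn.mul ?_ ?_, M, hM0, fun u hu => ?_⟩
  · exact hf.comp (by fun_prop) fun u hu => Real.sqrt_pos.2 hu
  · exact fun u hu => (Real.continuousAt_rpow_const _ _ (Or.inl (ne_of_gt hu))).continuousWithinAt
  · rw [abs_mul, abs_of_pos (Real.rpow_pos_of_pos hu (-p))]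
    gcongr
    exact hM _ (Real.sqrt_pos.2 hu)

theorem powerDecay_sub_shift (hLip : ∀ a b, 0 < a → a ≤ b → |f b - f a| ≤ B / a * (b - a))
    (hB : 0 ≤ B) {M p h : ℝ} (hM : ∀ t, 0 < t → |f t| ≤ M) (hp : 0 ≤ p) (hh : 0 ≤ h) :
    PowerDecay (p + 1) fun u => f √u * u ^ (-p) - f √(u + h) * (u + h) ^ (-p) := by
  have hM0 : 0 ≤ M := (abs_nonneg _).trans (hM 1 one_pos)
  have hg := powerDecay_comp_sqrt (p := p) (continuousOn_Ioi_of_abs_sub_le hLip) hM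
  refine ⟨hg.continuousOn.sub (hg.continuousOn.comp (f := fun u => u + h) (by fun_prop)
    fun u hu => add_pos_of_pos_of_nonneg hu hh), B * h + M * (p * h), by positivity,
    fun u hu => ?_⟩
  have h1 := abs_comp_sqrt_sub_le hLip hB hu hh
  have h2 := rpow_neg_sub_rpow_neg_add_le hp hu hh
  have h3 := hM _ (Real.sqrt_pos.2 (add_pos_of_pos_of_nonneg hu hh))
  have h4 : 0 < u ^ (-p) := by positivity
  have h6 : u ^ (-(p + 1)) = u ^ (-p) / u := by
    rw [neg_add, ← sub_eq_add_neg, Real.rpow_sub_one hu.ne']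
  calc |f √u * u ^ (-p) - f √(u + h) * (u + h) ^ (-p)|
      = |(f √u - f √(u + h)) * u ^ (-p) + f √(u + h) * (u ^ (-p) - (u + h) ^ (-p))| := by
        congr 1; ring
    _ ≤ |f √u - f √(u + h)| * u ^ (-p) + |f √(u + h)| * |u ^ (-p) - (u + h) ^ (-p)| := by
        refine (abs_add_le _ _).trans (le_of_eq ?_)
        rw [abs_mul, abs_mul, abs_of_pos h4]
    _ ≤ B * h / u * u ^ (-p) + M * (p * h * u ^ (-(p + 1))) := by gcongr
    _ = _ := by rw [h6]; ring

theorem eq_zero_of_radialProfile_eq_zero (hα : 0 < α) (hB : 0 ≤ B)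
    (hLip : ∀ a b, 0 < a → a ≤ b → |f b - f a| ≤ B / a * (b - a)) {M : ℝ}
    (hM : ∀ t, 0 < t → |f t| ≤ M) (h0 : ∀ t, 0 < t → radialProfile d α f t = 0) {t : ℝ}
    (ht : 0 < t) : f t = 0 := by
  set p : ℝ := (d + α) / 2 with hp
  have hd : (0 : ℝ) ≤ d := Nat.cast_nonneg d
  have hp0 : 0 < p := by positivity
  have hM0 : 0 ≤ M := (abs_nonneg _).trans (hM 1 one_pos)
  set g : ℝ → ℝ := fun u => f √u * u ^ (-p) with hg
  have hgd : PowerDecay p g := powerDecay_comp_sqrt (continuousOn_Ioi_of_abs_sub_le hLip) hM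
  have htr : ∀ v, 0 < v → normSqTransform d g v = 0 := fun v hv => by
    rw [normSqTransform, integral_add_norm_sq d g hv]
    have h1 : ∀ ζ : ES d, g (v * (1 + ‖ζ‖ ^ 2)) =
        v ^ (-p) * (f (√v * √(1 + ‖ζ‖ ^ 2)) * (1 + ‖ζ‖ ^ 2) ^ (-(d + α) / 2)) := fun ζ => by
      simp only [hg]
      rw [Real.sqrt_mul hv.le, Real.mul_rpow hv.le (by positivity),
        show -(d + α) / 2 = -p by rw [hp]; ring]
      ring
    simp_rw [h1]
    rw [integral_const_mul]
    have := h0 √v (Real.sqrt_pos.2 hv)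
    rw [radialProfile] at this
    rw [this, mul_zero, mul_zero]
  have hshift : ∀ u h, 0 < u → 0 ≤ h → g u = g (u + h) := fun u h hu hh => by
    have h1 := (powerDecay_sub_shift hLip hB hM hp0.le hh).eq_zero_of_normSqTransform (d := d)
      (by rw [hp]; linarith) (fun v hv => ?_) hu
    · exact sub_eq_zero.1 h1
    · have h2 := htr v hv
      have h3 := htr (v + h) (add_pos_of_pos_of_nonneg hv hh)
      rw [normSqTransform] at h2 h3 ⊢
      have h4 := integral_sub (hgd.integrable (d := d) (by rw [hp]; linarith) hv)
        (hgd.integrable (d := d) (by rw [hp]; linarith) (add_pos_of_pos_of_nonneg hv hh))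
      rw [h2, h3, sub_zero] at h4
      rw [← h4]
      refine integral_congr_ae (Eventually.of_forall fun ζ => ?_)
      simp only [hg, add_right_comm]
  have hlim : Tendsto g atTop (𝓝 0) := by
    have h1 : Tendsto (fun u : ℝ => M * u ^ (-p)) atTop (𝓝 0) := by
      simpa using (tendsto_rpow_neg_atTop hp0).const_mul M
    refine squeeze_zero_norm' ?_ h1
    filter_upwards [eventually_gt_atTop 0] with u hu
    rw [hg, norm_mul, Real.norm_of_nonneg (Real.rpow_nonneg hu.le _)]
    gcongr
    exact hM _ (Real.sqrt_pos.2 hu)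
  have hu : 0 < t ^ 2 := by positivity
  have hconst : Tendsto (fun h => g (t ^ 2 + h)) atTop (𝓝 (g (t ^ 2))) := by
    refine tendsto_const_nhds.congr' ?_
    filter_upwards [eventually_ge_atTop 0] with h hh using hshift _ h hu hh
  have h5 := tendsto_nhds_unique hconst (hlim.comp (tendsto_atTop_add_const_left _ _ tendsto_id))
  rw [hg] at h5
  simp only [Real.sqrt_sq ht.le] at h5
  exact (mul_eq_zero.1 h5).resolve_right (Real.rpow_pos_of_pos hu _).ne'

end Rigidity

section Compactness

variable {d : ℕ} {α B c : ℝ}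

theorem exists_subseq_tendsto_pointwise {F : ℕ → ℝ → ℝ}
    (hF : ∀ i t, 0 < t → F i t ∈ Icc c B)
    (hLip : ∀ i a b, 0 < a → a ≤ b → |F i b - F i a| ≤ B / a * (b - a)) :
    ∃ (φ : ℕ → ℕ) (f : ℝ → ℝ), StrictMono φ ∧
      ∀ t, 0 < t → Tendsto (fun i => F (φ i) t) atTop (𝓝 (f t)) := by
  have hcomp : IsCompact (univ.pi fun _ : ℚ => Icc (min c 0) (max B 0)) :=
    isCompact_univ_pi fun _ => isCompact_Icc
  obtain ⟨G, -, φ, hφ, hG⟩ := hcomp.tendsto_subseq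
    (x := fun i (q : ℚ) => if 0 < q then F i q else 0) fun i q _ => by
      simp only
      split_ifs with hq
      · have := hF i q (Rat.cast_pos.2 hq)
        exact ⟨(min_le_left _ _).trans this.1, this.2.trans (le_max_left _ _)⟩
      · exact ⟨min_le_right _ _, le_max_right _ _⟩
  rw [tendsto_pi_nhds] at hG
  have hrat : ∀ q : ℚ, 0 < q → CauchySeq fun i => F (φ i) q := fun q hq => by
    have := hG q
    simp only [Function.comp_apply, hq, if_true] at this
    exact this.cauchySeq
  have hcauchy : ∀ t : ℝ, 0 < t → CauchySeq fun i => F (φ i) t := fun t ht => by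
    rw [Metric.cauchySeq_iff']
    intro ε hε
    have hlim : Tendsto (fun a : ℝ => B / a * (t - a)) (𝓝[<] t) (𝓝 0) := by
      have : ContinuousAt (fun a : ℝ => B / a * (t - a)) t := by
        have := ht.ne'
        fun_prop (disch := assumption)
      have h2 : Tendsto (fun a : ℝ => B / a * (t - a)) (𝓝 t) (𝓝 0) := by
        simpa [ContinuousAt] using this
      exact h2.mono_left nhdsWithin_le_nhds
    have hev := (hlim.eventually (gt_mem_nhds (by positivity : 0 < ε / 3))).and
      (Ioo_mem_nhdsLT ht)
    obtain ⟨l, hl, hsub⟩ := (mem_nhdsLT_iff_exists_Ioo_subset).1 hev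
    obtain ⟨q, hq1, hq2⟩ := exists_rat_btwn (show l < t from hl)
    obtain ⟨h1, h2⟩ := hsub ⟨hq1, hq2⟩
    obtain ⟨N, hN⟩ := Metric.cauchySeq_iff'.1 (hrat q (Rat.cast_pos.1 h2.1)) (ε / 3)
      (by positivity)
    refine ⟨N, fun i hi => ?_⟩
    have h3 := hLip (φ i) q t h2.1 h2.2.le
    have h4 := hLip (φ N) q t h2.1 h2.2.le
    have h5 := hN i hi
    rw [Real.dist_eq] at h5 ⊢
    rw [abs_lt] at h5 ⊢
    rw [abs_le] at h3 h4
    constructor <;> linarith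
  choose! f hf using fun t ht => cauchySeq_tendsto_of_complete (hcauchy t ht)
  exact ⟨φ, f, hφ, hf⟩

theorem tendsto_of_tendsto_radialProfile (hα : 0 < α) (hc : 0 < c) {Kt : ℝ → ℝ}
    (hKB : ∀ t, 0 < t → Kt t ∈ Icc c B)
    (hLip : ∀ a b, 0 < a → a ≤ b → |Kt b - Kt a| ≤ B / a * (b - a)) {ℓ : ℝ}
    (hℓ : Tendsto (radialProfile d α Kt) (𝓝[>] 0) (𝓝 ℓ)) :
    ∃ κ, Tendsto Kt (𝓝[>] 0) (𝓝 κ) := by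
  have hp : (d : ℝ) < d + α := by linarith
  have hC1 := integral_one_add_norm_sq_rpow_pos hp
  have hi := integrable_one_add_norm_sq_rpow hp
  have hKc := continuousOn_Ioi_of_abs_sub_le hLip
  have hB : 0 < B := hc.trans_le ((hKB 1 one_pos).1.trans (hKB 1 one_pos).2)
  set C1 := ∫ ζ : ES d, (1 + ‖ζ‖ ^ 2) ^ (-(d + α) / 2) with hC1_def
  refine ⟨ℓ / C1, tendsto_of_subseq_tendsto fun s hs => ?_⟩
  obtain ⟨hs0, hspos⟩ := tendsto_nhdsWithin_iff.1 hs
  obtain ⟨N, hN⟩ := eventually_atTop.1 hspos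
  have hpos : ∀ i, 0 < s (N + i) := fun i => hN _ (by omega)
  obtain ⟨φ, f, hφ, hf⟩ := exists_subseq_tendsto_pointwise (B := B) (c := c)
    (F := fun i t => Kt (s (N + i) * t)) (fun i t ht => hKB _ (mul_pos (hpos i) ht))
    (fun i a b ha hab => by
      have h0 := hpos i
      refine (hLip (s (N + i) * a) (s (N + i) * b) (by positivity) (by gcongr)).trans_eq ?_
      field_simp)
  have hfB : ∀ t, 0 < t → f t ∈ Icc c B := fun t ht =>
    isClosed_Icc.mem_of_tendsto (hf t ht) (Eventually.of_forall fun i => hKB _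
      (mul_pos (hpos _) ht))
  have hfLip : ∀ a b, 0 < a → a ≤ b → |f b - f a| ≤ B / a * (b - a) := fun a b ha hab => by
    refine le_of_tendsto ((hf b (ha.trans_le hab)).sub (hf a ha)).abs
      (Eventually.of_forall fun i => ?_)
    have h0 := hpos (φ i)
    refine (hLip (s (N + φ i) * a) (s (N + φ i) * b) (by positivity) (by gcongr)).trans_eq ?_
    field_simp
  have hfc := continuousOn_Ioi_of_abs_sub_le hfLip
  have hsφ : Tendsto (fun i => s (N + φ i)) atTop (𝓝 0) :=
    hs0.comp (tendsto_atTop_mono (fun i => Nat.le_add_left (φ i) N) hφ.tendsto_atTop)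
  have hprof : ∀ t, 0 < t → radialProfile d α f t = ℓ := fun t ht => by
    have h1 : Tendsto (fun i => radialProfile d α Kt (s (N + φ i) * t)) atTop (𝓝 ℓ) := by
      refine hℓ.comp (tendsto_nhdsWithin_iff.2 ⟨?_, Eventually.of_forall fun i =>
        mul_pos (hpos _) ht⟩)
      simpa using hsφ.mul_const t
    refine tendsto_nhds_unique ?_ h1
    simp only [radialProfile]
    refine tendsto_integral_of_dominated_convergence
      (fun ζ : ES d => B * (1 + ‖ζ‖ ^ 2) ^ (-(d + α) / 2)) (fun i => ?_) (hi.const_mul B)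
      (fun i => Eventually.of_forall fun ζ => ?_) (Eventually.of_forall fun ζ => ?_)
    · exact (continuous_profile_integrand hKc _
        (mul_pos (hpos _) ht)).aestronglyMeasurable
    · have h2 := hKB (s (N + φ i) * t * √(1 + ‖ζ‖ ^ 2)) (by have := hpos (φ i); positivity)
      rw [norm_mul, Real.norm_of_nonneg (hc.le.trans h2.1), Real.norm_of_nonneg (by positivity)]
      gcongr
      exact h2.2
    · refine Tendsto.mul_const _ ?_
      simpa only [mul_assoc] using hf (t * √(1 + ‖ζ‖ ^ 2)) (by positivity)
  have hzero := eq_zero_of_radialProfile_eq_zero (d := d) (f := fun t => f t - ℓ / C1) hα hB.le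
    (fun a b ha hab => by simpa using hfLip a b ha hab) (M := B + |ℓ / C1|)
    (fun t ht => (abs_sub _ _).trans (by
      gcongr
      rw [abs_of_nonneg (hc.le.trans (hfB t ht).1)]
      exact (hfB t ht).2))
    (fun t ht => by
      have h1 := hprof t ht
      rw [radialProfile] at h1 ⊢
      simp_rw [sub_mul]
      rw [integral_sub (integrable_profile_integrand hfc hfB hc hp ht) (hi.const_mul _),
        integral_const_mul, h1, ← hC1_def, div_mul_cancel₀ _ hC1.ne', sub_self]) one_pos
  refine ⟨fun i => N + φ i, ?_⟩
  rw [← sub_eq_zero.1 hzero]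
  simpa using hf 1 one_pos

end Compactness

section Main

variable {n d : ℕ} {α B c : ℝ} {K : ES n → ℝ} {Kt : ℝ → ℝ}

theorem KernelBounds.exists_tendsto_of_hasNTLimit (hα : 0 < α) (hK : KernelBounds K B c)
    (hrad : ∀ x : ES n, x ≠ 0 → K x = Kt ‖x‖) {ι : ES d →ₗᵢ[ℝ] ES n} {e : ES n} (he : ‖e‖ = 1)
    (heι : ∀ ζ, inner ℝ e (ι ζ) = 0) {a : ES d} {η L : ℝ} (hη : η ≤ 1)
    (hL : HasNTLimit (range ι) (fun x => ‖gradient (DK d α K (flatMeasure ι)) x‖) (ι a) η L) :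
    ∃ κ, 0 < κ ∧ Tendsto K (𝓝[≠] 0) (𝓝 κ) := by
  have hKB : ∀ t, 0 < t → Kt t ∈ Icc c B := fun t ht => hK.radial_mem_Icc hrad he ht
  obtain ⟨ℓ, hℓ⟩ := exists_tendsto_radialProfile hα hK hrad he heι hη hL
  obtain ⟨κ, hκ⟩ := tendsto_of_tendsto_radialProfile hα hK.pos_c hKB
    (fun a b ha hab => hK.abs_radial_sub_le hrad he ha hab) hℓ
  refine ⟨κ, hK.pos_c.trans_le (ge_of_tendsto hκ ?_), ?_⟩
  · filter_upwards [self_mem_nhdsWithin] with t ht using (hKB t ht).1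
  · refine (hκ.comp tendsto_norm_nhdsNE_zero).congr' ?_
    filter_upwards [self_mem_nhdsWithin] with x hx using (hrad x hx).symm

end Main

/-- for a distance-standard radial kernel `K`, the non-tangential limits of
`|∇D_{K,μ,α}|` exist `H^d`-a.e. (for every aperture) on the support of every `d`-Ahlfors
regular measure with `d`-rectifiable support, if and only if `K(λ·)` converges in
`C¹_loc(ℝⁿ∖{0})` to a positive constant as `λ ↓ 0`. -/
theorem radial_ntlimits_iff_blowup_constant
    (n d : ℕ) (hdn : d < n) (α : ℝ) (hα : 0 < α)
    (K : ES n → ℝ) (hK : DistStandard K)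
    (Kt : ℝ → ℝ) (hrad : ∀ x : ES n, x ≠ 0 → K x = Kt ‖x‖) :
    (∀ (μ : Measure (ES n)) (C₀ : ℝ), IsAhlfors (d : ℝ) μ C₀ →
      RectSet n d (msupp μ) →
      (∀ᵐ Q ∂((μH[(d : ℝ)]).restrict (msupp μ)),
        ∀ η ∈ Ioo (0 : ℝ) 1, ∃ L : ℝ,
          HasNTLimit (msupp μ) (fun x => ‖gradient (DK (d : ℝ) α K μ) x‖) Q η L))
      ↔
    (∃ c : ℝ, 0 < c ∧ ∀ A : Set (ES n), IsCompact A → A ⊆ {(0 : ES n)}ᶜ →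
      TendstoUniformlyOn (fun (lam : ℝ) (x : ES n) => K (lam • x))
        (fun _ => c) (𝓝[>] (0 : ℝ)) A ∧
      TendstoUniformlyOn (fun (lam : ℝ) (x : ES n) => fderiv ℝ (fun y => K (lam • y)) x)
        (fun _ => 0) (𝓝[>] (0 : ℝ)) A) := by
  obtain ⟨B, c, hKb⟩ := hK.exists_kernelBounds
  simp_rw [tendstoUniformlyOn_kernel_iff]
  constructor
  · intro h
    obtain ⟨ι, e, he, heι⟩ := exists_linearIsometry_orthogonal hdn
    obtain ⟨C, hC⟩ := exists_isAhlfors_flatMeasure ι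
    have hsupp := msupp_flatMeasure ι
    obtain ⟨Q, hQ, hlim⟩ := hC.exists_mem_of_ae (by rw [hsupp]; exact range_nonempty _)
      (h _ C hC (rectSet_flatMeasure ι))
    rw [hsupp] at hQ hlim
    obtain ⟨a, rfl⟩ := hQ
    obtain ⟨L, hL⟩ := hlim (1 / 2) ⟨by norm_num, by norm_num⟩
    obtain ⟨κ, hκ, hlimK⟩ := hKb.exists_tendsto_of_hasNTLimit hα hrad he heι (by norm_num) hL
    exact ⟨κ, hκ, hlimK, hKb.tendsto_norm_mul_norm_fderiv hlimK⟩
  · rintro ⟨κ, hκ, h1, h2⟩ μ C₀ hμ hR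
    have hae := hμ.ae_hasTangentBlowup hR
    have hnull : μH[(d : ℝ)] {Q ∈ msupp μ | ¬ HasTangentBlowup μ d Q} = 0 :=
      hμ.hausdorff_null (Nat.cast_nonneg d) (fun Q hQ => hQ.1)
        (measure_mono_null (fun Q hQ => hQ.2) (ae_iff.1 hae))
    rw [ae_restrict_iff' (isClosed_msupp μ).measurableSet, ae_iff]
    refine measure_mono_null (fun Q hQ => ?_) hnull
    rw [mem_ofPred_eq, Classical.not_imp] at hQ
    refine ⟨hQ.1, fun hT => hQ.2 fun η hη => ?_⟩
    obtain ⟨L, hL⟩ := hT.exists_hasNTLimit hμ hα hKb hQ.1 hκ h1 h2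
    exact ⟨L, hL η hη⟩
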